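/- arXiv:1511.02212 — 8 statements merged into one kernel-verified Lean document; each statement's English description precedes it below -/
import Mathlib

section
/- Let ℓ be a prime, f ∈ ℤ_ℓ[X] monic and irreducible over ℚ_ℓ, R = ℤ_ℓ[X]/(f), F = Frac(R), O_F the integral closure of ℤ_ℓ in F, and δ the ℓ-adic valuation of the discriminant of the power basis 1, x, …, x^{deg f − 1} of R over ℤ_ℓ. For every n ≥ 1 and every finitely generated R-submodule M of F^{⊕n} that spans F^{⊕n} over F, there exists g ∈ GL_n(F) such that R^{⊕n} ⊆ g·M ⊆ O_F^{⊕n}; in particular the ℤ_ℓ-length of O_F^{⊕n}/(g·M) is at most nδ. -/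
open Polynomial

/-- The order `R = ℤ_ℓ[X]/(f)`. -/
abbrev WeilOrder (ℓ : ℕ) [Fact ℓ.Prime] (f : Polynomial ℤ_[ℓ]) :=
  Polynomial ℤ_[ℓ] ⧸ Ideal.span {f}

/-- The image `x` of `X` in `R = ℤ_ℓ[X]/(f)`. -/
noncomputable def WeilOrder.gen (ℓ : ℕ) [Fact ℓ.Prime] (f : Polynomial ℤ_[ℓ]) :
    WeilOrder ℓ f :=
  Ideal.Quotient.mk (Ideal.span {f}) X

/-- The `ℓ`-adic valuation `δ` of the discriminant of the power basis
`1, x, …, x^{deg f − 1}` of `R = ℤ_ℓ[X]/(f)` over `ℤ_ℓ`. -/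
noncomputable def powerBasisDiscValuation (ℓ : ℕ) [Fact ℓ.Prime] (f : Polynomial ℤ_[ℓ]) : ℤ :=
  (Algebra.discr ℤ_[ℓ] (fun i : Fin f.natDegree => WeilOrder.gen ℓ f ^ (i : ℕ))).valuation

/-- `M` is an `R`-module of finite length at most `m`, expressed via the existence of a
composition series from `⊥` to `⊤` of length at most `m`. -/
def HasLengthLE (R M : Type*) [Ring R] [AddCommGroup M] [Module R M] (m : ℕ) : Prop :=
  ∃ s : CompositionSeries (Submodule R M), s.head = ⊥ ∧ s.last = ⊤ ∧ s.length ≤ m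

theorem PadicInt.ord_eq_valuation {p : ℕ} [Fact p.Prime] {x : ℤ_[p]} (hx : x ≠ 0) :
    Ring.ord ℤ_[p] x = x.valuation := by
  have hp : (p : ℤ_[p]) ∈ nonZeroDivisors ℤ_[p] := by
    simpa using (Fact.out : p.Prime).ne_zero
  conv_lhs => rw [PadicInt.unitCoeff_spec hx]
  rw [Ring.ord_mul_of_isUnit_left (Units.isUnit _), Ring.ord_pow hp,
    Ring.ord_of_irreducible PadicInt.irreducible_p]
  simp

/-- In a finite extension of `ℚ_[p]`, an element of spectral norm at most one is integral. -/
theorem Padic.isIntegral_of_spectralNorm_le_one {p : ℕ} [Fact p.Prime] {L : Type*} [Field L]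
    [Algebra ℚ_[p] L] [Algebra ℤ_[p] L] [IsScalarTower ℤ_[p] ℚ_[p] L]
    [Algebra.IsAlgebraic ℚ_[p] L] {x : L} (hx : spectralNorm ℚ_[p] L x ≤ 1) :
    IsIntegral ℤ_[p] x := by
  have hmonic : (minpoly ℚ_[p] x).Monic :=
    minpoly.monic (Algebra.IsAlgebraic.isAlgebraic x).isIntegral
  have hcoeff := (spectralValue_le_one_iff hmonic).1 hx
  have hlifts : minpoly ℚ_[p] x ∈ Polynomial.lifts (algebraMap ℤ_[p] ℚ_[p]) :=
    (Polynomial.lifts_iff_coeff_lifts _).2 fun n => ⟨⟨_, hcoeff n⟩, rfl⟩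
  obtain ⟨q, hq, -, hqm⟩ := Polynomial.lifts_and_degree_eq_and_monic hlifts hmonic
  refine ⟨q, hqm, ?_⟩
  rw [IsScalarTower.algebraMap_eq ℤ_[p] ℚ_[p] L, ← Polynomial.eval₂_map, hq]
  exact minpoly.aeval _ _

/-- The integral closure of `ℤ_[p]` in an algebraic extension of `ℚ_[p]` is a valuation ring. -/
noncomputable def Padic.integralClosureValuationSubring (p : ℕ) [Fact p.Prime] (L : Type*) [Field L]
    [Algebra ℚ_[p] L] [Algebra ℤ_[p] L] [IsScalarTower ℤ_[p] ℚ_[p] L]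
    [Algebra.IsAlgebraic ℚ_[p] L] : ValuationSubring L where
  toSubring := (integralClosure ℤ_[p] L).toSubring
  mem_or_inv_mem' x := by
    rcases le_total (spectralNorm ℚ_[p] L x) 1 with h | h
    · exact Or.inl (isIntegral_of_spectralNorm_le_one h)
    · refine Or.inr (isIntegral_of_spectralNorm_le_one ?_)
      have : spectralNorm ℚ_[p] L x⁻¹ = (spectralNorm ℚ_[p] L x)⁻¹ := by
        simp only [← spectralMulAlgNorm_def]
        exact map_inv₀ _ _
      rw [this]
      exact inv_le_one_of_one_le₀ h

/-- If `M` is a finitely generated submodule spanning `F^n`, then a basis of `F^n` chosen among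
generators of `M` with determinant of maximal valuation moves `M` between the standard lattices
of `R` and of the valuation ring `V ⊇ R`. -/
theorem ValuationSubring.exists_linearEquiv_pi_range_le_map {R F : Type*} [CommRing R] [Field F]
    [Algebra R F] (V : ValuationSubring F) (hV : ∀ r : R, algebraMap R F r ∈ V)
    {ι : Type*} [Fintype ι] [DecidableEq ι] (M : Submodule R (ι → F)) (hfg : M.FG)
    (hspan : Submodule.span F (M : Set (ι → F)) = ⊤) :
    ∃ g : (ι → F) ≃ₗ[F] (ι → F),
      Submodule.pi (Set.univ : Set ι) (fun _ => LinearMap.range (Algebra.linearMap R F)) ≤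
        M.map (g.toLinearMap.restrictScalars R) ∧
      ∀ v ∈ M.map (g.toLinearMap.restrictScalars R), ∀ i, v i ∈ V := by
  obtain ⟨S, hS⟩ := hfg
  have hSM : (S : Set (ι → F)) ⊆ M := hS ▸ Submodule.subset_span
  have hSspan : Submodule.span F (S : Set (ι → F)) = ⊤ := by
    rw [← hspan, ← hS, Submodule.span_span_of_tower]
  let e := Pi.basisFun F ι
  obtain ⟨s₁, hs₁⟩ : ∃ s : ι → S, e.det (fun i => (s i : ι → F)) ≠ 0 := by
    obtain ⟨b, hbS, hb, hli⟩ := exists_linearIndependent F (S : Set (ι → F))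
    let B : Module.Basis b F (ι → F) := .mk hli (by simp [hb, hSspan])
    let B' := B.reindex (B.indexEquiv e)
    refine ⟨fun i => ⟨B' i, hbS ?_⟩, ?_⟩
    · simp [B', B]
    · exact (e.isUnit_det B').ne_zero
  have : Nonempty (ι → S) := ⟨s₁⟩
  obtain ⟨s, hs⟩ := Finite.exists_max
    fun s : ι → S => V.valuation (e.det (fun i => (s i : ι → F)))
  set d := e.det (fun i => (s i : ι → F)) with hd
  have hd0 : d ≠ 0 := by
    intro h
    have := hs s₁
    rw [h, map_zero, le_zero_iff, map_eq_zero] at this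
    exact hs₁ this
  obtain ⟨hli, hsp⟩ := e.is_basis_iff_det.2 hd0.isUnit
  let B : Module.Basis ι F (ι → F) := .mk hli hsp.ge
  have hcoord (w : ι → F) (hw : w ∈ S) (i : ι) : B.equivFun w i ∈ V := by
    have h := LinearMap.congr_fun (e.det_smul_mk_coord_eq_det_update hli hsp.ge i) w
    have h' : d * B.equivFun w i =
        e.det (fun j => (Function.update s i ⟨w, hw⟩ j : ι → F)) := by
      refine Eq.trans h ?_
      change e.det (Function.update _ i w) = _
      congr 1
      ext j
      rcases eq_or_ne j i with rfl | hj <;> simp [*]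
    have hle := hs (Function.update s i ⟨w, hw⟩)
    rw [← h', map_mul] at hle
    rw [← V.valuation_le_one_iff]
    exact le_of_mul_le_mul_left (by simpa using hle)
      (zero_lt_iff.2 ((_root_.map_ne_zero _).2 hd0))
  refine ⟨B.equivFun, ?_, ?_⟩
  · intro v hv
    choose r hr using fun i => (Submodule.mem_pi.1 hv) i (Set.mem_univ i)
    refine ⟨∑ i, r i • (s i : ι → F),
      Submodule.sum_mem _ fun i _ => M.smul_mem _ (hSM (s i).2), ?_⟩
    have : ∑ i, r i • (s i : ι → F) = B.equivFun.symm v := by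
      rw [B.equivFun_symm_apply]
      refine Finset.sum_congr rfl fun i _ => ?_
      rw [← hr i, Algebra.linearMap_apply, algebraMap_smul]
      simp [B]
    exact (congrArg B.equivFun this).trans (B.equivFun.apply_symm_apply v)
  · rintro _ ⟨w, hw, rfl⟩ i
    rw [← hS] at hw
    induction hw using Submodule.span_induction with
    | mem w hw => exact hcoord w hw i
    | zero => simp
    | add x y _ _ hx hy => simpa using V.add_mem _ _ hx hy
    | smul r x _ hx =>
      have h := V.mul_mem _ _ (hV r) hx
      rw [← algebraMap_smul F r x]
      change B.equivFun (algebraMap R F r • x) i ∈ V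
      rw [map_smul]
      exact h

/-- For a submodule `N` of full rank in the integral closure `C` of a principal ideal domain in
a finite separable extension, the length of `C ⧸ N` is bounded by the order of the
discriminant of a basis of `N`. -/
theorem Module.length_integralClosure_quotient_le_ord_discr {A : Type*} (K : Type*) {L : Type*}
    [CommRing A]
    [IsDomain A] [IsPrincipalIdealRing A] [Field K] [Field L] [Algebra A K] [IsFractionRing A K]
    [Algebra A L] [Algebra K L] [IsScalarTower A K L] [FiniteDimensional K L]
    [Algebra.IsSeparable K L] {ι : Type*} [Fintype ι] [DecidableEq ι]
    {N : Submodule A (integralClosure A L)} (c : Module.Basis ι A N)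
    (hc : Fintype.card ι = Module.finrank K L) {D : A}
    (hD : Algebra.discr K (fun i => ((c i : integralClosure A L) : L)) = algebraMap A K D) :
    Module.length A (integralClosure A L ⧸ N) ≤ Ring.ord A D := by
  have : Module.IsTorsionFree A L := .trans_faithfulSMul A K L
  have hrank := IsIntegralClosure.rank A K L (integralClosure A L)
  have : Module.Free A (integralClosure A L) := IsIntegralClosure.module_free A K L _
  have : Module.Finite A (integralClosure A L) := IsIntegralClosure.finite A K L _
  let b₀ : Module.Basis ι A (integralClosure A L) :=
    (Module.finBasis A _).reindex (Fintype.equivOfCardEq (by simp [hc, hrank]))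
  have hN : Module.finrank A N = Module.finrank A (integralClosure A L) := by
    rw [Module.finrank_eq_card_basis c, hc, hrank]
  let a := Submodule.smithNormalFormCoeffs b₀ hN
  let b := Submodule.smithNormalFormTopBasis b₀ hN
  let ab := Submodule.smithNormalFormBotBasis b₀ hN
  have hab i : (ab i : integralClosure A L) = a i • b i :=
    Submodule.smithNormalFormBotBasis_def b₀ hN i
  let P : Matrix ι ι A := Matrix.diagonal a * ab.toMatrix c
  have hP : (fun i => ((c i : integralClosure A L) : L)) =
      Matrix.vecMul (fun i => ((b i : integralClosure A L) : L))
        ((P.map (algebraMap A K)).map (algebraMap K L)) := by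
    ext i
    conv_lhs => rw [← ab.sum_toMatrix_smul_self c i]
    simp only [Matrix.vecMul, dotProduct, P, Matrix.map_apply, Matrix.diagonal_mul,
      ← IsScalarTower.algebraMap_apply]
    simp only [hab, AddSubmonoidClass.coe_finsetSum, Submodule.coe_smul, Subalgebra.coe_smul]
    refine Finset.sum_congr rfl fun j _ => ?_
    rw [smul_smul, Algebra.smul_def, mul_comm (ab.toMatrix _ _ _), mul_comm]
  obtain ⟨E, hE⟩ := (IsIntegrallyClosed.isIntegral_iff (R := A) (K := K)).1
    (Algebra.discr_isIntegral K (fun i => (b i).2))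
  have hdvd : ∏ i, a i ∣ D := by
    have : D = P.det ^ 2 * E := by
      apply IsFractionRing.injective A K
      rw [← hD, hP, Algebra.discr_of_matrix_vecMul, ← hE, map_mul, map_pow, RingHom.map_det]
      rfl
    rw [this, Matrix.det_mul, Matrix.det_diagonal, mul_pow, sq (∏ i, a i)]
    exact ⟨_, by rw [mul_assoc, mul_assoc]⟩
  have ha (i : ι) : a i ∈ nonZeroDivisors A :=
    mem_nonZeroDivisors_of_ne_zero (Submodule.smithNormalFormCoeffs_ne_zero b₀ hN i)
  have hprod (s : Finset ι) : ∑ i ∈ s, Ring.ord A (a i) = Ring.ord A (∏ i ∈ s, a i) := by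
    classical
    induction s using Finset.induction_on with
    | empty => simp
    | insert i s hi ih => rw [Finset.sum_insert hi, Finset.prod_insert hi, Ring.ord_mul' A (ha i), ih]
  rw [(N.quotientEquivPiSpan b₀ hN).length_eq, Module.length_pi_of_fintype]
  exact (hprod _).trans_le (Ring.ord_le_ord_of_dvd hdvd)

theorem HasLengthLE.of_length_le {R M : Type*} [Ring R] [AddCommGroup M] [Module R M] {m : ℕ}
    (h : Module.length R M ≤ m) : HasLengthLE R M m := by
  have hfin : IsFiniteLength R M :=
    Module.length_ne_top_iff.1 (ne_top_of_le_ne_top (ENat.natCast_ne_top m) h)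
  obtain ⟨s, hs₁, hs₂⟩ := isFiniteLength_iff_exists_compositionSeries.1 hfin
  refine ⟨s, hs₁, hs₂, ?_⟩
  rw [← Module.length_compositionSeries s hs₁ hs₂] at h
  exact_mod_cast h

/-- The length of `C^n / Q` is at most `n` times that of `C / N` whenever `N^n ⊆ Q`. -/
theorem Module.length_pi_quotient_le {A L : Type*} [CommRing A] [AddCommGroup L] [Module A L]
    {ι : Type*} [Fintype ι] (C : Submodule A L) (N : Submodule A C)
    (Q : Submodule A (ι → L)) (hQ : ∀ v : ι → C, (∀ i, v i ∈ N) → (fun i => (v i : L)) ∈ Q) :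
    Module.length A (↥(Submodule.pi (Set.univ : Set ι) fun _ => C) ⧸
        Q.comap (Submodule.pi (Set.univ : Set ι) fun _ => C).subtype) ≤
      Fintype.card ι * Module.length A (C ⧸ N) := by
  classical
  let φ : (ι → C) →ₗ[A] ↥(Submodule.pi (Set.univ : Set ι) fun _ => C) :=
    (LinearMap.pi fun i => C.subtype ∘ₗ LinearMap.proj i).codRestrict _
      fun v => Submodule.mem_pi.2 fun i _ => (v i).2
  let ψ := (Submodule.pi (Set.univ : Set ι) fun _ => N).mapQ
    (Q.comap (Submodule.pi (Set.univ : Set ι) fun _ => C).subtype) φ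
    fun v hv => hQ v fun i => Submodule.mem_pi.1 hv i (Set.mem_univ i)
  have hφ : Function.Surjective φ := fun w =>
    ⟨fun i => ⟨w.1 i, Submodule.mem_pi.1 w.2 i (Set.mem_univ i)⟩, rfl⟩
  have hψ : Function.Surjective ψ := by
    intro y
    obtain ⟨w, rfl⟩ := Submodule.mkQ_surjective _ y
    obtain ⟨v, rfl⟩ := hφ w
    exact ⟨Submodule.Quotient.mk v, rfl⟩
  refine (Module.length_le_of_surjective ψ hψ).trans ?_
  rw [(Submodule.quotientPi fun _ : ι => N).length_eq, Module.length_pi]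
  simp

set_option maxHeartbeats 1000000 in
/-- For `f ∈ ℤ_ℓ[X]` monic and irreducible over `ℚ_ℓ`, `R = ℤ_ℓ[X]/(f)`, `F = Frac R`,
`O_F` the integral closure of `ℤ_ℓ` in `F`, and `δ` the `ℓ`-adic valuation of the
discriminant of the power basis of `R` over `ℤ_ℓ`: for every `n ≥ 1` and every finitely
generated `R`-submodule `M` of `F^n` spanning `F^n` over `F`, there is `g ∈ GL_n(F)` with
`R^n ⊆ g·M ⊆ O_F^n`, and moreover the `ℤ_ℓ`-length of `O_F^n/(g·M)` is at most `nδ`.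
(`IsDomain R` is a consequence of the hypotheses on `f`.) -/
theorem stmt_5 (ℓ : ℕ) [Fact ℓ.Prime] (f : Polynomial ℤ_[ℓ]) (hmonic : f.Monic)
    (hirr : Irreducible (f.map (algebraMap ℤ_[ℓ] ℚ_[ℓ])))
    [IsDomain (WeilOrder ℓ f)]
    (δ : ℕ) (hδ : (δ : ℤ) = powerBasisDiscValuation ℓ f)
    (n : ℕ) (hn : 1 ≤ n)
    (M : Submodule (WeilOrder ℓ f) (Fin n → FractionRing (WeilOrder ℓ f)))
    (hfg : M.FG)
    (hspan : Submodule.span (FractionRing (WeilOrder ℓ f))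
      (M : Set (Fin n → FractionRing (WeilOrder ℓ f))) = ⊤) :
    ∃ g : (Fin n → FractionRing (WeilOrder ℓ f)) ≃ₗ[FractionRing (WeilOrder ℓ f)]
        (Fin n → FractionRing (WeilOrder ℓ f)),
      Submodule.pi (Set.univ : Set (Fin n)) (fun _ : Fin n =>
          LinearMap.range
            (Algebra.linearMap (WeilOrder ℓ f) (FractionRing (WeilOrder ℓ f)))) ≤
        M.map (LinearMap.restrictScalars (WeilOrder ℓ f) g.toLinearMap) ∧
      (∀ v ∈ M.map (LinearMap.restrictScalars (WeilOrder ℓ f) g.toLinearMap), ∀ i : Fin n,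
        v i ∈ integralClosure ℤ_[ℓ] (FractionRing (WeilOrder ℓ f))) ∧
      HasLengthLE ℤ_[ℓ]
        (↥(Submodule.pi (Set.univ : Set (Fin n)) (fun _ : Fin n =>
            Subalgebra.toSubmodule
              (integralClosure ℤ_[ℓ] (FractionRing (WeilOrder ℓ f))))) ⧸
          Submodule.comap
            (Submodule.pi (Set.univ : Set (Fin n)) (fun _ : Fin n =>
              Subalgebra.toSubmodule
                (integralClosure ℤ_[ℓ] (FractionRing (WeilOrder ℓ f))))).subtype
            (Submodule.restrictScalars ℤ_[ℓ]
              (M.map (LinearMap.restrictScalars (WeilOrder ℓ f) g.toLinearMap))))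
        (n * δ) := by
  let R := WeilOrder ℓ f
  let F := FractionRing R
  let pb : PowerBasis ℤ_[ℓ] R := AdjoinRoot.powerBasis' hmonic
  have : Module.Free ℤ_[ℓ] R := .of_basis pb.basis
  have : Module.Finite ℤ_[ℓ] R := .of_basis pb.basis
  have hRF : Function.Injective (algebraMap R F) := IsFractionRing.injective R F
  have : FaithfulSMul R F := (faithfulSMul_iff_algebraMap_injective R F).2 hRF
  have : FaithfulSMul ℤ_[ℓ] F := .trans ℤ_[ℓ] R F
  let : Algebra ℚ_[ℓ] F :=
    (IsFractionRing.lift (A := ℤ_[ℓ]) (FaithfulSMul.algebraMap_injective ℤ_[ℓ] F)).toAlgebra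
  have : IsScalarTower ℤ_[ℓ] ℚ_[ℓ] F := .of_algebraMap_eq fun x =>
    (IsFractionRing.lift_algebraMap (FaithfulSMul.algebraMap_injective ℤ_[ℓ] F) x).symm
  let b := pb.basis.localizationLocalization ℚ_[ℓ] (nonZeroDivisors ℤ_[ℓ]) F
  have : FiniteDimensional ℚ_[ℓ] F := .of_basis b
  have hRint (r : R) : IsIntegral ℤ_[ℓ] (algebraMap R F r) :=
    (Algebra.IsIntegral.isIntegral r).algebraMap
  obtain ⟨g, hg₁, hg₂⟩ :=
    (Padic.integralClosureValuationSubring ℓ F).exists_linearEquiv_pi_range_le_map hRint M hfg hspan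
  refine ⟨g, hg₁, hg₂, HasLengthLE.of_length_le ?_⟩
  let j : R →ₐ[ℤ_[ℓ]] integralClosure ℤ_[ℓ] F :=
    ((Algebra.ofId R F).restrictScalars ℤ_[ℓ]).codRestrict _ hRint
  have hj : Function.Injective j := fun x y hxy => hRF (congrArg Subtype.val hxy)
  let c := pb.basis.map (LinearEquiv.ofInjective j.toLinearMap hj)
  set D := Algebra.discr ℤ_[ℓ] (fun i : Fin f.natDegree => WeilOrder.gen ℓ f ^ (i : ℕ))
  have hDpb : D = Algebra.discr ℤ_[ℓ] pb.basis :=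
    congrArg (Algebra.discr ℤ_[ℓ]) (funext fun i => (pb.basis_eq_pow i).symm)
  have hD : Algebra.discr ℚ_[ℓ] b = algebraMap ℤ_[ℓ] ℚ_[ℓ] D := by
    rw [hDpb]
    exact Algebra.discr_localizationLocalization ..
  have hD0 : D ≠ 0 := by
    rintro h
    exact Algebra.discr_not_zero_of_basis ℚ_[ℓ] b (by rw [hD, h, map_zero])
  have hlen : Module.length ℤ_[ℓ] (integralClosure ℤ_[ℓ] F ⧸ LinearMap.range j.toLinearMap) ≤ δ := by
    refine (Module.length_integralClosure_quotient_le_ord_discr ℚ_[ℓ] c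
      (Module.finrank_eq_card_basis b).symm (D := D) ?_).trans ?_
    · rw [← hD]
      congr 1
      ext i
      rw [Module.Basis.localizationLocalization_apply]
      rfl
    · rw [PadicInt.ord_eq_valuation hD0]
      have : (δ : ℤ) = D.valuation := hδ
      rw [Int.natCast_inj.1 this]
  refine (Module.length_pi_quotient_le
    (Subalgebra.toSubmodule (integralClosure ℤ_[ℓ] F)) (LinearMap.range j.toLinearMap) _ ?_).trans ?_
  · intro v hv
    refine hg₁ (Submodule.mem_pi.2 fun i _ => ?_)
    obtain ⟨r, hr⟩ := hv i
    exact ⟨r, congrArg Subtype.val hr⟩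
  · rw [Fintype.card_fin]
    push_cast
    exact mul_le_mul_right hlen _
end

section
/- Let ℓ be a prime, V a finite-dimensional ℚ_ℓ-vector space, and γ a ℚ_ℓ-linear automorphism of V whose characteristic polynomial χ_γ has all coefficients in ℤ_ℓ and whose minimal polynomial is squarefree (γ is semisimple). Let λ₁, …, λ_d be the roots of χ_γ in an algebraic closure of ℚ_ℓ, listed with multiplicity, and let v be the ℓ-adic valuation of the element ∏_{(i,j): λ_i ≠ λ_j} (λ_i − λ_j), which is Galois-invariant and hence lies in ℤ_ℓ. Then the centralizer Z = {g ∈ GL(V) : gγ = γg}, acting on the set of γ-stable lattices in V by L ↦ g(L), has at most (2ℓ)^{4v} orbits. -/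
open Polynomial

variable (ℓ : ℕ) [Fact ℓ.Prime] (V : Type*) [AddCommGroup V] [Module ℚ_[ℓ] V]
  [Module ℤ_[ℓ] V] [IsScalarTower ℤ_[ℓ] ℚ_[ℓ] V]

/-- A `γ`-stable lattice in `V`: a finitely generated `ℤ_ℓ`-submodule that spans `V` over
`ℚ_ℓ` and is carried into itself by `γ`. -/
def IsStableLattice (γ : V ≃ₗ[ℚ_[ℓ]] V) (L : Submodule ℤ_[ℓ] V) : Prop :=
  L.FG ∧ Submodule.span ℚ_[ℓ] (L : Set V) = ⊤ ∧ ∀ x ∈ L, γ x ∈ L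

/-- Two `γ`-stable lattices are related if some `ℚ_ℓ`-linear automorphism of `V`
commuting with `γ` (an element of the centralizer of `γ` in `GL(V)`) maps one to the
other. -/
def CentralizerRel (γ : V ≃ₗ[ℚ_[ℓ]] V)
    (L₁ L₂ : {L : Submodule ℤ_[ℓ] V // IsStableLattice ℓ V γ L}) : Prop :=
  ∃ g : V ≃ₗ[ℚ_[ℓ]] V, (∀ x, g (γ x) = γ (g x)) ∧
    Submodule.map (LinearMap.restrictScalars ℤ_[ℓ] (g : V →ₗ[ℚ_[ℓ]] V)) L₁.1 = L₂.1

theorem PadicInt.finite_quotient_span_singleton {ℓ : ℕ} [Fact ℓ.Prime] {a : ℤ_[ℓ]} (ha : a ≠ 0) :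
    Finite (ℤ_[ℓ] ⧸ Ideal.span {a}) ∧
      (Nat.card (ℤ_[ℓ] ⧸ Ideal.span {a}) : ℝ) = ‖a‖⁻¹ := by
  have h1 : Ideal.span {a} = RingHom.ker (PadicInt.toZModPow a.valuation (p := ℓ)) := by
    rw [PadicInt.ker_toZModPow]
    conv_lhs => rw [PadicInt.unitCoeff_spec ha]
    exact Ideal.span_singleton_mul_left_unit (Units.isUnit _) _
  have e : ℤ_[ℓ] ⧸ Ideal.span {a} ≃ ZMod (ℓ ^ a.valuation) :=
    ((Ideal.quotEquivOfEq h1).trans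
      (RingHom.quotientKerEquivOfSurjective (ZMod.ringHom_surjective _))).toEquiv
  have : NeZero (ℓ ^ a.valuation) := ⟨pow_ne_zero _ (Fact.out : ℓ.Prime).ne_zero⟩
  refine ⟨Finite.of_equiv _ e.symm, ?_⟩
  rw [Nat.card_congr e, Nat.card_zmod, PadicInt.norm_eq_zpow_neg_valuation ha]
  simp

theorem card_quotient_range_le {ℓ : ℕ} [Fact ℓ.Prime] {M : Type*} [AddCommGroup M]
    [Module ℤ_[ℓ] M] {ι : Type*} [Fintype ι] (b : Module.Basis ι ℤ_[ℓ] M)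
    (f : M →ₗ[ℤ_[ℓ]] M) (hf : LinearMap.det f ≠ 0) :
    Finite (M ⧸ LinearMap.range f) ∧
      (Nat.card (M ⧸ LinearMap.range f) : ℝ) ≤ ‖LinearMap.det f‖⁻¹ := by
  classical
  have := Module.Free.of_basis b
  have := Module.Finite.of_basis b
  have hinj : Function.Injective f := by
    refine (injective_iff_map_eq_zero f).mpr fun x hx =>
      b.repr.injective (DFunLike.coe_injective ?_)
    have h := LinearMap.toMatrix_mulVec_repr b b f x
    rw [hx, map_zero, Finsupp.coe_zero] at h
    rw [map_zero, Finsupp.coe_zero]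
    exact Matrix.eq_zero_of_mulVec_eq_zero (by rwa [LinearMap.det_toMatrix]) h
  have hr : Module.finrank ℤ_[ℓ] (LinearMap.range f) = Module.finrank ℤ_[ℓ] M :=
    LinearMap.finrank_range_of_inj hinj
  set N := LinearMap.range f with hN
  let a := Submodule.smithNormalFormCoeffs b hr
  have ha : ∀ i, a i ≠ 0 := Submodule.smithNormalFormCoeffs_ne_zero b hr
  let b' := Submodule.smithNormalFormTopBasis b hr
  let e := Submodule.quotientEquivPiSpan N b hr
  have hfin : ∀ i, Finite (ℤ_[ℓ] ⧸ Ideal.span {a i}) :=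
    fun i => (PadicInt.finite_quotient_span_singleton (ha i)).1
  refine ⟨Finite.of_equiv _ e.symm.toEquiv, ?_⟩
  have hcard : (Nat.card (M ⧸ N) : ℝ) = (∏ i, ‖a i‖)⁻¹ := by
    rw [Nat.card_congr e.toEquiv, Nat.card_pi, Nat.cast_prod, ← Finset.prod_inv_distrib]
    exact Finset.prod_congr rfl fun i _ => (PadicInt.finite_quotient_span_singleton (ha i)).2
  rw [hcard]
  have hdvd : ∀ i j, a i ∣ LinearMap.toMatrix b' b' f i j := by
    intro i j
    rw [LinearMap.toMatrix_apply]
    have hmem : f (b' j) ∈ N := ⟨_, rfl⟩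
    let bN := Submodule.smithNormalFormBotBasis b hr
    have h2 := congrArg (Subtype.val) (bN.sum_repr ⟨_, hmem⟩)
    simp only [Submodule.coe_sum, Submodule.coe_smul] at h2
    rw [← h2]
    simp only [bN, Submodule.smithNormalFormBotBasis_def, map_sum, map_smul,
      Finsupp.coe_finsetSum, Finset.sum_apply]
    refine Finset.dvd_sum fun k _ => ?_
    change a i ∣ (bN.repr ⟨_, hmem⟩ k • a k • b'.repr (b' k)) i
    rw [Module.Basis.repr_self]
    by_cases hk : k = i
    · subst hk; simp
    · simp [hk]
  choose c hc using hdvd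
  have hm : LinearMap.toMatrix b' b' f = Matrix.diagonal a * Matrix.of c := by
    ext i j
    rw [Matrix.diagonal_mul, hc]; rfl
  have hdet : LinearMap.det f = (∏ i, a i) * (Matrix.of c).det := by
    rw [← LinearMap.det_toMatrix b', hm, Matrix.det_mul, Matrix.det_diagonal]
  have h3 : ‖LinearMap.det f‖ ≤ ∏ i, ‖a i‖ := by
    rw [hdet, norm_mul, norm_prod]
    exact mul_le_of_le_one_right (Finset.prod_nonneg fun _ _ => norm_nonneg _)
      (PadicInt.norm_le_one _)
  exact inv_anti₀ (norm_pos_iff.mpr hf) h3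

/-- The ideal `ℓ I` of `ℤ_ℓ[X]`. -/
noncomputable abbrev primeMul (ℓ : ℕ) [Fact ℓ.Prime] (I : Ideal ℤ_[ℓ][X]) : Ideal ℤ_[ℓ][X] :=
  Submodule.map (LinearMap.mulLeft ℤ_[ℓ][X] (C (ℓ : ℤ_[ℓ]))) I

/-- The ideal `(I : ℓ)` of `ℤ_ℓ[X]`. -/
noncomputable abbrev primeColon (ℓ : ℕ) [Fact ℓ.Prime] (I : Ideal ℤ_[ℓ][X]) : Ideal ℤ_[ℓ][X] :=
  Submodule.comap (LinearMap.mulLeft ℤ_[ℓ][X] (C (ℓ : ℤ_[ℓ]))) I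

theorem card_quotient_prime_smul_le {ℓ : ℕ} [Fact ℓ.Prime] {M : Type*} [AddCommGroup M]
    [Module ℤ_[ℓ] M] {r : ℕ} (b : Module.Basis (Fin r) ℤ_[ℓ] M) :
    Finite (M ⧸ LinearMap.range ((ℓ : ℤ_[ℓ]) • (LinearMap.id : M →ₗ[ℤ_[ℓ]] M))) ∧
      Nat.card (M ⧸ LinearMap.range ((ℓ : ℤ_[ℓ]) • (LinearMap.id : M →ₗ[ℤ_[ℓ]] M))) ≤ ℓ ^ r := by
  have hℓ : (ℓ : ℤ_[ℓ]) ≠ 0 := by exact_mod_cast (Fact.out : ℓ.Prime).ne_zero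
  have := Module.Free.of_basis b
  have hdet : LinearMap.det ((ℓ : ℤ_[ℓ]) • (LinearMap.id : M →ₗ[ℤ_[ℓ]] M)) = (ℓ : ℤ_[ℓ]) ^ r := by
    rw [LinearMap.det_smul, LinearMap.det_id, mul_one, Module.finrank_eq_card_basis b,
      Fintype.card_fin]
  obtain ⟨h1, h2⟩ := card_quotient_range_le b ((ℓ : ℤ_[ℓ]) • (LinearMap.id : M →ₗ[ℤ_[ℓ]] M))
    (by rw [hdet]; exact pow_ne_zero _ hℓ)
  refine ⟨h1, ?_⟩
  rw [hdet, norm_pow, PadicInt.norm_p, inv_pow, inv_inv] at h2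
  exact_mod_cast h2

theorem ncard_ideals_of_colon_le {ℓ : ℕ} [Fact ℓ.Prime] (I' : Ideal ℤ_[ℓ][X]) (d : ℕ) :
    {I : Ideal ℤ_[ℓ][X] | ∃ f : ℤ_[ℓ][X], f.Monic ∧ f.natDegree = d ∧ f ∈ I' ∧
      I = Ideal.span {f} ⊔ primeMul ℓ I'}.Finite ∧
    {I : Ideal ℤ_[ℓ][X] | ∃ f : ℤ_[ℓ][X], f.Monic ∧ f.natDegree = d ∧ f ∈ I' ∧
      I = Ideal.span {f} ⊔ primeMul ℓ I'}.ncard ≤ ℓ ^ d := by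
  set G := {I : Ideal ℤ_[ℓ][X] | ∃ f : ℤ_[ℓ][X], f.Monic ∧ f.natDegree = d ∧ f ∈ I' ∧
      I = Ideal.span {f} ⊔ primeMul ℓ I'} with hG
  rcases G.eq_empty_or_nonempty with h | ⟨_, f₀, hf₀, hd₀, hm₀, -⟩
  · rw [h]; simp
  let M : Submodule ℤ_[ℓ] ℤ_[ℓ][X] := degreeLT ℤ_[ℓ] d ⊓ I'.restrictScalars ℤ_[ℓ]
  let b0 : Module.Basis (Fin d) ℤ_[ℓ] (degreeLT ℤ_[ℓ] d) :=
    Module.Basis.ofEquivFun (degreeLTEquiv ℤ_[ℓ] d)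
  obtain ⟨r, b⟩ := Submodule.basisOfPidOfLE (inf_le_left : M ≤ _) b0
  have hr : r ≤ d := by
    have := Module.Finite.of_basis b0
    have := Submodule.finrank_mono (inf_le_left : M ≤ degreeLT ℤ_[ℓ] d)
    rwa [Module.finrank_eq_card_basis b, Module.finrank_eq_card_basis b0, Fintype.card_fin,
      Fintype.card_fin] at this
  obtain ⟨h1, h2⟩ := card_quotient_prime_smul_le (M := M) b
  set Q := M ⧸ LinearMap.range ((ℓ : ℤ_[ℓ]) • (LinearMap.id : M →ₗ[ℤ_[ℓ]] M)) with hQ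
  let φ : Q → Ideal ℤ_[ℓ][X] := fun q =>
    Ideal.span {f₀ + ((q.out : M) : ℤ_[ℓ][X])} ⊔ primeMul ℓ I'
  have hsub : G ⊆ Set.range φ := by
    rintro I ⟨f, hf, hd, hm, rfl⟩
    have hlt : f - f₀ ∈ degreeLT ℤ_[ℓ] d := by
      rw [mem_degreeLT]
      rcases Nat.eq_zero_or_pos d with h0 | hpos
      · rw [hf.natDegree_eq_zero.mp (hd.trans h0), hf₀.natDegree_eq_zero.mp (hd₀.trans h0)]
        simp
      · have : f.degree = d := by rw [degree_eq_natDegree hf.ne_zero, hd]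
        rw [← this]
        refine degree_sub_lt_left ?_ hf.ne_zero (by rw [hf.leadingCoeff, hf₀.leadingCoeff])
        rw [degree_eq_natDegree hf.ne_zero, degree_eq_natDegree hf₀.ne_zero, hd, hd₀]
    let m : M := ⟨f - f₀, hlt, I'.sub_mem hm hm₀⟩
    refine ⟨Submodule.Quotient.mk m, ?_⟩
    have hout : (Submodule.Quotient.mk ((Submodule.Quotient.mk m : Q).out) : Q) =
      Submodule.Quotient.mk m := Quotient.out_eq _
    rw [Submodule.Quotient.eq] at hout
    obtain ⟨y, hy⟩ := hout
    have hy' : C (ℓ : ℤ_[ℓ]) * (y : ℤ_[ℓ][X]) =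
        (((Submodule.Quotient.mk m : Q).out : M) : ℤ_[ℓ][X]) - (f - f₀) := by
      rw [← smul_eq_C_mul]
      exact congrArg (fun z : M => (z : ℤ_[ℓ][X])) hy
    have hmem : f₀ + (((Submodule.Quotient.mk m : Q).out : M) : ℤ_[ℓ][X]) - f
        ∈ primeMul ℓ I' := ⟨_, y.2.2, by rw [LinearMap.mulLeft_apply]; exact hy'.trans (by ring)⟩
    change Ideal.span {f₀ + _} ⊔ _ = _
    set g := f₀ + (((Submodule.Quotient.mk m : Q).out : M) : ℤ_[ℓ][X])
    apply le_antisymm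
    · refine sup_le ((Ideal.span_singleton_le_iff_mem _).mpr ?_) le_sup_right
      have := Submodule.add_mem_sup (Ideal.mem_span_singleton_self f) hmem
      rwa [add_sub_cancel] at this
    · refine sup_le ((Ideal.span_singleton_le_iff_mem _).mpr ?_) le_sup_right
      have := Submodule.sub_mem _ (Submodule.mem_sup_left (T := primeMul ℓ I')
        (Ideal.mem_span_singleton_self g)) (Submodule.mem_sup_right hmem)
      rwa [sub_sub_cancel] at this
  have hfin := Set.finite_range φ
  refine ⟨hfin.subset hsub, (Set.ncard_le_ncard hsub hfin).trans ?_⟩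
  calc (Set.range φ).ncard ≤ Nat.card Q := by
        rw [← Set.image_univ, ← Set.ncard_univ]; exact Set.ncard_image_le Set.finite_univ
    _ ≤ ℓ ^ r := h2
    _ ≤ ℓ ^ d := Nat.pow_le_pow_right (Fact.out : ℓ.Prime).pos hr

theorem exists_eq_C_mul_of_map_toZMod_eq_zero {ℓ : ℕ} [Fact ℓ.Prime] {p : ℤ_[ℓ][X]}
    (hp : p.map (PadicInt.toZMod (p := ℓ)) = 0) : ∃ a, p = C (ℓ : ℤ_[ℓ]) * a := by
  change C (ℓ : ℤ_[ℓ]) ∣ p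
  rw [C_dvd_iff_dvd_coeff]
  intro i
  rw [← Ideal.mem_span_singleton, ← PadicInt.maximalIdeal_eq_span_p, ← PadicInt.ker_toZMod,
    RingHom.mem_ker, ← coeff_map, hp, coeff_zero]

theorem exists_monic_of_finite_quotient {ℓ : ℕ} [Fact ℓ.Prime] (I : Ideal ℤ_[ℓ][X])
    [Finite (ℤ_[ℓ][X] ⧸ I)] :
    ∃ f : ℤ_[ℓ][X], f.Monic ∧ f ∈ I ∧ I = Ideal.span {f} ⊔ primeMul ℓ (primeColon ℓ I) ∧
      Finite (ℤ_[ℓ][X] ⧸ primeColon ℓ I) ∧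
      Nat.card (ℤ_[ℓ][X] ⧸ primeColon ℓ I) * ℓ ^ f.natDegree ≤ Nat.card (ℤ_[ℓ][X] ⧸ I) := by
  set ρ : ℤ_[ℓ][X] →+* (ZMod ℓ)[X] := mapRingHom (PadicInt.toZMod (p := ℓ)) with hρ
  have hsurj0 : Function.Surjective (PadicInt.toZMod (p := ℓ)) := ZMod.ringHom_surjective _
  have hsurj : Function.Surjective ρ := map_surjective _ hsurj0
  set J := I.map ρ with hJ
  let ψ : ℤ_[ℓ][X] ⧸ I →+* (ZMod ℓ)[X] ⧸ J := Ideal.quotientMap J ρ Ideal.le_comap_map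
  have hψ : Function.Surjective ψ := Ideal.quotientMap_surjective hsurj
  have hfinJ : Finite ((ZMod ℓ)[X] ⧸ J) := Finite.of_surjective _ hψ
  have hJ0 : J ≠ ⊥ := by
    intro h
    rw [h] at hfinJ
    have : Finite (ZMod ℓ)[X] := Finite.of_equiv _ (RingEquiv.quotientBot _).toEquiv
    exact not_finite (ZMod ℓ)[X]
  obtain ⟨g, hgm, hgJ⟩ : ∃ g : (ZMod ℓ)[X], g.Monic ∧ J = Ideal.span {g} := by
    have h0 : Submodule.IsPrincipal.generator J ≠ 0 := fun h =>
      hJ0 ((Submodule.IsPrincipal.eq_bot_iff_generator_eq_zero J).mpr h)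
    refine ⟨_, monic_mul_leadingCoeff_inv h0, ?_⟩
    rw [Ideal.span_singleton_mul_right_unit, Ideal.span_singleton_generator]
    exact isUnit_C.mpr (isUnit_iff_ne_zero.mpr (inv_ne_zero (leadingCoeff_ne_zero.mpr h0)))
  obtain ⟨h, hhg, hhd, hhm⟩ := lifts_and_natDegree_eq_and_monic
    (f := PadicInt.toZMod (p := ℓ)) (p := g)
    ((lifts_iff_coeff_lifts _).mpr fun n => hsurj0 _) hgm
  obtain ⟨u, huI, hu⟩ : ∃ u ∈ I, ρ u = g :=
    (Ideal.mem_map_iff_of_surjective ρ hsurj).mp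
      (by rw [← hJ, hgJ]; exact Ideal.mem_span_singleton_self g)
  obtain ⟨a, ha⟩ := exists_eq_C_mul_of_map_toZMod_eq_zero (ℓ := ℓ) (p := h - u) (by
    change ρ (h - u) = 0
    rw [map_sub, hu, sub_eq_zero]; exact hhg)
  set d := g.natDegree with hd
  let π : ℤ_[ℓ][X] →ₗ[ℤ_[ℓ]] ℤ_[ℓ][X] ⧸ I := (Ideal.Quotient.mkₐ ℤ_[ℓ] I).toLinearMap
  have hnak : (⊤ : Submodule ℤ_[ℓ] (ℤ_[ℓ][X] ⧸ I)) ≤ (degreeLT ℤ_[ℓ] d).map π := by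
    have : Module.Finite ℤ_[ℓ] (ℤ_[ℓ][X] ⧸ I) := inferInstance
    refine Submodule.le_of_le_smul_of_le_jacobson_bot (I := IsLocalRing.maximalIdeal ℤ_[ℓ])
      Module.Finite.fg_top (IsLocalRing.maximalIdeal_le_jacobson _) ?_
    rintro x -
    obtain ⟨p, rfl⟩ := Ideal.Quotient.mk_surjective x
    have hp : p = p %ₘ h + u * (p /ₘ h) + (ℓ : ℤ_[ℓ]) • (a * (p /ₘ h)) := by
      conv_lhs => rw [← modByMonic_add_div p h]
      rw [smul_eq_C_mul, sub_eq_iff_eq_add.mp ha]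
      ring
    have hp2 : Ideal.Quotient.mk I p = π (p %ₘ h) + (ℓ : ℤ_[ℓ]) • π (a * (p /ₘ h)) := by
      have h0 : π (u * (p /ₘ h)) = 0 := Ideal.Quotient.eq_zero_iff_mem.mpr (I.mul_mem_right _ huI)
      conv_lhs => rw [hp]
      change π _ = _
      rw [map_add, map_add, h0, add_zero, map_smul]
    rw [hp2]
    refine Submodule.add_mem_sup ⟨_, ?_, rfl⟩ (Submodule.smul_mem_smul ?_ trivial)
    · rw [SetLike.mem_coe, mem_degreeLT]
      refine (degree_modByMonic_lt p hhm).trans_eq ?_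
      rw [degree_eq_natDegree hhm.ne_zero, hhd]
    · rw [PadicInt.maximalIdeal_eq_span_p]; exact Ideal.mem_span_singleton_self _
  obtain ⟨r, hr, hrX⟩ := hnak (trivial : π (X ^ d) ∈ (⊤ : Submodule ℤ_[ℓ] (ℤ_[ℓ][X] ⧸ I)))
  have hr' : r.degree < (X ^ d : ℤ_[ℓ][X]).degree := by
    rw [degree_X_pow]; exact mem_degreeLT.mp hr
  have hfm : (X ^ d - r).Monic := (monic_X_pow d).sub_of_left hr'
  have hfd : (X ^ d - r).natDegree = d := by
    rw [natDegree_eq_of_degree_eq (degree_sub_eq_left_of_degree_lt hr'), natDegree_X_pow]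
  have hfI : X ^ d - r ∈ I := Ideal.Quotient.eq.mp hrX.symm
  set f := X ^ d - r with hf
  have hρf : ρ f = g := by
    refine (eq_of_monic_of_dvd_of_natDegree_le hgm (hfm.map _) ?_ ?_)
    · rw [← Ideal.mem_span_singleton, ← hgJ]; exact Ideal.mem_map_of_mem ρ hfI
    · exact (natDegree_map_le).trans_eq hfd
  let μ : (ℤ_[ℓ][X] ⧸ primeColon ℓ I) →ₗ[ℤ_[ℓ][X]] (ℤ_[ℓ][X] ⧸ I) :=
    Submodule.mapQ _ _ (LinearMap.mulLeft ℤ_[ℓ][X] (C (ℓ : ℤ_[ℓ]))) le_rfl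
  have hμ : Function.Injective μ := by
    refine (injective_iff_map_eq_zero μ).mpr fun x hx => ?_
    obtain ⟨p, rfl⟩ := Submodule.Quotient.mk_surjective _ x
    have hx' : (Submodule.Quotient.mk (C (ℓ : ℤ_[ℓ]) * p) : ℤ_[ℓ][X] ⧸ I) = 0 := hx
    exact (Submodule.Quotient.mk_eq_zero _).mpr ((Submodule.Quotient.mk_eq_zero I).mp hx')
  have hμψ : ∀ x, μ x ∈ ψ.toAddMonoidHom.ker := by
    intro x
    obtain ⟨p, rfl⟩ := Submodule.Quotient.mk_surjective _ x
    change Ideal.Quotient.mk J (ρ (C (ℓ : ℤ_[ℓ]) * p)) = 0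
    simp [hρ]
  refine ⟨f, hfm, hfI, le_antisymm ?_ ?_, Finite.of_injective _ hμ, ?_⟩
  · intro y hy
    have hy' : ρ y ∈ Ideal.span {g} := hgJ ▸ Ideal.mem_map_of_mem ρ hy
    obtain ⟨c, hc⟩ := Ideal.mem_span_singleton'.mp hy'
    obtain ⟨c', rfl⟩ := hsurj c
    obtain ⟨b, hb⟩ := exists_eq_C_mul_of_map_toZMod_eq_zero (ℓ := ℓ) (p := y - c' * f) (by
      change ρ (y - c' * f) = 0
      rw [map_sub, map_mul, hρf, hc, sub_self])
    have hbI : b ∈ primeColon ℓ I := by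
      change C (ℓ : ℤ_[ℓ]) * b ∈ I
      rw [← hb]
      exact I.sub_mem hy (I.mul_mem_left _ hfI)
    rw [← sub_add_cancel y (c' * f), add_comm, hb]
    exact Submodule.add_mem_sup (Ideal.mul_mem_left _ _ (Ideal.mem_span_singleton_self f))
      ⟨b, hbI, rfl⟩
  · refine sup_le ((Ideal.span_singleton_le_iff_mem _).mpr hfI) ?_
    rintro _ ⟨b, hb, rfl⟩
    exact hb
  · have hcardJ : Nat.card ((ZMod ℓ)[X] ⧸ J) = ℓ ^ d := by
      rw [hgJ] at hfinJ ⊢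
      have : Module.Finite (ZMod ℓ) ((ZMod ℓ)[X] ⧸ Ideal.span {g}) := inferInstance
      rw [Module.natCard_eq_pow_finrank (K := ZMod ℓ), Nat.card_zmod,
        finrank_quotient_span_eq_natDegree]
    rw [AddSubgroup.card_eq_card_quotient_mul_card_addSubgroup ψ.toAddMonoidHom.ker,
      Nat.card_congr (QuotientAddGroup.quotientKerEquivOfSurjective ψ.toAddMonoidHom hψ).toEquiv,
      hcardJ, hfd, mul_comm]
    refine Nat.mul_le_mul_left _ ?_
    exact Nat.card_le_card_of_injective (fun x => (⟨μ x, hμψ x⟩ : ψ.toAddMonoidHom.ker))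
      fun x y hxy => hμ (congrArg Subtype.val hxy)

theorem ncard_ideals_le (ℓ : ℕ) [Fact ℓ.Prime] (n : ℕ) :
    {I : Ideal ℤ_[ℓ][X] | Finite (ℤ_[ℓ][X] ⧸ I) ∧ Nat.card (ℤ_[ℓ][X] ⧸ I) ≤ ℓ ^ n}.Finite ∧
    {I : Ideal ℤ_[ℓ][X] | Finite (ℤ_[ℓ][X] ⧸ I) ∧
      Nat.card (ℤ_[ℓ][X] ⧸ I) ≤ ℓ ^ n}.ncard ≤ (2 * ℓ) ^ n := by
  have hℓ : 1 < ℓ := (Fact.out : ℓ.Prime).one_lt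
  induction n using Nat.strong_induction_on with
  | _ n ih =>
  set F : ℕ → Set (Ideal ℤ_[ℓ][X]) := fun n =>
    {I : Ideal ℤ_[ℓ][X] | Finite (ℤ_[ℓ][X] ⧸ I) ∧ Nat.card (ℤ_[ℓ][X] ⧸ I) ≤ ℓ ^ n} with hF
  let G : Ideal ℤ_[ℓ][X] → ℕ → Set (Ideal ℤ_[ℓ][X]) := fun I' d =>
    {I : Ideal ℤ_[ℓ][X] | ∃ f : ℤ_[ℓ][X], f.Monic ∧ f.natDegree = d ∧ f ∈ I' ∧
      I = Ideal.span {f} ⊔ primeMul ℓ I'}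
  have hG : ∀ I' d, (G I' d).Finite ∧ (G I' d).ncard ≤ ℓ ^ d := ncard_ideals_of_colon_le
  have hsub : F n ⊆ {⊤} ∪ ⋃ d ∈ Finset.Icc 1 n, ⋃ I' ∈ F (n - d), G I' d := by
    rintro I ⟨hfin, hcard⟩
    obtain ⟨f, hfm, hfI, hI, hfin', hle⟩ := exists_monic_of_finite_quotient I
    rcases Nat.eq_zero_or_pos f.natDegree with h0 | hpos
    · left
      rw [hfm.natDegree_eq_zero.mp h0] at hfI
      exact (Ideal.eq_top_iff_one I).mpr hfI
    · right
      have hdn : f.natDegree ≤ n := by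
        refine (Nat.pow_le_pow_iff_right hℓ).mp (le_trans ?_ (hle.trans hcard))
        exact Nat.le_mul_of_pos_left _ Nat.card_pos
      simp only [Set.mem_iUnion]
      refine ⟨f.natDegree, Finset.mem_Icc.mpr ⟨hpos, hdn⟩, primeColon ℓ I, ⟨hfin', ?_⟩,
        f, hfm, rfl, ?_, hI⟩
      · have h1 := hle.trans hcard
        rw [← Nat.sub_add_cancel hdn, pow_add] at h1
        exact Nat.le_of_mul_le_mul_right h1 (pow_pos (by lia) _)
      · exact I.mul_mem_left _ hfI
  have hin : ∀ d ∈ Finset.Icc 1 n, (⋃ I' ∈ F (n - d), G I' d).Finite ∧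
      (⋃ I' ∈ F (n - d), G I' d).ncard ≤ (2 * ℓ) ^ (n - d) * ℓ ^ d := by
    intro d hd
    rw [Finset.mem_Icc] at hd
    obtain ⟨h1, h2⟩ := ih (n - d) (by lia)
    refine ⟨h1.biUnion fun I' _ => (hG I' d).1, ?_⟩
    have : (⋃ I' ∈ F (n - d), G I' d) = ⋃ I' ∈ h1.toFinset, G I' d := by simp [hF]
    rw [this]
    refine (Finset.set_ncard_biUnion_le _ _).trans ?_
    refine (Finset.sum_le_card_nsmul _ _ (ℓ ^ d) fun I' _ => (hG I' d).2).trans ?_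
    rw [smul_eq_mul, ← Set.ncard_eq_toFinset_card _ h1]
    exact Nat.mul_le_mul_right _ h2
  have hfin : ({⊤} ∪ ⋃ d ∈ Finset.Icc 1 n, ⋃ I' ∈ F (n - d), G I' d).Finite :=
    (Set.finite_singleton _).union ((Finset.finite_toSet _).biUnion fun d hd => (hin d hd).1)
  refine ⟨hfin.subset hsub, (Set.ncard_le_ncard hsub hfin).trans ?_⟩
  have hgeom : ∑ d ∈ Finset.Icc 1 n, 2 ^ (n - d) = 2 ^ n - 1 := by
    suffices h : ∀ m : ℕ, ∑ d ∈ Finset.Icc 1 m, 2 ^ (m - d) + 1 = 2 ^ m by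
      have := h n; lia
    intro m
    induction m with
    | zero => simp
    | succ m ihm =>
      have h1 : ∑ d ∈ Finset.Icc 1 m, 2 ^ (m + 1 - d) = 2 * ∑ d ∈ Finset.Icc 1 m, 2 ^ (m - d) := by
        rw [Finset.mul_sum]
        refine Finset.sum_congr rfl fun d hd => ?_
        rw [Finset.mem_Icc] at hd
        rw [← pow_succ', Nat.sub_add_comm hd.2]
      rw [Finset.sum_Icc_succ_top (by lia), h1, Nat.sub_self, pow_zero, pow_succ]
      lia
  calc _ ≤ 1 + ∑ d ∈ Finset.Icc 1 n, (2 * ℓ) ^ (n - d) * ℓ ^ d := by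
        refine (Set.ncard_union_le _ _).trans (add_le_add (Set.ncard_singleton _).le ?_)
        exact (Finset.set_ncard_biUnion_le _ _).trans (Finset.sum_le_sum fun d hd => (hin d hd).2)
    _ = 1 + ∑ d ∈ Finset.Icc 1 n, 2 ^ (n - d) * ℓ ^ n := by
        congr 1
        refine Finset.sum_congr rfl fun d hd => ?_
        rw [Finset.mem_Icc] at hd
        rw [mul_pow, mul_assoc, ← pow_add, Nat.sub_add_cancel hd.2]
    _ ≤ (2 * ℓ) ^ n := by
        rw [← Finset.sum_mul, hgeom, mul_pow, Nat.sub_mul, one_mul]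
        have h1 : ℓ ^ n ≤ 2 ^ n * ℓ ^ n := Nat.le_mul_of_pos_left _ (by positivity)
        have h2 : 1 ≤ ℓ ^ n := Nat.one_le_pow _ _ (by lia)
        lia

/-- The centralizer of `γ` has at most `B` orbits on `γ`-stable lattices. -/
def HasOrbitBound {ℓ : ℕ} [Fact ℓ.Prime] {V : Type*} [AddCommGroup V] [Module ℚ_[ℓ] V]
    [Module ℤ_[ℓ] V] [IsScalarTower ℤ_[ℓ] ℚ_[ℓ] V] (γ : V →ₗ[ℚ_[ℓ]] V) (B : ℝ) : Prop :=
  ∃ S : Finset (Submodule ℤ_[ℓ] V), (S.card : ℝ) ≤ B ∧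
    ∀ L : Submodule ℤ_[ℓ] V, L.FG → Submodule.span ℚ_[ℓ] (L : Set V) = ⊤ → (∀ x ∈ L, γ x ∈ L) →
      ∃ g : V ≃ₗ[ℚ_[ℓ]] V, (∀ x, g (γ x) = γ (g x)) ∧
        Submodule.map (LinearMap.restrictScalars ℤ_[ℓ] (g : V →ₗ[ℚ_[ℓ]] V)) L ∈ S

theorem isIntegral_of_norm_coeff_le_one {ℓ : ℕ} [Fact ℓ.Prime] {A : Type*} [Ring A]
    [Algebra ℚ_[ℓ] A] [Algebra ℤ_[ℓ] A] [IsScalarTower ℤ_[ℓ] ℚ_[ℓ] A] {p : ℚ_[ℓ][X]} (hp : p.Monic)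
    (hc : ∀ i, ‖p.coeff i‖ ≤ 1) {z : A} (hz : aeval z p = 0) : IsIntegral ℤ_[ℓ] z := by
  obtain ⟨q, hq, -, hqm⟩ := lifts_and_natDegree_eq_and_monic (f := algebraMap ℤ_[ℓ] ℚ_[ℓ])
    ((lifts_iff_coeff_lifts p).mpr fun n => ⟨⟨p.coeff n, hc n⟩, rfl⟩) hp
  refine ⟨q, hqm, ?_⟩
  rw [← aeval_def, ← aeval_map_algebraMap ℚ_[ℓ], hq, hz]

theorem card_lattice_quotient_le {ℓ : ℕ} [Fact ℓ.Prime] {V : Type*} [AddCommGroup V]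
    [Module ℚ_[ℓ] V] [Module ℤ_[ℓ] V] [IsScalarTower ℤ_[ℓ] ℚ_[ℓ] V] [FiniteDimensional ℚ_[ℓ] V]
    (L : Submodule ℤ_[ℓ] V) (hfg : L.FG) (hspan : Submodule.span ℚ_[ℓ] (L : Set V) = ⊤)
    (f : V →ₗ[ℚ_[ℓ]] V) (hf : ∀ x ∈ L, f x ∈ L) (hdet : LinearMap.det f ≠ 0) :
    Finite (L ⧸ LinearMap.range ((f.restrictScalars ℤ_[ℓ]).restrict hf)) ∧
      (Nat.card (L ⧸ LinearMap.range ((f.restrictScalars ℤ_[ℓ]).restrict hf)) : ℝ) ≤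
        ‖LinearMap.det f‖⁻¹ := by
  classical
  have : Submodule.IsLattice ℚ_[ℓ] L := ⟨hfg, hspan⟩
  have : Module.Free ℤ_[ℓ] L := Submodule.IsLattice.free ℚ_[ℓ] L
  let b := Module.Free.chooseBasis ℤ_[ℓ] L
  let b' := b.extendOfIsLattice ℚ_[ℓ]
  set f' := (f.restrictScalars ℤ_[ℓ]).restrict hf with hf'
  have hrepr : ∀ (x : L) i, b'.repr x i = algebraMap ℤ_[ℓ] ℚ_[ℓ] (b.repr x i) := by
    intro x i
    have h : (x : V) = ∑ j, (algebraMap ℤ_[ℓ] ℚ_[ℓ] (b.repr x j)) • b' j := by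
      have h := congrArg Subtype.val (b.sum_repr x)
      rw [Submodule.coe_sum] at h
      rw [← h]
      refine Finset.sum_congr rfl fun j _ => ?_
      rw [algebraMap_smul, Module.Basis.extendOfIsLattice_apply]
      rfl
    rw [h, Module.Basis.repr_sum_self]
  have hd : LinearMap.det f = algebraMap ℤ_[ℓ] ℚ_[ℓ] (LinearMap.det f') := by
    rw [← LinearMap.det_toMatrix b', ← LinearMap.det_toMatrix b, RingHom.map_det]
    congr 1
    ext i j
    rw [RingHom.mapMatrix_apply, Matrix.map_apply, LinearMap.toMatrix_apply,
      LinearMap.toMatrix_apply, ← hrepr, Module.Basis.extendOfIsLattice_apply]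
    rfl
  have hn : ‖LinearMap.det f‖ = ‖LinearMap.det f'‖ := by rw [hd]; rfl
  rw [hn]
  refine card_quotient_range_le b f' fun h => hdet ?_
  rw [hd, h, map_zero]

theorem exists_max_spectralNorm {ℓ : ℕ} [Fact ℓ.Prime] {E : Type*} [Field E] [Algebra ℚ_[ℓ] E]
    [Algebra ℤ_[ℓ] E] [IsScalarTower ℤ_[ℓ] ℚ_[ℓ] E] [FiniteDimensional ℚ_[ℓ] E]
    (L : Submodule ℤ_[ℓ] E) (hfg : L.FG) (hspan : Submodule.span ℚ_[ℓ] (L : Set E) = ⊤) :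
    ∃ y ∈ L, y ≠ 0 ∧ ∀ z ∈ L, IsIntegral ℤ_[ℓ] (y⁻¹ * z) := by
  classical
  obtain ⟨s, rfl⟩ := hfg
  let N := spectralMulAlgNorm ℚ_[ℓ] E
  have hs : s.Nonempty := by
    by_contra h
    rw [Finset.not_nonempty_iff_eq_empty] at h
    subst h
    have : (1 : E) ∈ (⊤ : Submodule ℚ_[ℓ] E) := trivial
    rw [← hspan] at this
    simp at this
  obtain ⟨y, hys, hy⟩ := s.exists_max_image N hs
  have hmax : ∀ z ∈ Submodule.span ℤ_[ℓ] (s : Set E), N z ≤ N y := by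
    intro z hz
    induction hz using Submodule.span_induction with
    | mem x hx => exact hy x hx
    | zero => rw [map_zero]; exact apply_nonneg _ _
    | add a b _ _ ha hb =>
      exact (isNonarchimedean_spectralNorm a b).trans (max_le ha hb)
    | smul a x _ hx =>
      rw [← algebraMap_smul ℚ_[ℓ] a x, map_smul_eq_mul]
      exact (mul_le_of_le_one_left (apply_nonneg _ _) (PadicInt.norm_le_one a)).trans hx
  have hy0 : y ≠ 0 := by
    rintro rfl
    have h0 : Submodule.span ℤ_[ℓ] (s : Set E) = ⊥ := by
      refine (Submodule.eq_bot_iff _).mpr fun z hz => ?_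
      have := hmax z hz
      rw [map_zero] at this
      exact (map_eq_zero_iff_eq_zero N).mp (le_antisymm this (apply_nonneg _ _))
    rw [h0] at hspan
    have : (1 : E) ∈ (⊤ : Submodule ℚ_[ℓ] E) := trivial
    rw [← hspan] at this
    simp at this
  refine ⟨y, Submodule.subset_span hys, hy0, fun z hz => ?_⟩
  have hle : spectralNorm ℚ_[ℓ] E (y⁻¹ * z) ≤ 1 := by
    change N (y⁻¹ * z) ≤ 1
    rw [map_mul, map_inv₀]
    have hpos : 0 < N y := (apply_nonneg N y).lt_of_ne' (map_ne_zero_iff_ne_zero N |>.mpr hy0)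
    rw [inv_mul_le_iff₀ hpos, mul_one]
    exact hmax z hz
  have hint : IsIntegral ℚ_[ℓ] (y⁻¹ * z) := Algebra.IsIntegral.isIntegral _
  exact isIntegral_of_norm_coeff_le_one (minpoly.monic hint)
    ((spectralValue_le_one_iff (minpoly.monic hint)).mp hle) (minpoly.aeval _ _)

open scoped Pointwise in
theorem exists_aeval_eq_derivative_mul {ℓ : ℕ} [Fact ℓ.Prime] {E : Type*} [Field E]
    [Algebra ℚ_[ℓ] E] [Algebra ℤ_[ℓ] E] [IsScalarTower ℤ_[ℓ] ℚ_[ℓ] E] [FiniteDimensional ℚ_[ℓ] E]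
    {α : E} (hα : Algebra.adjoin ℚ_[ℓ] {α} = ⊤) (hint : IsIntegral ℤ_[ℓ] α) {z : E}
    (hz : IsIntegral ℤ_[ℓ] z) :
    ∃ p : ℤ_[ℓ][X], aeval α p = aeval α (derivative (minpoly ℚ_[ℓ] α)) * z := by
  have hδ : aeval α (derivative (minpoly ℚ_[ℓ] α)) ≠ 0 :=
    (Algebra.IsSeparable.isSeparable ℚ_[ℓ] α).aeval_derivative_ne_zero (minpoly.aeval _ _)
  have hmem : z ∈ (Algebra.traceForm ℚ_[ℓ] E).dualSubmodule
      (Subalgebra.toSubmodule (Algebra.adjoin ℤ_[ℓ] {α})) := by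
    rw [LinearMap.BilinForm.mem_dualSubmodule]
    intro r hr
    have hr' : IsIntegral ℤ_[ℓ] r :=
      Algebra.adjoin_le_iff (S := integralClosure ℤ_[ℓ] E).mpr
        (Set.singleton_subset_iff.mpr hint) hr
    have := IsIntegrallyClosed.isIntegral_iff.mp
      (Algebra.isIntegral_trace (L := ℚ_[ℓ]) (hz.mul hr'))
    rw [Submodule.mem_one, Algebra.traceForm_apply]
    exact this
  rw [traceForm_dualSubmodule_adjoin ℤ_[ℓ] ℚ_[ℓ] hα hint] at hmem
  obtain ⟨w, hw, rfl⟩ := hmem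
  have hw' : w ∈ Algebra.adjoin ℤ_[ℓ] {α} := hw
  rw [Algebra.adjoin_singleton_eq_range_aeval] at hw'
  obtain ⟨p, hp⟩ := hw'
  refine ⟨p, hp.trans ?_⟩
  simp [hδ]

theorem aeval_mul_mem_of_stable {R E : Type*} [CommRing R] [CommRing E] [Algebra R E] {α : E}
    {L : Submodule R E} (hL : ∀ x ∈ L, α * x ∈ L) (p : R[X]) {x : E} (hx : x ∈ L) :
    aeval α p * x ∈ L := by
  induction p using Polynomial.induction_on' with
  | add p q hp hq => rw [map_add, add_mul]; exact L.add_mem hp hq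
  | monomial n a =>
    rw [aeval_monomial, mul_assoc, ← Algebra.smul_def]
    refine L.smul_mem a ?_
    induction n with
    | zero => simpa using hx
    | succ n ih => rw [pow_succ', mul_assoc]; exact hL _ ih

theorem hasOrbitBound_mulLeft {ℓ : ℕ} [Fact ℓ.Prime] {E : Type*} [Field E]
    [Algebra ℚ_[ℓ] E] [Algebra ℤ_[ℓ] E] [IsScalarTower ℤ_[ℓ] ℚ_[ℓ] E] [FiniteDimensional ℚ_[ℓ] E]
    {α : E} (hα : Algebra.adjoin ℚ_[ℓ] {α} = ⊤) (hint : IsIntegral ℤ_[ℓ] α) :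
    HasOrbitBound (LinearMap.mulLeft ℚ_[ℓ] α)
      ((‖Algebra.norm ℚ_[ℓ] (aeval α (derivative (minpoly ℚ_[ℓ] α)))‖⁻¹) ^ 2) := by
  classical
  set δ := aeval α (derivative (minpoly ℚ_[ℓ] α)) with hδdef
  have hδ : δ ≠ 0 :=
    (Algebra.IsSeparable.isSeparable ℚ_[ℓ] α).aeval_derivative_ne_zero (minpoly.aeval _ _)
  obtain ⟨pδ, hpδ⟩ := exists_aeval_eq_derivative_mul hα hint (isIntegral_one (R := ℤ_[ℓ]) (B := E))
  rw [mul_one, ← hδdef] at hpδ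
  have hδint : IsIntegral ℤ_[ℓ] δ := by
    rw [← hpδ, ← mem_integralClosure_iff]
    refine (Algebra.adjoin_le_iff (S := integralClosure ℤ_[ℓ] E)).mpr
      (Set.singleton_subset_iff.mpr hint) (aeval_mem_adjoin_singleton _ _)
  obtain ⟨n, hn⟩ : ∃ n : ℕ, ‖Algebra.norm ℚ_[ℓ] δ‖⁻¹ = (ℓ : ℝ) ^ n := by
    obtain ⟨t, ht⟩ := IsIntegrallyClosed.isIntegral_iff.mp
      (Algebra.isIntegral_norm ℚ_[ℓ] hδint)
    have ht0 : t ≠ 0 := by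
      rintro rfl
      rw [map_zero] at ht
      exact hδ (Algebra.norm_eq_zero_iff.mp ht.symm)
    refine ⟨t.valuation, ?_⟩
    rw [← ht, show ‖algebraMap ℤ_[ℓ] ℚ_[ℓ] t‖ = ‖t‖ from rfl,
      PadicInt.norm_eq_zpow_neg_valuation ht0, zpow_neg, inv_inv, zpow_natCast]
  obtain ⟨hfin, hcard⟩ := ncard_ideals_le ℓ n
  refine ⟨hfin.toFinset.image fun I => (I.restrictScalars ℤ_[ℓ]).map (aeval α).toLinearMap, ?_, ?_⟩
  · rw [hn]
    have h1 : (hfin.toFinset.image fun I : Ideal ℤ_[ℓ][X] =>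
        (I.restrictScalars ℤ_[ℓ]).map (aeval α).toLinearMap).card ≤ (2 * ℓ) ^ n :=
      Finset.card_image_le.trans (by rwa [← Set.ncard_eq_toFinset_card _ hfin])
    have h2 : (2 * ℓ) ^ n ≤ (ℓ ^ n) ^ 2 := by
      rw [← pow_mul, mul_comm n 2, pow_mul, sq]
      exact Nat.pow_le_pow_left (Nat.mul_le_mul_right _ (Fact.out : ℓ.Prime).two_le) n
    exact_mod_cast h1.trans h2
  intro L hfg hspan hL
  have hL : ∀ x ∈ L, α * x ∈ L := hL
  obtain ⟨y, hyL, hy0, hy⟩ := exists_max_spectralNorm L hfg hspan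
  let u : E ≃ₗ[ℚ_[ℓ]] E :=
    (LinearEquiv.smulOfNeZero E E y⁻¹ (inv_ne_zero hy0)).restrictScalars ℚ_[ℓ]
  have hu : ∀ x, u x = y⁻¹ * x := fun x => rfl
  let g : E ≃ₗ[ℚ_[ℓ]] E :=
    (LinearEquiv.smulOfNeZero E E (δ * y⁻¹) (mul_ne_zero hδ (inv_ne_zero hy0))).restrictScalars
      ℚ_[ℓ]
  have hg : ∀ x, g x = δ * y⁻¹ * x := fun x => rfl
  let L' := L.map (LinearMap.restrictScalars ℤ_[ℓ] (u : E →ₗ[ℚ_[ℓ]] E))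
  let G := L.map (LinearMap.restrictScalars ℤ_[ℓ] (g : E →ₗ[ℚ_[ℓ]] E))
  have hL'mem : ∀ z, z ∈ L' ↔ ∃ x ∈ L, y⁻¹ * x = z := fun z => Iff.rfl
  have hGmem : ∀ z, z ∈ G ↔ ∃ x ∈ L, δ * y⁻¹ * x = z := fun z => Iff.rfl
  have hGL' : ∀ z, z ∈ G ↔ ∃ x ∈ L', δ * x = z := by
    intro z
    rw [hGmem]
    constructor
    · rintro ⟨x, hx, rfl⟩
      exact ⟨_, ⟨x, hx, rfl⟩, (mul_assoc _ _ _).symm⟩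
    · rintro ⟨_, ⟨x, hx, rfl⟩, rfl⟩
      exact ⟨x, hx, mul_assoc _ _ _⟩
  have hL'α : ∀ x ∈ L', α * x ∈ L' := by
    rintro _ ⟨x, hx, rfl⟩
    exact ⟨α * x, hL x hx, mul_left_comm _ _ _⟩
  have hGα : ∀ x ∈ G, α * x ∈ G := by
    rintro _ ⟨x, hx, rfl⟩
    exact ⟨α * x, hL x hx, mul_left_comm _ _ _⟩
  have h1L' : (1 : E) ∈ L' := ⟨y, hyL, inv_mul_cancel₀ hy0⟩
  have hL'fg : L'.FG := hfg.map _
  have hL'span : Submodule.span ℚ_[ℓ] (L' : Set E) = ⊤ := by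
    have : (L' : Set E) = (u : E →ₗ[ℚ_[ℓ]] E) '' (L : Set E) := rfl
    rw [this, Submodule.span_image, hspan, Submodule.map_top, LinearEquiv.range]
  refine ⟨g, fun x => by simp only [hg, LinearMap.mulLeft_apply]; ring, ?_⟩
  have hδL' : ∀ x ∈ L', LinearMap.mulLeft ℚ_[ℓ] δ x ∈ L' := fun x hx => by
    rw [LinearMap.mulLeft_apply, ← hpδ]
    exact aeval_mul_mem_of_stable hL'α pδ hx
  have hdet : LinearMap.det (LinearMap.mulLeft ℚ_[ℓ] δ) = Algebra.norm ℚ_[ℓ] δ := rfl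
  obtain ⟨hQ, hQcard⟩ := card_lattice_quotient_le L' hL'fg hL'span (LinearMap.mulLeft ℚ_[ℓ] δ) hδL'
    (by rw [hdet]; exact fun h => hδ (Algebra.norm_eq_zero_iff.mp h))
  rw [hdet, hn] at hQcard
  let I : Ideal ℤ_[ℓ][X] :=
    { carrier := {p | aeval α p ∈ G}
      add_mem' := fun {a b} ha hb => by
        simp only [Set.mem_ofPred_eq, map_add] at *; exact G.add_mem ha hb
      zero_mem' := by simp
      smul_mem' := fun c p hp => by
        simp only [Set.mem_ofPred_eq, smul_eq_mul, map_mul] at *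
        exact aeval_mul_mem_of_stable hGα c hp }
  have hImem : ∀ p, p ∈ I ↔ aeval α p ∈ G := fun p => Iff.rfl
  have hmemL' : ∀ p : ℤ_[ℓ][X], aeval α p ∈ L' := fun p => by
    simpa using aeval_mul_mem_of_stable hL'α p h1L'
  set R := LinearMap.range (((LinearMap.mulLeft ℚ_[ℓ] δ).restrictScalars ℤ_[ℓ]).restrict hδL')
    with hR
  let F : ℤ_[ℓ][X] ⧸ I → L' ⧸ R := fun q => R.mkQ ⟨aeval α q.out, hmemL' _⟩
  have hF : Function.Injective F := by
    intro a b hab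
    have h := (Submodule.Quotient.eq R).mp hab
    obtain ⟨⟨x, hx⟩, hxe⟩ := h
    have hxe := congrArg Subtype.val hxe
    have hx2 : δ * x = aeval α (a.out - b.out) := by rw [map_sub]; exact hxe
    have : a.out - b.out ∈ I := by
      rw [hImem, hGL']
      exact ⟨x, hx, hx2⟩
    rw [← Quotient.out_eq a, ← Quotient.out_eq b]
    exact Ideal.Quotient.eq.mpr this
  have hfinI : Finite (ℤ_[ℓ][X] ⧸ I) := Finite.of_injective F hF
  have hcardI : Nat.card (ℤ_[ℓ][X] ⧸ I) ≤ ℓ ^ n := by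
    have h1 := Nat.card_le_card_of_injective F hF
    have h2 : Nat.card (L' ⧸ R) ≤ ℓ ^ n := by exact_mod_cast hQcard
    exact h1.trans h2
  refine Finset.mem_image.mpr ⟨I, hfin.mem_toFinset.mpr ⟨hfinI, hcardI⟩, ?_⟩
  change _ = G
  ext z
  constructor
  · rintro ⟨p, hp, rfl⟩
    exact hp
  · intro hz
    obtain ⟨x, ⟨x', hx', rfl⟩, rfl⟩ := (hGL' z).mp hz
    obtain ⟨p, hp⟩ := exists_aeval_eq_derivative_mul hα hint (hy x' hx')
    refine ⟨p, ?_, hp⟩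
    change aeval α p ∈ G
    rw [hp]
    exact hz

open scoped Classical in
/-- The product of the norms of all nonzero differences `a - b` for `a ∈ s` and `b ∈ t`. -/
noncomputable def diffNorm {ℓ : ℕ} [Fact ℓ.Prime] (s t : Multiset (PadicAlgCl ℓ)) : ℝ :=
  (s.map fun a => (t.map fun b => if a = b then 1 else ‖a - b‖).prod).prod

section diffNorm

variable {ℓ : ℕ} [Fact ℓ.Prime]

theorem diffNorm_add_left (s s' t : Multiset (PadicAlgCl ℓ)) :
    diffNorm (s + s') t = diffNorm s t * diffNorm s' t := by
  simp [diffNorm]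

theorem diffNorm_add_right (s t t' : Multiset (PadicAlgCl ℓ)) :
    diffNorm s (t + t') = diffNorm s t * diffNorm s t' := by
  simp [diffNorm]

theorem diffNorm_comm (s t : Multiset (PadicAlgCl ℓ)) : diffNorm s t = diffNorm t s := by
  rw [diffNorm, Multiset.prod_map_prod_map]
  refine congrArg _ (Multiset.map_congr rfl fun a _ =>
    congrArg _ (Multiset.map_congr rfl fun b _ => ?_))
  rw [norm_sub_rev]
  congr 1
  exact propext eq_comm

theorem diffNorm_pos (s t : Multiset (PadicAlgCl ℓ)) : 0 < diffNorm s t := by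
  refine Multiset.prod_pos fun x hx => ?_
  obtain ⟨a, -, rfl⟩ := Multiset.mem_map.mp hx
  refine Multiset.prod_pos fun y hy => ?_
  obtain ⟨b, -, rfl⟩ := Multiset.mem_map.mp hy
  split_ifs with h
  · exact one_pos
  · exact norm_pos_iff.mpr (sub_ne_zero.mpr h)

theorem norm_padicAlgCl_le_one_of_isIntegral {z : PadicAlgCl ℓ} (hz : IsIntegral ℤ_[ℓ] z) :
    ‖z‖ ≤ 1 := by
  rw [← PadicAlgCl.spectralNorm_eq]
  have hi : IsIntegral ℚ_[ℓ] z := Algebra.IsIntegral.isIntegral _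
  refine (spectralValue_le_one_iff (minpoly.monic hi)).mpr fun n => ?_
  rw [minpoly.isIntegrallyClosed_eq_field_fractions' ℚ_[ℓ] hz, coeff_map]
  exact PadicInt.norm_le_one _

theorem prod_le_one_of_forall {s : Multiset ℝ} (h : ∀ x ∈ s, 0 ≤ x ∧ x ≤ 1) : s.prod ≤ 1 := by
  induction s using Multiset.induction_on with
  | empty => simp
  | cons a s ih =>
    rw [Multiset.prod_cons]
    have ha := h a (Multiset.mem_cons_self _ _)
    have hs : ∀ x ∈ s, 0 ≤ x ∧ x ≤ 1 := fun x hx => h x (Multiset.mem_cons_of_mem hx)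
    exact mul_le_one₀ ha.2 (Multiset.prod_nonneg fun x hx => (hs x hx).1) (ih hs)

theorem diffNorm_le_one {s t : Multiset (PadicAlgCl ℓ)} (hs : ∀ z ∈ s, IsIntegral ℤ_[ℓ] z)
    (ht : ∀ z ∈ t, IsIntegral ℤ_[ℓ] z) : diffNorm s t ≤ 1 := by
  classical
  have key : ∀ a ∈ s, ∀ x ∈ t.map fun b => (if a = b then 1 else ‖a - b‖ : ℝ), 0 ≤ x ∧ x ≤ 1 := by
    intro a ha x hx
    obtain ⟨b, hb, rfl⟩ := Multiset.mem_map.mp hx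
    split_ifs with h
    · simp
    · exact ⟨norm_nonneg _, norm_padicAlgCl_le_one_of_isIntegral ((hs a ha).sub (ht b hb))⟩
  refine prod_le_one_of_forall fun x hx => ?_
  obtain ⟨a, ha, rfl⟩ := Multiset.mem_map.mp hx
  exact ⟨Multiset.prod_nonneg fun x hx => (key a ha x hx).1, prod_le_one_of_forall (key a ha)⟩

theorem norm_norm_aeval_derivative {E : Type*} [Field E] [Algebra ℚ_[ℓ] E]
    [FiniteDimensional ℚ_[ℓ] E] {α : E} (hα : Algebra.adjoin ℚ_[ℓ] {α} = ⊤) :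
    ‖Algebra.norm ℚ_[ℓ] (aeval α (derivative (minpoly ℚ_[ℓ] α)))‖ =
      diffNorm ((minpoly ℚ_[ℓ] α).aroots (PadicAlgCl ℓ))
        ((minpoly ℚ_[ℓ] α).aroots (PadicAlgCl ℓ)) := by
  classical
  have hint : IsIntegral ℚ_[ℓ] α := Algebra.IsIntegral.isIntegral _
  let pb := PowerBasis.ofAdjoinEqTop hint hα
  have hgen : pb.gen = α := PowerBasis.ofAdjoinEqTop_gen hint hα
  have hsep : (minpoly ℚ_[ℓ] α).Separable := Algebra.IsSeparable.isSeparable ℚ_[ℓ] α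
  have hnd : ((minpoly ℚ_[ℓ] α).aroots (PadicAlgCl ℓ)).Nodup := nodup_aroots_iff_of_splits
    (minpoly.ne_zero hint) (IsAlgClosed.splits _) |>.mpr hsep
  rw [← PadicAlgCl.norm_extends,
    Algebra.norm_eq_prod_embeddings ℚ_[ℓ] (PadicAlgCl ℓ), norm_prod]
  have hm : ∀ s : Multiset (PadicAlgCl ℓ), ‖s.prod‖ = (s.map norm).prod :=
    map_multiset_prod (normHom : PadicAlgCl ℓ →*₀ ℝ)
  have hroot : ∀ a ∈ (minpoly ℚ_[ℓ] α).aroots (PadicAlgCl ℓ),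
      ‖aeval a (derivative (minpoly ℚ_[ℓ] α))‖ = (((minpoly ℚ_[ℓ] α).aroots (PadicAlgCl ℓ)).map
        fun b => if a = b then 1 else ‖a - b‖).prod := by
    intro a ha
    rw [aeval_def, ← eval_map, ← derivative_map,
      (IsAlgClosed.splits _).eval_root_derivative ((minpoly.monic hint).map _) ha]
    conv_rhs => rw [← Multiset.cons_erase ha]
    rw [Multiset.map_cons, Multiset.prod_cons, if_pos rfl, one_mul, hm,
      Multiset.map_map]
    refine congrArg _ (Multiset.map_congr rfl fun b hb => ?_)
    have : a ≠ b := by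
      rintro rfl
      exact hnd.notMem_erase hb
    rw [if_neg this]
    rfl
  rw [diffNorm, ← Multiset.map_congr rfl hroot,
    Fintype.prod_equiv (pb.liftEquiv' (B := PadicAlgCl ℓ)) _
      (fun x => ‖aeval (x : PadicAlgCl ℓ) (derivative (minpoly ℚ_[ℓ] α))‖) fun σ => by
        rw [PowerBasis.liftEquiv'_apply_coe, hgen, ← aeval_algHom_apply],
    Finset.prod_mem_multiset _ _ (fun x => ‖aeval (x : PadicAlgCl ℓ)
      (derivative (minpoly ℚ_[ℓ] α))‖) (fun _ => rfl),
    Finset.prod_eq_multiset_prod, Multiset.toFinset_val, hgen, Multiset.dedup_eq_self.mpr hnd]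

end diffNorm

theorem HasOrbitBound.mono {ℓ : ℕ} [Fact ℓ.Prime] {V : Type*} [AddCommGroup V] [Module ℚ_[ℓ] V]
    [Module ℤ_[ℓ] V] [IsScalarTower ℤ_[ℓ] ℚ_[ℓ] V] {γ : V →ₗ[ℚ_[ℓ]] V} {B B' : ℝ}
    (h : HasOrbitBound γ B) (hB : B ≤ B') : HasOrbitBound γ B' := by
  obtain ⟨S, hS, h⟩ := h
  exact ⟨S, hS.trans hB, h⟩

theorem HasOrbitBound.of_linearEquiv {ℓ : ℕ} [Fact ℓ.Prime] {V V' : Type*}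
    [AddCommGroup V] [Module ℚ_[ℓ] V] [Module ℤ_[ℓ] V] [IsScalarTower ℤ_[ℓ] ℚ_[ℓ] V]
    [AddCommGroup V'] [Module ℚ_[ℓ] V'] [Module ℤ_[ℓ] V'] [IsScalarTower ℤ_[ℓ] ℚ_[ℓ] V']
    {γ : V →ₗ[ℚ_[ℓ]] V} {γ' : V' →ₗ[ℚ_[ℓ]] V'} {B : ℝ} (e : V ≃ₗ[ℚ_[ℓ]] V')
    (he : ∀ x, e (γ x) = γ' (e x)) (h : HasOrbitBound γ B) : HasOrbitBound γ' B := by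
  classical
  obtain ⟨S, hS, h⟩ := h
  refine ⟨S.image fun L => L.map (LinearMap.restrictScalars ℤ_[ℓ] (e : V →ₗ[ℚ_[ℓ]] V')),
    (Nat.cast_le.mpr Finset.card_image_le).trans hS, fun L hfg hspan hL => ?_⟩
  have he' : ∀ x, e.symm (γ' x) = γ (e.symm x) := fun x => by
    rw [LinearEquiv.symm_apply_eq, he, LinearEquiv.apply_symm_apply]
  have hspan' : Submodule.span ℚ_[ℓ] (L.map (LinearMap.restrictScalars ℤ_[ℓ]
      (e.symm : V' →ₗ[ℚ_[ℓ]] V)) : Set V) = ⊤ := by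
    have : (L.map (LinearMap.restrictScalars ℤ_[ℓ] (e.symm : V' →ₗ[ℚ_[ℓ]] V)) : Set V) =
      (e.symm : V' →ₗ[ℚ_[ℓ]] V) '' (L : Set V') := rfl
    rw [this, Submodule.span_image, hspan, Submodule.map_top, LinearEquiv.range]
  obtain ⟨g, hg, hgS⟩ := h (L.map (LinearMap.restrictScalars ℤ_[ℓ] (e.symm : V' →ₗ[ℚ_[ℓ]] V)))
    (hfg.map _) hspan' (by
      rintro _ ⟨x, hx, rfl⟩
      exact ⟨γ' x, hL x hx, he' x⟩)
  refine ⟨e.symm.trans (g.trans e), fun x => by simp [he', hg, he],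
    Finset.mem_image.mpr ⟨_, hgS, ?_⟩⟩
  rw [← Submodule.map_comp, ← Submodule.map_comp]
  rfl

theorem minpoly_irreducible_of_forall_invariant {K V : Type*} [Field K] [AddCommGroup V]
    [Module K V] [FiniteDimensional K V] [Nontrivial V] {γ : V →ₗ[K] V}
    (hsimple : ∀ U : Submodule K V, (∀ x ∈ U, γ x ∈ U) → U = ⊥ ∨ U = ⊤) :
    Irreducible (minpoly K γ) := by
  have hint : IsIntegral K γ := Algebra.IsIntegral.isIntegral _
  rw [irreducible_iff]
  refine ⟨minpoly.not_isUnit K γ, fun a b hab => ?_⟩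
  have hmul : aeval γ a * aeval γ b = 0 := by rw [← map_mul, ← hab, minpoly.aeval]
  have hne : a * b ≠ 0 := hab ▸ minpoly.ne_zero hint
  rcases hsimple (LinearMap.ker (aeval γ a)) (fun x hx => by
    rw [LinearMap.mem_ker] at hx ⊢
    have : (aeval γ a * γ) x = (γ * aeval γ a) x := by
      congr 1
      have h := congrArg (aeval γ) (mul_comm a X)
      rwa [map_mul, map_mul, aeval_X] at h
    rw [Module.End.mul_apply, Module.End.mul_apply, hx, map_zero] at this
    exact this) with h | h
  · left
    have hb : aeval γ b = 0 := by
      ext x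
      have : (aeval γ a) (aeval γ b x) = 0 := by rw [← Module.End.mul_apply, hmul]; rfl
      rw [← LinearMap.mem_ker, h, Submodule.mem_bot] at this
      exact this
    have hd := minpoly.dvd K γ hb
    obtain ⟨c, hc⟩ := hd
    refine IsUnit.of_mul_eq_one c (mul_right_cancel₀ (right_ne_zero_of_mul hne) ?_)
    rw [one_mul, mul_right_comm, ← hab, ← hc]
  · right
    have ha : aeval γ a = 0 := LinearMap.ker_eq_top.mp h
    obtain ⟨c, hc⟩ := minpoly.dvd K γ ha
    refine IsUnit.of_mul_eq_one c (mul_left_cancel₀ (left_ne_zero_of_mul hne) ?_)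
    rw [mul_one, ← mul_assoc, ← hab, ← hc]

theorem HasOrbitBound.of_forall_invariant {ℓ : ℕ} [Fact ℓ.Prime] {V : Type*} [AddCommGroup V]
    [Module ℚ_[ℓ] V] [Module ℤ_[ℓ] V] [IsScalarTower ℤ_[ℓ] ℚ_[ℓ] V] [FiniteDimensional ℚ_[ℓ] V]
    [Nontrivial V] {γ : V →ₗ[ℚ_[ℓ]] V}
    (hsimple : ∀ U : Submodule ℚ_[ℓ] V, (∀ x ∈ U, γ x ∈ U) → U = ⊥ ∨ U = ⊤)
    (hint : ∀ z ∈ γ.charpoly.aroots (PadicAlgCl ℓ), IsIntegral ℤ_[ℓ] z) :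
    HasOrbitBound γ ((diffNorm (γ.charpoly.aroots (PadicAlgCl ℓ))
      (γ.charpoly.aroots (PadicAlgCl ℓ)))⁻¹ ^ 2) := by
  have hirr := minpoly_irreducible_of_forall_invariant hsimple
  have hγint : IsIntegral ℚ_[ℓ] γ := Algebra.IsIntegral.isIntegral _
  have hmonic := minpoly.monic hγint
  have hcomm : ∀ p : ℚ_[ℓ][X], ∀ x, aeval γ (X * p) x = γ (aeval γ p x) := fun p x => by
    rw [map_mul, aeval_X, Module.End.mul_apply]
  have hcomm' : ∀ p : ℚ_[ℓ][X], ∀ x, aeval γ p (γ x) = γ (aeval γ p x) := fun p x => by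
    rw [← hcomm, mul_comm, map_mul, aeval_X, Module.End.mul_apply]
  have : Fact (Irreducible (minpoly ℚ_[ℓ] γ)) := ⟨hirr⟩
  obtain ⟨w, hw⟩ := exists_ne (0 : V)
  let φ : ℚ_[ℓ][X] →ₗ[ℚ_[ℓ]] V :=
    (LinearMap.applyₗ w).comp (aeval γ : ℚ_[ℓ][X] →ₐ[ℚ_[ℓ]] Module.End ℚ_[ℓ] V).toLinearMap
  have hφ : ∀ p, φ p = aeval γ p w := fun p => rfl
  have hφsurj : LinearMap.range φ = ⊤ := by
    refine (hsimple _ ?_).resolve_left ?_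
    · rintro _ ⟨p, rfl⟩
      exact ⟨X * p, hcomm p w⟩
    · intro h
      have : φ 1 ∈ LinearMap.range φ := ⟨1, rfl⟩
      rw [h, Submodule.mem_bot, hφ, map_one] at this
      exact hw this
  let ψ : ℚ_[ℓ][X] →ₗ[ℚ_[ℓ]] AdjoinRoot (minpoly ℚ_[ℓ] γ) :=
    (AdjoinRoot.mkₐ (R := ℚ_[ℓ]) (minpoly ℚ_[ℓ] γ)).toLinearMap
  have hψ : ∀ p, ψ p = AdjoinRoot.mk _ p := fun p => rfl
  have hψsurj : LinearMap.range ψ = ⊤ := LinearMap.range_eq_top.mpr AdjoinRoot.mk_surjective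
  have hker : LinearMap.ker ψ = LinearMap.ker φ := by
    ext p
    rw [LinearMap.mem_ker, LinearMap.mem_ker, hψ, hφ, AdjoinRoot.mk_eq_zero]
    constructor
    · rintro ⟨c, rfl⟩
      rw [map_mul, minpoly.aeval, zero_mul]
      rfl
    · intro h
      refine minpoly.dvd _ _ (LinearMap.ker_eq_top.mp ((hsimple _ fun x hx => ?_).resolve_left ?_))
      · rw [LinearMap.mem_ker] at hx ⊢
        rw [hcomm', hx, map_zero]
      · intro hb
        rw [← LinearMap.mem_ker, hb, Submodule.mem_bot] at h
        exact hw h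
  let e : AdjoinRoot (minpoly ℚ_[ℓ] γ) ≃ₗ[ℚ_[ℓ]] V :=
    (ψ.quotKerEquivOfSurjective (LinearMap.range_eq_top.mp hψsurj)).symm.trans
      ((Submodule.quotEquivOfEq _ _ hker).trans
        (φ.quotKerEquivOfSurjective (LinearMap.range_eq_top.mp hφsurj)))
  have he : ∀ p, e (AdjoinRoot.mk _ p) = aeval γ p w := by
    intro p
    have : (ψ.quotKerEquivOfSurjective (LinearMap.range_eq_top.mp hψsurj)).symm
        (AdjoinRoot.mk _ p) = Submodule.Quotient.mk p := by
      rw [LinearEquiv.symm_apply_eq]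
      rfl
    simp only [e, LinearEquiv.trans_apply, this]
    rfl
  have hfd : FiniteDimensional ℚ_[ℓ] (AdjoinRoot (minpoly ℚ_[ℓ] γ)) := .of_surjective
    (e.symm : V →ₗ[ℚ_[ℓ]] _) e.symm.surjective
  set α := AdjoinRoot.root (minpoly ℚ_[ℓ] γ) with hαdef
  have hα : Algebra.adjoin ℚ_[ℓ] {α} = ⊤ := AdjoinRoot.adjoinRoot_eq_top
  have hminα : minpoly ℚ_[ℓ] α = minpoly ℚ_[ℓ] γ := by
    rw [hαdef, AdjoinRoot.minpoly_root hirr.ne_zero, hmonic.leadingCoeff, inv_one, C_1, mul_one]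
  have hchar : γ.charpoly = minpoly ℚ_[ℓ] γ := by
    refine (eq_of_monic_of_dvd_of_natDegree_le hmonic (LinearMap.charpoly_monic γ)
      (LinearMap.minpoly_dvd_charpoly γ) ?_)
    rw [LinearMap.charpoly_natDegree, ← e.finrank_eq,
      (AdjoinRoot.powerBasis hirr.ne_zero).finrank, AdjoinRoot.powerBasis_dim]
  have hαint : IsIntegral ℤ_[ℓ] α := by
    let σ : AdjoinRoot (minpoly ℚ_[ℓ] γ) →ₐ[ℚ_[ℓ]] PadicAlgCl ℓ := IsAlgClosed.lift
    have hσ := hint (σ α) (by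
      rw [hchar, mem_aroots]
      refine ⟨hirr.ne_zero, ?_⟩
      rw [aeval_algHom_apply, show aeval α (minpoly ℚ_[ℓ] γ) = 0 by
        simpa only [hminα] using minpoly.aeval ℚ_[ℓ] α, map_zero])
    exact (isIntegral_algHom_iff (σ.restrictScalars ℤ_[ℓ]) σ.injective).mp hσ
  have key := hasOrbitBound_mulLeft hα hαint
  rw [norm_norm_aeval_derivative hα, hminα] at key
  rw [hchar]
  refine HasOrbitBound.of_linearEquiv e (fun x => ?_) key
  obtain ⟨p, rfl⟩ := AdjoinRoot.mk_surjective x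
  rw [LinearMap.mulLeft_apply, hαdef, ← AdjoinRoot.mk_X, ← map_mul, he, he, hcomm]

theorem exists_finset_reps_of_map_mem {ℓ : ℕ} [Fact ℓ.Prime] {W : Type*} [AddCommGroup W]
    [Module ℚ_[ℓ] W] [Module ℤ_[ℓ] W] [IsScalarTower ℤ_[ℓ] ℚ_[ℓ] W] [FiniteDimensional ℚ_[ℓ] W]
    (D : W →ₗ[ℚ_[ℓ]] W) (hD : Disjoint (LinearMap.ker D) (LinearMap.range D))
    (H : Submodule ℤ_[ℓ] W) (hfg : H.FG) (hspan : Submodule.span ℚ_[ℓ] (H : Set W) = ⊤)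
    (hDH : ∀ x ∈ H, D x ∈ H) :
    ∃ F : Finset W, (F.card : ℝ) ≤ ‖LinearMap.det (D.restrict (p := LinearMap.range D)
        (q := LinearMap.range D) fun x _ => ⟨x, rfl⟩)‖⁻¹ ∧
      ∀ Φ, D Φ ∈ H → ∃ f ∈ F, ∃ k, D k = 0 ∧ ∃ h ∈ H, Φ = f + k + h := by
  classical
  set R := LinearMap.range D with hR
  set DR := D.restrict (p := R) (q := R) fun x _ => ⟨x, rfl⟩ with hDR
  have hinj : Function.Injective DR := by
    rw [← LinearMap.ker_eq_bot, LinearMap.ker_eq_bot']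
    rintro ⟨x, hx⟩ hx0
    have hx0 : D x = 0 := congrArg Subtype.val hx0
    exact Subtype.ext (Submodule.disjoint_def.mp hD x hx0 hx)
  have hsurj : Function.Surjective DR := LinearMap.injective_iff_surjective.mp hinj
  have hdet : LinearMap.det DR ≠ 0 := by
    intro h
    exact LinearMap.bot_lt_ker_of_det_eq_zero h |>.ne' (LinearMap.ker_eq_bot.mpr hinj)
  let N : Submodule ℤ_[ℓ] R := H.comap (R.subtype.restrictScalars ℤ_[ℓ])
  have hNmem : ∀ x : R, x ∈ N ↔ (x : W) ∈ H := fun x => Iff.rfl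
  have hNfg : N.FG := by
    have hH : Module.Finite ℤ_[ℓ] H := Module.Finite.iff_fg.mpr hfg
    let j : N →ₗ[ℤ_[ℓ]] H := (R.subtype.restrictScalars ℤ_[ℓ]).restrict fun x hx => hx
    have hj : Function.Injective j := fun a b hab =>
      Subtype.ext (Subtype.ext (congrArg (fun x : H => (x : W)) hab))
    have := isNoetherian_of_injective j hj
    exact Module.Finite.iff_fg.mp inferInstance
  have hNspan : Submodule.span ℚ_[ℓ] (N : Set R) = ⊤ := by
    rw [eq_top_iff, ← D.range_rangeRestrict, ← Submodule.map_top, ← hspan, Submodule.map_span]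
    refine Submodule.span_mono ?_
    rintro _ ⟨x, hx, rfl⟩
    exact hDH x hx
  have hDN : ∀ x ∈ N, DR x ∈ N := fun x hx => hDH x hx
  obtain ⟨hfin, hcard⟩ := card_lattice_quotient_le N hNfg hNspan DR hDN hdet
  set Q := LinearMap.range ((DR.restrictScalars ℤ_[ℓ]).restrict hDN)
  choose inv hinv using hsurj
  have := Fintype.ofFinite (N ⧸ Q)
  refine ⟨Finset.univ.image fun q : N ⧸ Q => (inv q.out : W), ?_, fun Φ hΦ => ?_⟩
  · refine le_trans ?_ hcard
    rw [Nat.card_eq_fintype_card]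
    exact_mod_cast Finset.card_image_le
  · let n : N := ⟨⟨D Φ, ⟨Φ, rfl⟩⟩, hΦ⟩
    obtain ⟨h', hh'⟩ : (Submodule.Quotient.mk n : N ⧸ Q).out - n ∈ Q := by
      rw [← Submodule.Quotient.eq]
      exact Quotient.out_eq _
    refine ⟨_, Finset.mem_image_of_mem _ (Finset.mem_univ (Submodule.Quotient.mk n)),
      Φ - inv (Submodule.Quotient.mk n : N ⧸ Q).out + h', ?_, -(h' : W), H.neg_mem h'.2, by abel⟩
    have h1 : D (h' : R) = ((Submodule.Quotient.mk n : N ⧸ Q).out : R) - D Φ :=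
      congrArg (fun x : N => ((x : R) : W)) hh'
    have h2 : D (inv (Submodule.Quotient.mk n : N ⧸ Q).out : R) =
        ((Submodule.Quotient.mk n : N ⧸ Q).out : R) := congrArg Subtype.val (hinv _)
    rw [map_add, map_sub, h1, h2]
    abel

open scoped Classical in
theorem norm_det_restrict_range {ℓ : ℕ} [Fact ℓ.Prime] {W : Type*} [AddCommGroup W]
    [Module ℚ_[ℓ] W] [FiniteDimensional ℚ_[ℓ] W]
    (D : W →ₗ[ℚ_[ℓ]] W) (hD : Disjoint (LinearMap.ker D) (LinearMap.range D)) :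
    ‖LinearMap.det (D.restrict (p := LinearMap.range D)
        (q := LinearMap.range D) fun x _ => ⟨x, rfl⟩)‖ =
      ((D.charpoly.aroots (PadicAlgCl ℓ)).map fun z => if z = 0 then 1 else ‖z‖).prod := by
  classical
  set R := LinearMap.range D with hR
  set DR := D.restrict (p := R) (q := R) fun x _ => ⟨x, rfl⟩ with hDR
  have hcompl : IsCompl (LinearMap.ker D) R := by
    refine ⟨hD, codisjoint_iff.mpr (Submodule.eq_top_of_disjoint _ _ ?_ hD).symm.symm⟩
    rw [add_comm, LinearMap.finrank_range_add_finrank_ker]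
  have hinj : Function.Injective DR := by
    rw [← LinearMap.ker_eq_bot, LinearMap.ker_eq_bot']
    rintro ⟨x, hx⟩ hx0
    have hx0 : D x = 0 := congrArg Subtype.val hx0
    exact Subtype.ext (Submodule.disjoint_def.mp hD x hx0 hx)
  have hdet : LinearMap.det DR ≠ 0 := by
    intro h
    exact LinearMap.bot_lt_ker_of_det_eq_zero h |>.ne' (LinearMap.ker_eq_bot.mpr hinj)
  let e := Submodule.prodEquivOfIsCompl _ _ hcompl
  have hchar : D.charpoly = X ^ Module.finrank ℚ_[ℓ] (LinearMap.ker D) * DR.charpoly := by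
    rw [← LinearMap.charpoly_zero, ← LinearMap.charpoly_prodMap, ← LinearEquiv.charpoly_conj e]
    congr 1
    ext x
    obtain ⟨⟨⟨a, ha⟩, b⟩, rfl⟩ := e.surjective x
    have ha : D a = 0 := ha
    rw [LinearEquiv.conj_apply_apply, LinearEquiv.symm_apply_apply]
    simp [e, ha]
    rfl
  have hnorm : ∀ s : Multiset (PadicAlgCl ℓ), ‖s.prod‖ = (s.map norm).prod :=
    map_multiset_prod (normHom : PadicAlgCl ℓ →*₀ ℝ)
  have hprod : algebraMap ℚ_[ℓ] (PadicAlgCl ℓ) (LinearMap.det DR) =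
      (DR.charpoly.aroots (PadicAlgCl ℓ)).prod := by
    let b := Module.finBasis ℚ_[ℓ] R
    rw [← LinearMap.det_toMatrix b, RingHom.map_det, Matrix.det_eq_prod_roots_charpoly,
      RingHom.mapMatrix_apply, Matrix.charpoly_map, LinearMap.charpoly_toMatrix]
  have hz : ∀ z ∈ DR.charpoly.aroots (PadicAlgCl ℓ), z ≠ 0 := by
    rintro z hz rfl
    rw [Multiset.prod_eq_zero hz] at hprod
    exact hdet ((map_eq_zero _).mp hprod)
  rw [← PadicAlgCl.norm_extends, hprod, hchar, aroots_mul (mul_ne_zero (pow_ne_zero _ X_ne_zero)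
    (LinearMap.charpoly_monic _).ne_zero), Multiset.map_add, Multiset.prod_add, aroots_X_pow,
    hnorm]
  have h1 : (DR.charpoly.aroots (PadicAlgCl ℓ)).map (fun z => if z = 0 then (1 : ℝ) else ‖z‖) =
      (DR.charpoly.aroots (PadicAlgCl ℓ)).map norm :=
    Multiset.map_congr rfl fun z h => if_neg (hz z h)
  rw [h1]
  simp [Multiset.nsmul_singleton]

theorem exists_diagonal_of_squarefree_aeval_eq_zero {K n : Type*} [Field K] [IsAlgClosed K]
    [Fintype n] [DecidableEq n] {A : Matrix n n K} {p : K[X]} (hp : Squarefree p)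
    (hA : aeval A p = 0) :
    ∃ (P Q : Matrix n n K) (d : n → K), P * Q = 1 ∧ A = P * Matrix.diagonal d * Q := by
  set f : Module.End K (n → K) := Matrix.toLin' A with hf
  have hfp : aeval f p = 0 := by
    have : f = Matrix.toLinAlgEquiv' A := rfl
    rw [this, aeval_algEquiv]
    simp [hA]
  have hss : f.IsSemisimple := Module.End.isSemisimple_of_squarefree_aeval_eq_zero hp hfp
  set E : Set (n → K) := {x | ∃ μ : K, f x = μ • x} with hE
  have hspan : Submodule.span K E = ⊤ := by
    rw [eq_top_iff, ← hss.iSup_eigenspace_eq_top, iSup_le_iff]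
    intro μ x hx
    exact Submodule.subset_span ⟨μ, Module.End.mem_eigenspace_iff.mp hx⟩
  obtain ⟨b, hbE, hbspan, hbli⟩ := exists_linearIndependent K E
  let b₀ : Module.Basis b K (n → K) := Module.Basis.mk hbli (by
    rw [Subtype.range_coe, hbspan, hspan])
  have : Fintype b := FiniteDimensional.fintypeBasisIndex b₀
  let e : b ≃ n := b₀.indexEquiv (Pi.basisFun K n)
  let B := b₀.reindex e
  have hB : ∀ i, ∃ μ : K, f (B i) = μ • B i := fun i => by
    have : B i = (e.symm i : n → K) := by simp [B, b₀]
    rw [this]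
    exact hbE (e.symm i).2
  choose d hd using hB
  refine ⟨(Pi.basisFun K n).toMatrix B, B.toMatrix (Pi.basisFun K n), d,
    Module.Basis.toMatrix_mul_toMatrix_flip _ _, ?_⟩
  have hdiag : LinearMap.toMatrix B B f = Matrix.diagonal d := by
    ext i j
    rw [LinearMap.toMatrix_apply, hd, map_smul, Finsupp.smul_apply, B.repr_self, smul_eq_mul,
      Matrix.diagonal_apply]
    rcases eq_or_ne i j with rfl | h
    · simp
    · simp [h]
  rw [← hdiag, basis_toMatrix_mul_linearMap_toMatrix_mul_basis_toMatrix]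
  exact (LinearMap.toMatrix'_toLin' A).symm

theorem charpoly_mul_diagonal_mul {K n : Type*} [CommRing K] [Fintype n] [DecidableEq n]
    {P Q : Matrix n n K} (d : n → K) (h : P * Q = 1) :
    (P * Matrix.diagonal d * Q).charpoly = ∏ i, (X - C (d i)) := by
  rw [Matrix.charpoly_mul_comm, ← mul_assoc, mul_eq_one_comm.mp h, one_mul,
    Matrix.charpoly_diagonal]

open scoped Kronecker in
theorem charpoly_kronecker_sub_kronecker {K m n : Type*} [Field K] [Fintype m] [DecidableEq m]
    [Fintype n] [DecidableEq n] {P Q : Matrix m m K} {P' Q' : Matrix n n K} (d : m → K) (d' : n → K)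
    (h : P * Q = 1) (h' : P' * Q' = 1) :
    ((P * Matrix.diagonal d * Q) ⊗ₖ (1 : Matrix n n K) -
      (1 : Matrix m m K) ⊗ₖ (P' * Matrix.diagonal d' * Q')).charpoly =
      ∏ i : m × n, (X - C (d i.1 - d' i.2)) := by
  have hone : (P ⊗ₖ P') * (Q ⊗ₖ Q') = 1 := by
    rw [← Matrix.mul_kronecker_mul, h, h', Matrix.one_kronecker_one]
  have key : (P * Matrix.diagonal d * Q) ⊗ₖ (1 : Matrix n n K) -
      (1 : Matrix m m K) ⊗ₖ (P' * Matrix.diagonal d' * Q') =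
      (P ⊗ₖ P') * Matrix.diagonal (fun i : m × n => d i.1 - d' i.2) * (Q ⊗ₖ Q') := by
    have h1 : Matrix.diagonal (fun i : m × n => d i.1 - d' i.2) =
        Matrix.diagonal d ⊗ₖ (1 : Matrix n n K) - (1 : Matrix m m K) ⊗ₖ Matrix.diagonal d' := by
      rw [← Matrix.diagonal_one, ← Matrix.diagonal_one, Matrix.diagonal_kronecker_diagonal,
        Matrix.diagonal_kronecker_diagonal, Matrix.diagonal_sub]
      simp
    rw [h1, mul_sub, sub_mul, ← Matrix.mul_kronecker_mul, ← Matrix.mul_kronecker_mul,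
      ← Matrix.mul_kronecker_mul, ← Matrix.mul_kronecker_mul, mul_one, mul_one, h, h']
  rw [key]
  exact charpoly_mul_diagonal_mul _ hone

/-- The Sylvester operator `Φ ↦ γ₁ Φ - Φ γ₂`. -/
def sylvesterOp {K V₁ V₂ : Type*} [Field K] [AddCommGroup V₁] [Module K V₁] [AddCommGroup V₂]
    [Module K V₂] (γ₁ : V₁ →ₗ[K] V₁) (γ₂ : V₂ →ₗ[K] V₂) :
    (V₂ →ₗ[K] V₁) →ₗ[K] (V₂ →ₗ[K] V₁) :=
  LinearMap.llcomp K V₂ V₁ V₁ γ₁ - LinearMap.lcomp K V₁ γ₂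

theorem sylvesterOp_apply {K V₁ V₂ : Type*} [Field K] [AddCommGroup V₁] [Module K V₁]
    [AddCommGroup V₂] [Module K V₂] (γ₁ : V₁ →ₗ[K] V₁) (γ₂ : V₂ →ₗ[K] V₂) (Φ : V₂ →ₗ[K] V₁) :
    sylvesterOp γ₁ γ₂ Φ = γ₁ ∘ₗ Φ - Φ ∘ₗ γ₂ := rfl

theorem disjoint_ker_range_sylvesterOp {K V₁ V₂ : Type*} [Field K] [PerfectField K]
    [AddCommGroup V₁] [Module K V₁] [AddCommGroup V₂] [Module K V₂]
    [FiniteDimensional K V₁] [FiniteDimensional K V₂]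
    {γ₁ : V₁ →ₗ[K] V₁} {γ₂ : V₂ →ₗ[K] V₂} (h₁ : Squarefree (minpoly K γ₁))
    (h₂ : Squarefree (minpoly K γ₂)) :
    Disjoint (LinearMap.ker (sylvesterOp γ₁ γ₂)) (LinearMap.range (sylvesterOp γ₁ γ₂)) := by
  let l : Module.End K (V₂ →ₗ[K] V₁) := LinearMap.llcomp K V₂ V₁ V₁ γ₁
  let r : Module.End K (V₂ →ₗ[K] V₁) := LinearMap.lcomp K V₁ γ₂
  have hl : ∀ p : K[X], ∀ Φ, aeval l p Φ = aeval γ₁ p ∘ₗ Φ := fun p => by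
    induction p using Polynomial.induction_on' with
    | add p q hp hq => intro Φ; simp [hp, hq, LinearMap.add_comp]
    | monomial k a =>
      intro Φ
      induction k generalizing Φ with
      | zero => ext x; simp [Module.algebraMap_end_apply]
      | succ k ih =>
        have := ih (γ₁ ∘ₗ Φ)
        rw [aeval_monomial] at this ⊢
        rw [pow_succ, ← mul_assoc, Module.End.mul_apply]
        refine this.trans ?_
        rw [aeval_monomial, aeval_monomial, pow_succ, ← mul_assoc]
        rfl
  have hr : ∀ p : K[X], ∀ Φ, aeval r p Φ = Φ ∘ₗ aeval γ₂ p := fun p => by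
    induction p using Polynomial.induction_on' with
    | add p q hp hq => intro Φ; simp [hp, hq, LinearMap.comp_add]
    | monomial k a =>
      intro Φ
      induction k generalizing Φ with
      | zero => ext x; simp [Module.algebraMap_end_apply]
      | succ k ih =>
        have := ih (Φ ∘ₗ γ₂)
        rw [aeval_monomial] at this ⊢
        rw [pow_succ, ← mul_assoc, Module.End.mul_apply]
        refine this.trans ?_
        rw [aeval_monomial, aeval_monomial, pow_succ', ← mul_assoc,
          Algebra.commutes a γ₂, mul_assoc]
        rfl
  have hlss : l.IsSemisimple := Module.End.isSemisimple_of_squarefree_aeval_eq_zero h₁ (by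
    ext1 Φ
    rw [hl, minpoly.aeval, LinearMap.zero_comp, LinearMap.zero_apply])
  have hrss : r.IsSemisimple := Module.End.isSemisimple_of_squarefree_aeval_eq_zero h₂ (by
    ext1 Φ
    rw [hr, minpoly.aeval, LinearMap.comp_zero, LinearMap.zero_apply])
  have hss : (l - r).IsSemisimple := Module.End.IsSemisimple.sub_of_commute rfl hlss hrss
  have hgen := hss.isFinitelySemisimple.maxGenEigenspace_eq_eigenspace 0
  rw [Submodule.disjoint_def]
  rintro _ hx ⟨y, rfl⟩
  have hy : y ∈ Module.End.maxGenEigenspace (l - r) 0 := by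
    rw [Module.End.mem_maxGenEigenspace]
    refine ⟨2, ?_⟩
    rw [zero_smul, sub_zero, pow_two]
    exact hx
  rw [hgen, Module.End.mem_eigenspace_iff, zero_smul] at hy
  exact hy

open scoped Kronecker Matrix in
theorem aroots_charpoly_sylvesterOp {K Ω V₁ V₂ : Type*} [Field K] [PerfectField K] [Field Ω]
    [IsAlgClosed Ω] [Algebra K Ω] [AddCommGroup V₁]
    [Module K V₁] [AddCommGroup V₂] [Module K V₂] [FiniteDimensional K V₁] [FiniteDimensional K V₂]
    {γ₁ : V₁ →ₗ[K] V₁} {γ₂ : V₂ →ₗ[K] V₂} (h₁ : Squarefree (minpoly K γ₁))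
    (h₂ : Squarefree (minpoly K γ₂)) :
    (sylvesterOp γ₁ γ₂).charpoly.aroots Ω =
      (γ₁.charpoly.aroots Ω ×ˢ γ₂.charpoly.aroots Ω).map fun z => z.1 - z.2 := by
  classical
  let b₁ := Module.finBasis K V₁
  let b₂ := Module.finBasis K V₂
  let φ := algebraMap K Ω
  have hdiag : ∀ {n : Type} [Fintype n] [DecidableEq n] (A : Matrix n n K) (p : K[X]),
      Squarefree p → aeval A p = 0 → ∃ (P Q : Matrix n n Ω) (d : n → Ω), P * Q = 1 ∧
        A.map φ = P * Matrix.diagonal d * Q := by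
    intro n _ _ A p hp hA
    refine exists_diagonal_of_squarefree_aeval_eq_zero (p := p.map φ)
      (PerfectField.separable_iff_squarefree.mpr hp).map.squarefree ?_
    have : A.map φ = (Algebra.ofId K Ω).mapMatrix A := rfl
    rw [aeval_map_algebraMap, this, aeval_algHom_apply, hA, map_zero]
  have hA₁ : aeval (LinearMap.toMatrix b₁ b₁ γ₁) (minpoly K γ₁) = 0 := by
    have : LinearMap.toMatrix b₁ b₁ γ₁ = LinearMap.toMatrixAlgEquiv b₁ γ₁ := rfl
    rw [this, aeval_algEquiv]
    simp
  have hA₂ : aeval (LinearMap.toMatrix b₂ b₂ γ₂) (minpoly K γ₂) = 0 := by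
    have : LinearMap.toMatrix b₂ b₂ γ₂ = LinearMap.toMatrixAlgEquiv b₂ γ₂ := rfl
    rw [this, aeval_algEquiv]
    simp
  obtain ⟨P₁, Q₁, d₁, hPQ₁, hd₁⟩ := hdiag _ _ h₁ hA₁
  obtain ⟨P₂, Q₂, d₂, hPQ₂, hd₂⟩ := hdiag _ _ h₂ hA₂
  have hroots : ∀ {n : Type} [Fintype n] [DecidableEq n] (A : Matrix n n K) (P Q : Matrix n n Ω)
      (d : n → Ω), P * Q = 1 → A.map φ = P * Matrix.diagonal d * Q →
      A.charpoly.aroots Ω = Finset.univ.val.map d := by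
    intro n _ _ A P Q d h hA
    rw [aroots_def, ← Matrix.charpoly_map, hA, charpoly_mul_diagonal_mul _ h]
    have := roots_multiset_prod_X_sub_C (Finset.univ.val.map d)
    rwa [Multiset.map_map] at this
  have hmat : LinearMap.toMatrix (b₂.linearMap b₁) (b₂.linearMap b₁) (sylvesterOp γ₁ γ₂) =
      (LinearMap.toMatrix b₁ b₁ γ₁) ⊗ₖ (1 : Matrix _ _ K) -
        (1 : Matrix _ _ K) ⊗ₖ (LinearMap.toMatrix b₂ b₂ γ₂)ᵀ := by
    ext ⟨i, j⟩ ⟨i', j'⟩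
    rw [LinearMap.toMatrix_apply, sylvesterOp_apply]
    have hrepr : ∀ Φ : V₂ →ₗ[K] V₁, (b₂.linearMap b₁).repr Φ (i, j) = b₁.repr (Φ (b₂ j)) i :=
      fun Φ => (LinearMap.toMatrix_apply b₂ b₁ Φ i j)
    rw [hrepr, LinearMap.sub_apply, map_sub, Finsupp.sub_apply, Matrix.sub_apply]
    simp only [Matrix.kroneckerMap_apply, Matrix.transpose_apply, LinearMap.toMatrix_apply,
      LinearMap.comp_apply]
    have happ : ∀ x, b₂.linearMap b₁ (i', j') x = b₂.repr x j' • b₁ i' := fun x => by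
      have : b₂.linearMap b₁ (i', j') = (b₂.coord j').smulRight (b₁ i') := b₂.ext fun k => by
        rw [Module.Basis.linearMap_apply_apply]
        rcases eq_or_ne j' k with rfl | h
        · simp
        · simp [h]
      rw [this]
      rfl
    rw [happ, happ, map_smul, map_smul, map_smul, b₂.repr_self, b₁.repr_self]
    simp only [Finsupp.smul_apply, smul_eq_mul, Matrix.one_apply, Finsupp.single_apply,
      eq_comm (a := i')]
    ring
  have hA := hroots _ P₁ Q₁ d₁ hPQ₁ hd₁
  have hB := hroots _ P₂ Q₂ d₂ hPQ₂ hd₂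
  rw [LinearMap.charpoly_toMatrix] at hA hB
  rw [hA, hB, aroots_def, ← LinearMap.charpoly_toMatrix _ (b₂.linearMap b₁), ← Matrix.charpoly_map,
    hmat]
  have hmap : ((LinearMap.toMatrix b₁ b₁ γ₁) ⊗ₖ (1 : Matrix _ _ K) -
      (1 : Matrix _ _ K) ⊗ₖ (LinearMap.toMatrix b₂ b₂ γ₂)ᵀ).map φ =
      (P₁ * Matrix.diagonal d₁ * Q₁) ⊗ₖ 1 - 1 ⊗ₖ (Q₂ᵀ * Matrix.diagonal d₂ * P₂ᵀ) := by
    have : Q₂ᵀ * Matrix.diagonal d₂ * P₂ᵀ = ((LinearMap.toMatrix b₂ b₂ γ₂).map φ)ᵀ := by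
      rw [hd₂, Matrix.transpose_mul, Matrix.transpose_mul, Matrix.diagonal_transpose, mul_assoc]
    rw [← hd₁, this]
    ext ⟨i, j⟩ ⟨i', j'⟩
    simp [Matrix.kroneckerMap_apply, Matrix.one_apply, apply_ite φ]
  rw [hmap, charpoly_kronecker_sub_kronecker d₁ d₂ hPQ₁ (by
    rw [← Matrix.transpose_mul, hPQ₂, Matrix.transpose_one])]
  have := roots_multiset_prod_X_sub_C
    ((Finset.univ : Finset (_ × _)).val.map fun i => d₁ i.1 - d₂ i.2)
  rw [Multiset.map_map] at this
  refine this.trans ?_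
  rw [← Finset.univ_product_univ, Finset.product_val]
  simp [SProd.sprod, Multiset.product, Multiset.map_bind, Multiset.bind_map]
  rfl

theorem exists_smul_mem_of_span_eq_top {ℓ : ℕ} [Fact ℓ.Prime] {V : Type*} [AddCommGroup V]
    [Module ℚ_[ℓ] V] [Module ℤ_[ℓ] V] [IsScalarTower ℤ_[ℓ] ℚ_[ℓ] V] {L : Submodule ℤ_[ℓ] V}
    (hspan : Submodule.span ℚ_[ℓ] (L : Set V) = ⊤) (y : V) : ∃ a : ℤ_[ℓ], a ≠ 0 ∧ a • y ∈ L := by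
  have hy : y ∈ Submodule.span ℚ_[ℓ] (L : Set V) := hspan ▸ Submodule.mem_top
  induction hy using Submodule.span_induction with
  | mem x hx => exact ⟨1, one_ne_zero, by rwa [one_smul]⟩
  | zero => exact ⟨1, one_ne_zero, by simp⟩
  | add x y _ _ hx hy =>
    obtain ⟨a, ha, hx⟩ := hx
    obtain ⟨b, hb, hy⟩ := hy
    refine ⟨a * b, mul_ne_zero ha hb, ?_⟩
    rw [smul_add]
    refine L.add_mem ?_ ?_
    · rw [mul_comm, mul_smul]
      exact L.smul_mem _ hx
    · rw [mul_smul]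
      exact L.smul_mem _ hy
  | smul c x _ hx =>
    obtain ⟨a, ha, hx⟩ := hx
    obtain ⟨n, d, hd, rfl⟩ := IsFractionRing.div_surjective (A := ℤ_[ℓ]) c
    have hd0 : d ≠ 0 := nonZeroDivisors.ne_zero hd
    refine ⟨a * d, mul_ne_zero ha hd0, ?_⟩
    have : (a * d) • ((algebraMap ℤ_[ℓ] ℚ_[ℓ] n / algebraMap ℤ_[ℓ] ℚ_[ℓ] d) • x) =
        n • (a • x) := by
      have hd' : algebraMap ℤ_[ℓ] ℚ_[ℓ] d ≠ 0 := by
        simpa using hd0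
      simp only [← algebraMap_smul ℚ_[ℓ] (_ : ℤ_[ℓ]), smul_smul, map_mul]
      congr 1
      field_simp
    rw [this]
    exact L.smul_mem _ hx

theorem span_eq_top_of_forall_exists_smul_mem {ℓ : ℕ} [Fact ℓ.Prime] {V : Type*} [AddCommGroup V]
    [Module ℚ_[ℓ] V] [Module ℤ_[ℓ] V] [IsScalarTower ℤ_[ℓ] ℚ_[ℓ] V] {L : Submodule ℤ_[ℓ] V}
    (h : ∀ y : V, ∃ a : ℤ_[ℓ], a ≠ 0 ∧ a • y ∈ L) :
    Submodule.span ℚ_[ℓ] (L : Set V) = ⊤ := by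
  refine eq_top_iff.mpr fun y _ => ?_
  obtain ⟨a, ha, hy⟩ := h y
  have ha' : algebraMap ℤ_[ℓ] ℚ_[ℓ] a ≠ 0 := by
    simpa using ha
  have : y = (algebraMap ℤ_[ℓ] ℚ_[ℓ] a)⁻¹ • (a • y) := by
    rw [← algebraMap_smul ℚ_[ℓ] a y, smul_smul, inv_mul_cancel₀ ha', one_smul]
  rw [this]
  exact Submodule.smul_mem _ _ (Submodule.subset_span hy)

/-- The `ℤ_ℓ`-module of linear maps carrying `M₁` into `M₂`. -/
def homLattice {ℓ : ℕ} [Fact ℓ.Prime] {V₁ V₂ : Type*} [AddCommGroup V₁]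
    [Module ℚ_[ℓ] V₁] [Module ℤ_[ℓ] V₁]
    [AddCommGroup V₂] [Module ℚ_[ℓ] V₂] [Module ℤ_[ℓ] V₂] [IsScalarTower ℤ_[ℓ] ℚ_[ℓ] V₂]
    (M₁ : Submodule ℤ_[ℓ] V₁) (M₂ : Submodule ℤ_[ℓ] V₂) :
    Submodule ℤ_[ℓ] (V₁ →ₗ[ℚ_[ℓ]] V₂) where
  carrier := {Ψ | ∀ x ∈ M₁, Ψ x ∈ M₂}
  add_mem' h h' x hx := M₂.add_mem (h x hx) (h' x hx)
  zero_mem' _ _ := M₂.zero_mem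
  smul_mem' a _ h x hx := M₂.smul_mem a (h x hx)

theorem homLattice_isLattice {ℓ : ℕ} [Fact ℓ.Prime] {V₁ V₂ : Type*} [AddCommGroup V₁]
    [Module ℚ_[ℓ] V₁] [Module ℤ_[ℓ] V₁] [IsScalarTower ℤ_[ℓ] ℚ_[ℓ] V₁]
    [AddCommGroup V₂] [Module ℚ_[ℓ] V₂] [Module ℤ_[ℓ] V₂] [IsScalarTower ℤ_[ℓ] ℚ_[ℓ] V₂]
    {M₁ : Submodule ℤ_[ℓ] V₁} {M₂ : Submodule ℤ_[ℓ] V₂}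
    (hfg₁ : M₁.FG) (hspan₁ : Submodule.span ℚ_[ℓ] (M₁ : Set V₁) = ⊤)
    (hfg₂ : M₂.FG) (hspan₂ : Submodule.span ℚ_[ℓ] (M₂ : Set V₂) = ⊤) :
    (homLattice M₁ M₂).FG ∧
      Submodule.span ℚ_[ℓ] (homLattice M₁ M₂ : Set (V₁ →ₗ[ℚ_[ℓ]] V₂)) = ⊤ := by
  classical
  obtain ⟨t, rfl⟩ := hfg₁
  have hspan₁' : Submodule.span ℚ_[ℓ] (t : Set V₁) = ⊤ := by
    rwa [Submodule.span_span_of_tower] at hspan₁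
  constructor
  · have : Module.Finite ℤ_[ℓ] M₂ := Module.Finite.iff_fg.mpr hfg₂
    let j : homLattice (Submodule.span ℤ_[ℓ] (t : Set V₁)) M₂ →ₗ[ℤ_[ℓ]] (t → M₂) :=
      { toFun := fun Ψ x => ⟨Ψ.1 x, Ψ.2 x (Submodule.subset_span x.2)⟩
        map_add' := fun _ _ => rfl
        map_smul' := fun _ _ => rfl }
    have hj : Function.Injective j := fun a b hab => by
      refine Subtype.ext (LinearMap.ext_on hspan₁' fun x hx => ?_)
      exact congrArg Subtype.val (congrFun hab ⟨x, hx⟩)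
    have := isNoetherian_of_injective j hj
    exact Module.Finite.iff_fg.mp inferInstance
  · refine span_eq_top_of_forall_exists_smul_mem fun Φ => ?_
    choose a ha hmem using fun x => exists_smul_mem_of_span_eq_top hspan₂ (Φ x)
    refine ⟨∏ x ∈ t, a x, Finset.prod_ne_zero_iff.mpr fun x _ => ha x, fun x hx => ?_⟩
    induction hx using Submodule.span_induction with
    | mem x hx =>
      rw [LinearMap.smul_apply, ← Finset.prod_erase_mul _ _ hx, mul_smul]
      exact M₂.smul_mem _ (hmem x)
    | zero => simp
    | add x y _ _ hx hy =>
      rw [map_add]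
      exact M₂.add_mem hx hy
    | smul c x _ hx =>
      rw [LinearMap.map_smul_of_tower]
      exact M₂.smul_mem c hx

/-- The lattice of all `(x, y + Φ x)` with `x ∈ M₁` and `y ∈ M₂`. -/
def shearLattice {ℓ : ℕ} [Fact ℓ.Prime] {V₁ V₂ : Type*} [AddCommGroup V₁]
    [Module ℚ_[ℓ] V₁] [Module ℤ_[ℓ] V₁] [IsScalarTower ℤ_[ℓ] ℚ_[ℓ] V₁]
    [AddCommGroup V₂] [Module ℚ_[ℓ] V₂] [Module ℤ_[ℓ] V₂] [IsScalarTower ℤ_[ℓ] ℚ_[ℓ] V₂]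
    (M₁ : Submodule ℤ_[ℓ] V₁) (M₂ : Submodule ℤ_[ℓ] V₂) (Φ : V₁ →ₗ[ℚ_[ℓ]] V₂) :
    Submodule ℤ_[ℓ] (V₁ × V₂) where
  carrier := {z | z.1 ∈ M₁ ∧ z.2 - Φ z.1 ∈ M₂}
  add_mem' {z w} h h' := ⟨M₁.add_mem h.1 h'.1, by
    have := M₂.add_mem h.2 h'.2
    rw [Prod.fst_add, Prod.snd_add, map_add]
    convert this using 1
    abel⟩
  zero_mem' := by simp
  smul_mem' a z h := ⟨M₁.smul_mem a h.1, by
    have := M₂.smul_mem a h.2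
    rwa [Prod.smul_fst, Prod.smul_snd, LinearMap.map_smul_of_tower, ← smul_sub]⟩

theorem exists_eq_shearLattice {ℓ : ℕ} [Fact ℓ.Prime] {V₁ V₂ : Type*} [AddCommGroup V₁]
    [Module ℚ_[ℓ] V₁] [Module ℤ_[ℓ] V₁] [IsScalarTower ℤ_[ℓ] ℚ_[ℓ] V₁]
    [AddCommGroup V₂] [Module ℚ_[ℓ] V₂] [Module ℤ_[ℓ] V₂] [IsScalarTower ℤ_[ℓ] ℚ_[ℓ] V₂]
    {L : Submodule ℤ_[ℓ] (V₁ × V₂)} {M₁ : Submodule ℤ_[ℓ] V₁} {M₂ : Submodule ℤ_[ℓ] V₂}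
    (hfg₁ : M₁.FG) (hspan₁ : Submodule.span ℚ_[ℓ] (M₁ : Set V₁) = ⊤)
    (h₁ : ∀ x, x ∈ M₁ ↔ ∃ y, (x, y) ∈ L) (h₂ : ∀ y, y ∈ M₂ ↔ (0, y) ∈ L) :
    ∃ Φ : V₁ →ₗ[ℚ_[ℓ]] V₂, L = shearLattice M₁ M₂ Φ := by
  have : Submodule.IsLattice ℚ_[ℓ] M₁ := ⟨hfg₁, hspan₁⟩
  have : Module.Free ℤ_[ℓ] M₁ := Submodule.IsLattice.free ℚ_[ℓ] M₁
  let b := Module.Free.chooseBasis ℤ_[ℓ] M₁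
  let b' := b.extendOfIsLattice ℚ_[ℓ]
  choose c hc using fun i => (h₁ (b i)).mp (b i).2
  let Φ : V₁ →ₗ[ℚ_[ℓ]] V₂ := b'.constr ℚ_[ℓ] c
  have hΦ : ∀ x ∈ M₁, (x, Φ x) ∈ L := by
    intro x hx
    have : M₁ ≤ L.comap ((LinearMap.id.prod Φ).restrictScalars ℤ_[ℓ]) := by
      have hb : M₁ = Submodule.span ℤ_[ℓ] (Set.range fun i => (b i : V₁)) := by
        have := congrArg (Submodule.map M₁.subtype) b.span_eq
        rw [Submodule.map_span, Submodule.map_top, Submodule.range_subtype,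
            ← Set.range_comp] at this
        exact this.symm
      conv_lhs => rw [hb]
      rw [Submodule.span_le]
      rintro _ ⟨i, rfl⟩
      have h3 : Φ (b i) = c i := by
        rw [← Module.Basis.extendOfIsLattice_apply ℚ_[ℓ] b i]
        exact b'.constr_basis ℚ_[ℓ] c i
      show ((b i : V₁), Φ (b i)) ∈ L
      rw [h3]
      exact hc i
    exact this hx
  refine ⟨Φ, Submodule.ext fun z => ?_⟩
  have hsub : (z.1, Φ z.1) + (0, z.2 - Φ z.1) = z := by
    ext <;> simp
  refine ⟨fun hz => ?_, fun hz => ?_⟩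
  · have hz1 : z.1 ∈ M₁ := (h₁ _).mpr ⟨z.2, hz⟩
    refine ⟨hz1, (h₂ _).mpr ?_⟩
    rw [← eq_sub_iff_add_eq'] at hsub
    rw [hsub]
    exact L.sub_mem hz (hΦ _ hz1)
  · rw [← hsub]
    exact L.add_mem (hΦ _ hz.1) ((h₂ _).mp hz.2)

theorem norm_det_restrict_range_sylvesterOp {ℓ : ℕ} [Fact ℓ.Prime] {V₁ V₂ : Type*}
    [AddCommGroup V₁] [Module ℚ_[ℓ] V₁] [FiniteDimensional ℚ_[ℓ] V₁]
    [AddCommGroup V₂] [Module ℚ_[ℓ] V₂] [FiniteDimensional ℚ_[ℓ] V₂]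
    {γ₁ : V₁ →ₗ[ℚ_[ℓ]] V₁} {γ₂ : V₂ →ₗ[ℚ_[ℓ]] V₂} (h₁ : Squarefree (minpoly ℚ_[ℓ] γ₁))
    (h₂ : Squarefree (minpoly ℚ_[ℓ] γ₂)) :
    ‖LinearMap.det ((sylvesterOp γ₂ γ₁).restrict (p := LinearMap.range (sylvesterOp γ₂ γ₁))
      (q := LinearMap.range (sylvesterOp γ₂ γ₁)) fun x _ => ⟨x, rfl⟩)‖ =
      diffNorm (γ₂.charpoly.aroots (PadicAlgCl ℓ)) (γ₁.charpoly.aroots (PadicAlgCl ℓ)) := by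
  rw [norm_det_restrict_range _ (disjoint_ker_range_sylvesterOp h₂ h₁),
    aroots_charpoly_sylvesterOp h₂ h₁, Multiset.map_map, Multiset.prod_map_product_eq_prod_prod,
    diffNorm]
  refine congrArg _ (Multiset.map_congr rfl fun a _ => congrArg _
    (Multiset.map_congr rfl fun b _ => ?_))
  by_cases h : a = b <;> simp [h, sub_eq_zero]

theorem HasOrbitBound.prodMap {ℓ : ℕ} [Fact ℓ.Prime] {V₁ V₂ : Type*} [AddCommGroup V₁]
    [Module ℚ_[ℓ] V₁] [Module ℤ_[ℓ] V₁] [IsScalarTower ℤ_[ℓ] ℚ_[ℓ] V₁] [FiniteDimensional ℚ_[ℓ] V₁]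
    [AddCommGroup V₂] [Module ℚ_[ℓ] V₂] [Module ℤ_[ℓ] V₂] [IsScalarTower ℤ_[ℓ] ℚ_[ℓ] V₂]
    [FiniteDimensional ℚ_[ℓ] V₂] {γ₁ : V₁ →ₗ[ℚ_[ℓ]] V₁} {γ₂ : V₂ →ₗ[ℚ_[ℓ]] V₂}
    (hss₁ : Squarefree (minpoly ℚ_[ℓ] γ₁)) (hss₂ : Squarefree (minpoly ℚ_[ℓ] γ₂)) {B₁ B₂ : ℝ}
    (h₁ : HasOrbitBound γ₁ B₁) (h₂ : HasOrbitBound γ₂ B₂) :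
    HasOrbitBound (γ₁.prodMap γ₂) (B₁ * B₂ * (diffNorm (γ₂.charpoly.aroots (PadicAlgCl ℓ))
      (γ₁.charpoly.aroots (PadicAlgCl ℓ)))⁻¹) := by
  classical
  obtain ⟨S₁, hS₁, h₁⟩ := h₁
  obtain ⟨S₂, hS₂, h₂⟩ := h₂
  set m := diffNorm (γ₂.charpoly.aroots (PadicAlgCl ℓ)) (γ₁.charpoly.aroots (PadicAlgCl ℓ)) with hm
  have hm0 : 0 < m := diffNorm_pos _ _
  have hF : ∀ M : Submodule ℤ_[ℓ] V₁ × Submodule ℤ_[ℓ] V₂, ∃ F : Finset (V₁ →ₗ[ℚ_[ℓ]] V₂),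
      (F.card : ℝ) ≤ m⁻¹ ∧
      (M.1.FG → Submodule.span ℚ_[ℓ] (M.1 : Set V₁) = ⊤ → (∀ x ∈ M.1, γ₁ x ∈ M.1) →
       M.2.FG → Submodule.span ℚ_[ℓ] (M.2 : Set V₂) = ⊤ → (∀ x ∈ M.2, γ₂ x ∈ M.2) →
        ∀ Φ, sylvesterOp γ₂ γ₁ Φ ∈ homLattice M.1 M.2 →
          ∃ f ∈ F, ∃ k, sylvesterOp γ₂ γ₁ k = 0 ∧ ∃ h ∈ homLattice M.1 M.2, Φ = f + k + h) := by
    rintro ⟨M₁, M₂⟩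
    by_cases hM : (M₁.FG ∧ Submodule.span ℚ_[ℓ] (M₁ : Set V₁) = ⊤ ∧ (∀ x ∈ M₁, γ₁ x ∈ M₁)) ∧
      (M₂.FG ∧ Submodule.span ℚ_[ℓ] (M₂ : Set V₂) = ⊤ ∧ (∀ x ∈ M₂, γ₂ x ∈ M₂))
    · obtain ⟨⟨hfg₁, hspan₁, hγ₁⟩, ⟨hfg₂, hspan₂, hγ₂⟩⟩ := hM
      obtain ⟨hfg, hspan⟩ := homLattice_isLattice hfg₁ hspan₁ hfg₂ hspan₂
      obtain ⟨F, hF, hF'⟩ := exists_finset_reps_of_map_mem (sylvesterOp γ₂ γ₁)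
        (disjoint_ker_range_sylvesterOp hss₂ hss₁) (homLattice M₁ M₂) hfg hspan
        fun Ψ hΨ x hx => M₂.sub_mem (hγ₂ _ (hΨ x hx)) (hΨ _ (hγ₁ x hx))
      rw [norm_det_restrict_range_sylvesterOp hss₁ hss₂] at hF
      exact ⟨F, hF, fun _ _ _ _ _ _ => hF'⟩
    · refine ⟨∅, by simpa using hm0.le, fun a b c d e f => absurd ⟨⟨a, b, c⟩, ⟨d, e, f⟩⟩ hM⟩
  choose F hFcard hF using hF
  refine ⟨(S₁ ×ˢ S₂).biUnion fun M => (F M).image fun f => shearLattice M.1 M.2 f, ?_, ?_⟩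
  · have hcard := Finset.card_biUnion_le_card_mul (S₁ ×ˢ S₂)
      (fun M => (F M).image fun f => shearLattice M.1 M.2 f) ⌊m⁻¹⌋₊ fun M _ =>
        Nat.le_floor ((Nat.cast_le.mpr Finset.card_image_le).trans (hFcard M))
    refine (Nat.cast_le.mpr hcard).trans ?_
    rw [Finset.card_product, Nat.cast_mul, Nat.cast_mul]
    have := Nat.floor_le (inv_pos.mpr hm0).le
    have : (0 : ℝ) ≤ B₁ := (Nat.cast_nonneg _).trans hS₁
    have : (0 : ℝ) ≤ B₂ := (Nat.cast_nonneg _).trans hS₂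
    gcongr
  · intro L hfg hspan hL
    have hLmod : Module.Finite ℤ_[ℓ] L := Module.Finite.iff_fg.mpr hfg
    set L₁ : Submodule ℤ_[ℓ] V₁ := L.map (LinearMap.fst ℤ_[ℓ] V₁ V₂) with hL₁
    set L₂ : Submodule ℤ_[ℓ] V₂ := L.comap (LinearMap.inr ℤ_[ℓ] V₁ V₂) with hL₂
    have hfg₁ : L₁.FG := hfg.map _
    have hfg₂ : L₂.FG := by
      have : Function.Injective ((LinearMap.inr ℤ_[ℓ] V₁ V₂).restrict (p := L₂) (q := L)
          fun x hx => hx) := fun a b hab =>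
        Subtype.ext (congrArg (fun z : L => (z : V₁ × V₂).2) hab)
      have := isNoetherian_of_injective _ this
      exact Module.Finite.iff_fg.mp inferInstance
    have hspan₁ : Submodule.span ℚ_[ℓ] (L₁ : Set V₁) = ⊤ :=
      span_eq_top_of_forall_exists_smul_mem fun y => by
        obtain ⟨a, ha, h⟩ := exists_smul_mem_of_span_eq_top hspan (y, (0 : V₂))
        exact ⟨a, ha, _, h, rfl⟩
    have hspan₂ : Submodule.span ℚ_[ℓ] (L₂ : Set V₂) = ⊤ :=
      span_eq_top_of_forall_exists_smul_mem fun y => by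
        obtain ⟨a, ha, h⟩ := exists_smul_mem_of_span_eq_top hspan ((0 : V₁), y)
        refine ⟨a, ha, ?_⟩
        rwa [Prod.smul_mk, smul_zero] at h
    have hγ₁ : ∀ x ∈ L₁, γ₁ x ∈ L₁ := by
      rintro _ ⟨z, hz, rfl⟩
      exact ⟨_, hL z hz, rfl⟩
    have hγ₂ : ∀ x ∈ L₂, γ₂ x ∈ L₂ := fun x hx => by
      have := hL _ hx
      simpa [hL₂] using this
    obtain ⟨g₁, hg₁, hM₁⟩ := h₁ L₁ hfg₁ hspan₁ hγ₁
    obtain ⟨g₂, hg₂, hM₂⟩ := h₂ L₂ hfg₂ hspan₂ hγ₂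
    set M₁ := L₁.map (LinearMap.restrictScalars ℤ_[ℓ] (g₁ : V₁ →ₗ[ℚ_[ℓ]] V₁)) with hM₁'
    set M₂ := L₂.map (LinearMap.restrictScalars ℤ_[ℓ] (g₂ : V₂ →ₗ[ℚ_[ℓ]] V₂)) with hM₂'
    have hMfg₁ : M₁.FG := hfg₁.map _
    have hMfg₂ : M₂.FG := hfg₂.map _
    have hMspan₁ : Submodule.span ℚ_[ℓ] (M₁ : Set V₁) = ⊤ :=
      span_eq_top_of_forall_exists_smul_mem fun y => by
        obtain ⟨a, ha, h⟩ := exists_smul_mem_of_span_eq_top hspan₁ (g₁.symm y)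
        refine ⟨a, ha, _, h, ?_⟩
        rw [map_smul]
        simp
    have hMspan₂ : Submodule.span ℚ_[ℓ] (M₂ : Set V₂) = ⊤ :=
      span_eq_top_of_forall_exists_smul_mem fun y => by
        obtain ⟨a, ha, h⟩ := exists_smul_mem_of_span_eq_top hspan₂ (g₂.symm y)
        refine ⟨a, ha, _, h, ?_⟩
        rw [map_smul]
        simp
    have hMγ₁ : ∀ x ∈ M₁, γ₁ x ∈ M₁ := by
      rintro _ ⟨z, hz, rfl⟩
      exact ⟨_, hγ₁ z hz, hg₁ z⟩
    have hMγ₂ : ∀ x ∈ M₂, γ₂ x ∈ M₂ := by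
      rintro _ ⟨z, hz, rfl⟩
      exact ⟨_, hγ₂ z hz, hg₂ z⟩
    let G := LinearEquiv.prodCongr g₁ g₂
    set L' := L.map (LinearMap.restrictScalars ℤ_[ℓ] (G : (V₁ × V₂) →ₗ[ℚ_[ℓ]] (V₁ × V₂))) with hL'
    have hmem : ∀ z : V₁ × V₂, z ∈ L' ↔ (g₁.symm z.1, g₂.symm z.2) ∈ L := by
      intro z
      constructor
      · rintro ⟨w, hw, rfl⟩
        simpa [G] using hw
      · intro h
        exact ⟨_, h, by simp [G]⟩
    have hLγ : ∀ x ∈ L', γ₁.prodMap γ₂ x ∈ L' := by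
      rintro _ ⟨z, hz, rfl⟩
      exact ⟨_, hL z hz, Prod.ext (hg₁ z.1) (hg₂ z.2)⟩
    obtain ⟨Φ, hΦ⟩ := exists_eq_shearLattice (L := L') (M₁ := M₁) (M₂ := M₂) hMfg₁ hMspan₁
      (fun x => by
        constructor
        · rintro ⟨_, ⟨w, hw, rfl⟩, rfl⟩
          exact ⟨g₂ w.2, _, hw, rfl⟩
        · rintro ⟨y, w, hw, hwx⟩
          exact ⟨w.1, ⟨w, hw, rfl⟩, congrArg Prod.fst hwx⟩)
      (fun y => by
        rw [hmem]
        constructor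
        · rintro ⟨w, hw, rfl⟩
          simpa [hL₂] using hw
        · intro h
          exact ⟨_, by simpa [hL₂] using h, g₂.apply_symm_apply y⟩)
    have hDΦ : sylvesterOp γ₂ γ₁ Φ ∈ homLattice M₁ M₂ := fun x hx => by
      have h3 : (x, Φ x) ∈ L' := by
        rw [hΦ]
        exact ⟨hx, by simp⟩
      have h4 := hLγ _ h3
      rw [hΦ] at h4
      exact h4.2
    obtain ⟨f, hf, k, hk, h, hh, rfl⟩ :=
      hF (M₁, M₂) hMfg₁ hMspan₁ hMγ₁ hMfg₂ hMspan₂ hMγ₂ Φ hDΦ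
    have hk' : ∀ x, γ₂ (k x) = k (γ₁ x) := fun x =>
      sub_eq_zero.mp (LinearMap.congr_fun hk x)
    let T := (LinearEquiv.refl ℚ_[ℓ] V₁).skewProd (LinearEquiv.refl ℚ_[ℓ] V₂) (-k)
    have hT : ∀ z, T z = (z.1, z.2 - k z.1) := fun z => by
      simp [T, sub_eq_add_neg]
    refine ⟨G.trans T, fun z => ?_, ?_⟩
    · rw [LinearEquiv.trans_apply, LinearEquiv.trans_apply, hT, hT]
      refine Prod.ext (hg₁ z.1) ?_
      show g₂ (γ₂ z.2) - k (g₁ (γ₁ z.1)) = γ₂ (g₂ z.2 - k (g₁ z.1))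
      rw [map_sub, hk', hg₁, hg₂]
    · refine Finset.mem_biUnion.mpr ⟨(M₁, M₂), Finset.mem_product.mpr ⟨hM₁, hM₂⟩,
        Finset.mem_image.mpr ⟨f, hf, ?_⟩⟩
      have hcomp : L.map (LinearMap.restrictScalars ℤ_[ℓ]
          ((G.trans T : (V₁ × V₂) ≃ₗ[ℚ_[ℓ]] (V₁ × V₂)) : (V₁ × V₂) →ₗ[ℚ_[ℓ]] (V₁ × V₂))) =
          L'.map (LinearMap.restrictScalars ℤ_[ℓ] (T : (V₁ × V₂) →ₗ[ℚ_[ℓ]] (V₁ × V₂))) := by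
        rw [hL', ← Submodule.map_comp]
        rfl
      rw [hcomp, hΦ]
      ext z
      constructor
      · rintro ⟨hz1, hz2⟩
        refine ⟨(z.1, z.2 + k z.1), ⟨hz1, ?_⟩, ?_⟩
        · have := M₂.sub_mem hz2 (hh _ hz1)
          simp only [LinearMap.add_apply]
          convert this using 1
          abel
        · refine (hT _).trans ?_
          ext <;> simp
      · rintro ⟨w, ⟨hw1, hw2⟩, rfl⟩
        have hTw : (LinearMap.restrictScalars ℤ_[ℓ] (T : (V₁ × V₂) →ₗ[ℚ_[ℓ]] (V₁ × V₂))) w =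
          (w.1, w.2 - k w.1) := hT w
        rw [hTw]
        refine ⟨hw1, ?_⟩
        have := M₂.add_mem hw2 (hh _ hw1)
        simp only [LinearMap.add_apply] at this
        have he : w.2 - k w.1 - f w.1 = w.2 - (f w.1 + k w.1 + h w.1) + h w.1 := by abel
        exact he ▸ this

theorem hasOrbitBound_of_isSemisimple {ℓ : ℕ} [Fact ℓ.Prime] {V : Type*} [AddCommGroup V]
    [Module ℚ_[ℓ] V] [Module ℤ_[ℓ] V] [IsScalarTower ℤ_[ℓ] ℚ_[ℓ] V] [FiniteDimensional ℚ_[ℓ] V]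
    (γ : V →ₗ[ℚ_[ℓ]] V) (hss : Module.End.IsSemisimple γ)
    (hint : ∀ z ∈ γ.charpoly.aroots (PadicAlgCl ℓ), IsIntegral ℤ_[ℓ] z) :
    HasOrbitBound γ ((diffNorm (γ.charpoly.aroots (PadicAlgCl ℓ))
      (γ.charpoly.aroots (PadicAlgCl ℓ)))⁻¹ ^ 2) := by
  induction hn : Module.finrank ℚ_[ℓ] V using Nat.strong_induction_on generalizing V with
  | _ n ih =>
  subst hn
  rcases subsingleton_or_nontrivial V with hV | hV
  · refine ⟨{⊤}, ?_, fun L _ _ _ => ⟨LinearEquiv.refl _ _, fun _ => rfl, ?_⟩⟩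
    · rw [Finset.card_singleton, Nat.cast_one]
      exact one_le_pow₀ ((one_le_inv₀ (diffNorm_pos _ _)).mpr (diffNorm_le_one hint hint))
    · rw [Finset.mem_singleton]
      exact Subsingleton.elim _ _
  by_cases hsimple : ∀ U : Submodule ℚ_[ℓ] V, (∀ x ∈ U, γ x ∈ U) → U = ⊥ ∨ U = ⊤
  · exact HasOrbitBound.of_forall_invariant hsimple hint
  push Not at hsimple
  obtain ⟨U, hU, hbot, htop⟩ := hsimple
  obtain ⟨W, hW, hUW⟩ := Module.End.isSemisimple_iff.mp hss U hU
  have hWtop : W ≠ ⊤ := fun h => hbot (by simpa [h] using hUW.disjoint)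
  let γ₁ := γ.restrict hU
  let γ₂ := γ.restrict hW
  let e := Submodule.prodEquivOfIsCompl U W hUW
  have he : ∀ z, e (γ₁.prodMap γ₂ z) = γ (e z) := fun z => by
    simp only [e, γ₁, γ₂, LinearMap.prodMap_apply, Submodule.coe_prodEquivOfIsCompl', map_add]
    rfl
  have hchar : γ.charpoly = γ₁.charpoly * γ₂.charpoly := by
    rw [← LinearMap.charpoly_prodMap, ← LinearEquiv.charpoly_conj e]
    congr 1
    ext x
    rw [LinearEquiv.conj_apply_apply, he, e.apply_symm_apply]
  have hroots : γ.charpoly.aroots (PadicAlgCl ℓ) =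
      γ₁.charpoly.aroots (PadicAlgCl ℓ) + γ₂.charpoly.aroots (PadicAlgCl ℓ) := by
    rw [hchar, aroots_mul]
    exact mul_ne_zero γ₁.charpoly_monic.ne_zero γ₂.charpoly_monic.ne_zero
  have hint₁ : ∀ z ∈ γ₁.charpoly.aroots (PadicAlgCl ℓ), IsIntegral ℤ_[ℓ] z := fun z hz =>
    hint z (hroots ▸ Multiset.mem_add.mpr (Or.inl hz))
  have hint₂ : ∀ z ∈ γ₂.charpoly.aroots (PadicAlgCl ℓ), IsIntegral ℤ_[ℓ] z := fun z hz =>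
    hint z (hroots ▸ Multiset.mem_add.mpr (Or.inr hz))
  have hss₁ : Module.End.IsSemisimple γ₁ := Module.End.IsSemisimple.restrict hU hss
  have hss₂ : Module.End.IsSemisimple γ₂ := Module.End.IsSemisimple.restrict hW hss
  have ih₁ := ih _ (Submodule.finrank_lt htop) γ₁ hss₁ hint₁ rfl
  have ih₂ := ih _ (Submodule.finrank_lt hWtop) γ₂ hss₂ hint₂ rfl
  refine (HasOrbitBound.of_linearEquiv e he (HasOrbitBound.prodMap hss₁.minpoly_squarefree
    hss₂.minpoly_squarefree ih₁ ih₂)).mono ?_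
  rw [hroots, diffNorm_add_left, diffNorm_add_right, diffNorm_add_right,
    diffNorm_comm (γ₁.charpoly.aroots _) (γ₂.charpoly.aroots _)]
  have hpos := diffNorm_pos (γ₂.charpoly.aroots (PadicAlgCl ℓ)) (γ₁.charpoly.aroots (PadicAlgCl ℓ))
  have h1 : 1 ≤ (diffNorm (γ₂.charpoly.aroots (PadicAlgCl ℓ))
      (γ₁.charpoly.aroots (PadicAlgCl ℓ)))⁻¹ :=
    (one_le_inv₀ hpos).mpr (diffNorm_le_one hint₂ hint₁)
  simp only [mul_inv, mul_pow]
  set x := (diffNorm (γ₂.charpoly.aroots (PadicAlgCl ℓ)) (γ₁.charpoly.aroots (PadicAlgCl ℓ)))⁻¹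
  set y := (diffNorm (γ₁.charpoly.aroots (PadicAlgCl ℓ)) (γ₁.charpoly.aroots (PadicAlgCl ℓ)))⁻¹
  set z := (diffNorm (γ₂.charpoly.aroots (PadicAlgCl ℓ)) (γ₂.charpoly.aroots (PadicAlgCl ℓ)))⁻¹
  calc y ^ 2 * z ^ 2 * x ≤ y ^ 2 * z ^ 2 * x ^ 4 := by
        gcongr
        exact le_self_pow₀ h1 (by norm_num)
    _ = _ := by ring

theorem HasOrbitBound.finite_quot {ℓ : ℕ} [Fact ℓ.Prime] {V : Type*} [AddCommGroup V]
    [Module ℚ_[ℓ] V] [Module ℤ_[ℓ] V] [IsScalarTower ℤ_[ℓ] ℚ_[ℓ] V] {γ : V ≃ₗ[ℚ_[ℓ]] V} {B : ℝ}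
    (h : HasOrbitBound (γ : V →ₗ[ℚ_[ℓ]] V) B) :
    Finite (Quot (CentralizerRel ℓ V γ)) ∧ (Nat.card (Quot (CentralizerRel ℓ V γ)) : ℝ) ≤ B := by
  obtain ⟨S, hS, h⟩ := h
  choose g hg hgS using fun L : {L : Submodule ℤ_[ℓ] V // IsStableLattice ℓ V γ L} =>
    h L.1 L.2.1 L.2.2.1 L.2.2.2
  let s : Quot (CentralizerRel ℓ V γ) → S := fun q => ⟨_, hgS q.out⟩
  have hs : Function.Injective s := by
    intro q q' hqq
    have hqq : Submodule.map (LinearMap.restrictScalars ℤ_[ℓ] (g q.out : V →ₗ[ℚ_[ℓ]] V)) q.out.1 =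
        Submodule.map (LinearMap.restrictScalars ℤ_[ℓ] (g q'.out : V →ₗ[ℚ_[ℓ]] V)) q'.out.1 :=
      congrArg Subtype.val hqq
    rw [← Quot.out_eq q, ← Quot.out_eq q']
    refine Quot.sound ⟨(g q.out).trans (g q'.out).symm, fun x => ?_, ?_⟩
    · have h1 : g q.out (γ x) = γ (g q.out x) := hg _ x
      have h2 : g q'.out (γ ((g q'.out).symm (g q.out x))) =
          γ (g q'.out ((g q'.out).symm (g q.out x))) := hg _ _
      rw [LinearEquiv.trans_apply, LinearEquiv.trans_apply, h1, LinearEquiv.symm_apply_eq, h2,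
        LinearEquiv.apply_symm_apply]
    · ext x
      constructor
      · rintro ⟨y, hy, rfl⟩
        obtain ⟨w, hw, hwy⟩ : g q.out y ∈ Submodule.map (LinearMap.restrictScalars ℤ_[ℓ]
            (g q'.out : V →ₗ[ℚ_[ℓ]] V)) q'.out.1 := hqq ▸ ⟨y, hy, rfl⟩
        have : (g q'.out).symm (g q.out y) = w := by
          rw [LinearEquiv.symm_apply_eq]
          exact hwy.symm
        show (g q'.out).symm (g q.out y) ∈ q'.out.1
        rwa [this]
      · intro hx
        obtain ⟨w, hw, hwx⟩ : g q'.out x ∈ Submodule.map (LinearMap.restrictScalars ℤ_[ℓ]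
            (g q.out : V →ₗ[ℚ_[ℓ]] V)) q.out.1 := hqq ▸ ⟨x, hx, rfl⟩
        refine ⟨w, hw, ?_⟩
        show (g q'.out).symm (g q.out w) = x
        rw [LinearEquiv.symm_apply_eq]
        exact hwx
  refine ⟨Finite.of_injective s hs, le_trans ?_ hS⟩
  have := Nat.card_le_card_of_injective s hs
  rw [Nat.card_eq_fintype_card (α := S), Fintype.card_coe] at this
  exact_mod_cast this

theorem inv_diffNorm_eq_pow {ℓ : ℕ} [Fact ℓ.Prime] {ι : Type*} [Fintype ι]
    [DecidableEq (PadicAlgCl ℓ)]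
    (lam : ι → PadicAlgCl ℓ) {Δ : ℤ_[ℓ]}
    (hΔ : algebraMap ℚ_[ℓ] (PadicAlgCl ℓ) (Δ : ℚ_[ℓ]) =
      ∏ ij ∈ Finset.univ.filter (fun ij : ι × ι => lam ij.1 ≠ lam ij.2), (lam ij.1 - lam ij.2))
    {v : ℕ} (hv : (v : ℤ) = Δ.valuation) :
    (diffNorm (Finset.univ.val.map lam) (Finset.univ.val.map lam))⁻¹ = (ℓ : ℝ) ^ v := by
  have hne : Δ ≠ 0 := by
    rintro rfl
    rw [PadicInt.coe_zero, map_zero, eq_comm, Finset.prod_eq_zero_iff] at hΔ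
    obtain ⟨ij, hij, h⟩ := hΔ
    exact (Finset.mem_filter.mp hij).2 (sub_eq_zero.mp h)
  have h1 : diffNorm (Finset.univ.val.map lam) (Finset.univ.val.map lam) = ‖Δ‖ := by
    have h2 : ‖Δ‖ = ‖algebraMap ℚ_[ℓ] (PadicAlgCl ℓ) (Δ : ℚ_[ℓ])‖ :=
      (PadicAlgCl.norm_extends ℓ (Δ : ℚ_[ℓ])).symm
    rw [h2]
    rw [hΔ, norm_prod, Finset.prod_filter, diffNorm, Multiset.map_map]
    rw [← Finset.univ_product_univ, Finset.prod_product]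
    refine congrArg _ (Multiset.map_congr rfl fun i _ => ?_)
    rw [Function.comp_apply, Multiset.map_map]
    refine congrArg _ (Multiset.map_congr rfl fun j _ => ?_)
    by_cases h : lam i = lam j <;> simp [h]
  rw [h1, PadicInt.norm_eq_zpow_neg_valuation hne, ← zpow_neg, neg_neg, ← zpow_natCast]
  congr 1
  exact hv.symm

open scoped Classical in
/-- Let `γ` be a semisimple automorphism of a finite-dimensional `ℚ_ℓ`-vector space whose
characteristic polynomial `χ_γ` has coefficients in `ℤ_ℓ` (i.e. of norm at most 1), with
roots `λ₁, …, λ_d` (with multiplicity) in an algebraic closure, and let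
`v = v_ℓ(∏_{λ_i ≠ λ_j} (λ_i − λ_j))` (this product being an element `Δ` of `ℤ_ℓ`).  Then
the centralizer of `γ` in `GL(V)` has at most `(2ℓ)^{4v}` orbits on `γ`-stable lattices. -/
theorem stmt_8 [FiniteDimensional ℚ_[ℓ] V] (γ : V ≃ₗ[ℚ_[ℓ]] V)
    (hcoeff : ∀ i : ℕ, ‖(LinearMap.charpoly (γ : V →ₗ[ℚ_[ℓ]] V)).coeff i‖ ≤ 1)
    (hss : Squarefree (minpoly ℚ_[ℓ] (γ : V →ₗ[ℚ_[ℓ]] V)))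
    (lam : Fin (Module.finrank ℚ_[ℓ] V) → AlgebraicClosure ℚ_[ℓ])
    (hfac : (LinearMap.charpoly (γ : V →ₗ[ℚ_[ℓ]] V)).map
        (algebraMap ℚ_[ℓ] (AlgebraicClosure ℚ_[ℓ])) = ∏ i, (X - C (lam i)))
    (Δ : ℤ_[ℓ])
    (hΔ : algebraMap ℚ_[ℓ] (AlgebraicClosure ℚ_[ℓ]) (Δ : ℚ_[ℓ]) =
      ∏ ij ∈ Finset.univ.filter
        (fun ij : Fin (Module.finrank ℚ_[ℓ] V) × Fin (Module.finrank ℚ_[ℓ] V) =>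
          lam ij.1 ≠ lam ij.2), (lam ij.1 - lam ij.2))
    (v : ℕ) (hv : (v : ℤ) = Δ.valuation) :
    Finite (Quot (CentralizerRel ℓ V γ)) ∧
      Nat.card (Quot (CentralizerRel ℓ V γ)) ≤ (2 * ℓ) ^ (4 * v) := by
  have hroots : (γ : V →ₗ[ℚ_[ℓ]] V).charpoly.aroots (PadicAlgCl ℓ) = Finset.univ.val.map lam := by
    have h := roots_multiset_prod_X_sub_C (Finset.univ.val.map lam)
    rw [Multiset.map_map] at h
    exact (congrArg roots hfac).trans h
  have hint : ∀ z ∈ (γ : V →ₗ[ℚ_[ℓ]] V).charpoly.aroots (PadicAlgCl ℓ), IsIntegral ℤ_[ℓ] z :=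
    fun z hz => isIntegral_of_norm_coeff_le_one (LinearMap.charpoly_monic _) hcoeff
      (mem_aroots.mp hz).2
  have hbound := hasOrbitBound_of_isSemisimple (γ : V →ₗ[ℚ_[ℓ]] V)
    (Module.End.isSemisimple_of_squarefree_aeval_eq_zero hss (minpoly.aeval _ _)) hint
  rw [hroots, inv_diffNorm_eq_pow lam hΔ hv] at hbound
  obtain ⟨hfin, hcard⟩ := hbound.finite_quot
  refine ⟨hfin, ?_⟩
  have hcard : Nat.card (Quot (CentralizerRel ℓ V γ)) ≤ (ℓ ^ v) ^ 2 := by exact_mod_cast hcard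
  have hℓ : 1 ≤ ℓ := (Fact.out : ℓ.Prime).one_le
  calc Nat.card (Quot (CentralizerRel ℓ V γ)) ≤ ℓ ^ (v * 2) := by rwa [pow_mul]
    _ ≤ (2 * ℓ) ^ (v * 2) := Nat.pow_le_pow_left (by omega) _
    _ ≤ (2 * ℓ) ^ (4 * v) := Nat.pow_le_pow_right (by omega) (by omega)
end

section
/- Let n ≥ 1 and let H be a finite subgroup of GL_n(ℤ). Then for every prime q ≥ 3, the order of H divides the order of the finite group GL_n(ℤ/qℤ). -/
open Matrix

/-- Second-order binomial expansion of `(1 + x) ^ m` in a possibly noncommutative ring. -/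
theorem exists_one_add_pow_eq {R : Type*} [Ring R] (x : R) (m : ℕ) :
    ∃ d : R, (1 + x) ^ m = 1 + (m : ℤ) • x + (m.choose 2 : ℤ) • x ^ 2 + x ^ 3 * d := by
  induction m with
  | zero => exact ⟨0, by simp⟩
  | succ m ih =>
    obtain ⟨d, hd⟩ := ih
    refine ⟨d * (1 + x) + (m.choose 2 : ℤ) • 1, ?_⟩
    rw [pow_succ, hd, Nat.choose_succ_succ' m 1, Nat.choose_one_right]
    push_cast
    simp only [add_smul, one_smul, mul_add, add_mul, mul_one, one_mul, mul_smul_comm,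
      smul_mul_assoc, pow_succ, pow_zero, mul_assoc]
    abel

/-- If `1 + q ^ k • c` has prime order and `q` is an odd prime, then `q ∣ c`. -/
theorem exists_eq_smul_of_one_add_pow_eq_one {R : Type*} [Ring R] [IsAddTorsionFree R]
    {q p k : ℕ} (hq : q.Prime) (hq3 : 3 ≤ q) (hp : p.Prime) (hk : 1 ≤ k) (c : R)
    (h : (1 + (q ^ k : ℤ) • c) ^ p = 1) : ∃ e : R, c = (q : ℤ) • e := by
  obtain ⟨d, hd⟩ := exists_one_add_pow_eq ((q ^ k : ℤ) • c) p
  obtain ⟨l, rfl⟩ := Nat.exists_eq_add_of_le hk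
  have hq0 : (q : ℤ) ≠ 0 := by exact_mod_cast hq.ne_zero
  have expand : (q ^ (1 + l) : ℤ) • ((p : ℤ) • c + (p.choose 2 * q ^ (1 + l) : ℤ) • c ^ 2
      + (q ^ (2 + 2 * l) : ℤ) • (c ^ 3 * d)) = 0 := by
    rw [h, add_assoc, add_assoc, left_eq_add, smul_pow, smul_pow, smul_mul_assoc] at hd
    rw [← hd]
    module
  have hsum := (smul_eq_zero.1 expand).resolve_left (pow_ne_zero _ hq0)
  by_cases hpq : p = q
  · subst hpq
    obtain ⟨t, ht⟩ : p ∣ p.choose 2 := hp.dvd_choose_self (by norm_num) (by omega)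
    rw [ht] at hsum
    have hfactor : (p : ℤ) • (c + (t * p ^ (1 + l) : ℤ) • c ^ 2
        + (p ^ (1 + 2 * l) : ℤ) • (c ^ 3 * d)) = 0 := by
      rw [← hsum]
      push_cast
      module
    have hc := (smul_eq_zero.1 hfactor).resolve_left hq0
    refine ⟨-((t * p ^ l : ℤ) • c ^ 2 + (p ^ (2 * l) : ℤ) • (c ^ 3 * d)), ?_⟩
    rw [add_assoc] at hc
    refine (eq_neg_of_add_eq_zero_left hc).trans ?_
    module
  · obtain ⟨u, v, huv⟩ : IsCoprime (p : ℤ) q :=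
      Nat.isCoprime_iff_coprime.2 ((Nat.coprime_primes hp hq).2 hpq)
    refine ⟨v • c - u • ((p.choose 2 * q ^ l : ℤ) • c ^ 2
      + (q ^ (1 + 2 * l) : ℤ) • (c ^ 3 * d)), ?_⟩
    rw [add_assoc] at hsum
    have hpc := eq_neg_of_add_eq_zero_left hsum
    calc c = (u * p + v * q) • c := by rw [huv, one_smul]
      _ = u • ((p : ℤ) • c) + (v * q) • c := by rw [add_smul, mul_smul]
      _ = _ := by
        rw [hpc, add_comm, ← sub_eq_zero]
        module

/-- An integer matrix of prime order congruent to `1` modulo an odd prime is `1`. -/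
theorem Matrix.eq_one_of_pow_prime_eq_one {n : Type*} [Fintype n] [DecidableEq n]
    {q p : ℕ} (hq : q.Prime) (hq3 : 3 ≤ q) (hp : p.Prime) (A : Matrix n n ℤ)
    (hA : A ^ p = 1) (hmod : ∀ i j, (q : ℤ) ∣ (A - 1) i j) : A = 1 := by
  have : IsAddTorsionFree (Matrix n n ℤ) := inferInstanceAs (IsAddTorsionFree (n → n → ℤ))
  have key : ∀ k : ℕ, ∃ c : Matrix n n ℤ, A - 1 = (q ^ (k + 1) : ℤ) • c := by
    intro k
    induction k with
    | zero =>
      choose c hc using hmod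
      exact ⟨Matrix.of c, by ext i j; simpa using hc i j⟩
    | succ k ih =>
      obtain ⟨c, hc⟩ := ih
      obtain ⟨e, rfl⟩ := exists_eq_smul_of_one_add_pow_eq_one hq hq3 hp (Nat.succ_pos k) c
        (by rw [← hc, add_sub_cancel, hA])
      exact ⟨e, by rw [hc, smul_smul, ← pow_succ]⟩
  rw [← sub_eq_zero]
  ext i j
  refine Int.eq_zero_of_abs_lt_dvd (m := (q ^ (((A - 1) i j).natAbs + 1) : ℤ)) ?_ ?_
  · obtain ⟨c, hc⟩ := key ((A - 1) i j).natAbs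
    exact ⟨c i j, by conv_lhs => rw [hc]
                     simp⟩
  · rw [Int.abs_eq_natAbs]
    exact_mod_cast (Nat.lt_pow_self hq.one_lt).trans (Nat.pow_lt_pow_succ hq.one_lt)

/-- The order of any finite subgroup of `GL_n(ℤ)` divides the order of `GL_n(ℤ/qℤ)` for
every prime `q ≥ 3`. -/
theorem stmt_12 (n : ℕ) (hn : 1 ≤ n) (H : Subgroup (GL (Fin n) ℤ))
    (hH : (H : Set (GL (Fin n) ℤ)).Finite)
    (q : ℕ) (hq : q.Prime) (hq3 : 3 ≤ q) :
    Nat.card H ∣ Nat.card (GL (Fin n) (ZMod q)) := by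
  have : Finite H := hH
  let f : H →* GL (Fin n) (ZMod q) :=
    (Matrix.GeneralLinearGroup.map (Int.castRingHom (ZMod q))).comp H.subtype
  refine Subgroup.card_dvd_of_injective f ((injective_iff_map_eq_one' f).2 fun a => ⟨?_, ?_⟩)
  swap
  · rintro rfl
    exact map_one f
  intro ha
  by_contra hne
  have horder : orderOf a ≠ 1 := mt orderOf_eq_one_iff.1 hne
  obtain ⟨p, hp, m, hm⟩ := Nat.exists_prime_and_dvd horder
  have hpos : 0 < orderOf a := orderOf_pos a
  have hb : a ^ m = 1 := by
    have hfb : f (a ^ m) = 1 := by rw [map_pow, ha, one_pow]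
    have hbp : (a ^ m) ^ p = 1 := by rw [← pow_mul, mul_comm, ← hm, pow_orderOf_eq_one]
    generalize a ^ m = b at hfb hbp
    apply Subtype.ext
    apply Units.ext
    refine Matrix.eq_one_of_pow_prime_eq_one hq hq3 hp _ ?_ fun i j => ?_
    · simpa using congrArg (fun x : H => ((x : GL (Fin n) ℤ) : Matrix (Fin n) (Fin n) ℤ)) hbp
    · rw [← ZMod.intCast_zmod_eq_zero_iff_dvd _ q]
      have hij := congrArg (fun x : GL (Fin n) (ZMod q) => x i j) hfb
      simp [f, Matrix.one_apply] at hij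
      simp [Matrix.one_apply, hij]
  have hle := Nat.le_of_dvd (Nat.pos_of_ne_zero (by rintro rfl; omega))
    (orderOf_dvd_of_pow_eq_one hb)
  nlinarith [hp.two_le]
end

section
/- Let n ≥ 1, let p be an odd prime, and let H be a finite subgroup of GL_n(ℤ). Then the p-adic valuation of the order of H is at most M(n,p) := Σ_{a ≥ 0} ⌊ n / ((p−1)·p^a) ⌋ (a finite sum, e.g. it suffices to sum over 0 ≤ a ≤ n). -/
open Matrix

/-- A finite set of invertible integer matrices embeds in `GL_m(ℤ/q)` for all large `q`. -/
theorem exists_bound_injOn_map_castRingHom {m : Type*} [Fintype m] [DecidableEq m]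
    {S : Set (GL m ℤ)} (hS : S.Finite) :
    ∃ B : ℕ, ∀ q > B, Set.InjOn (GeneralLinearGroup.map (n := m) (Int.castRingHom (ZMod q))) S := by
  classical
  let B : ℕ := ∑ g ∈ hS.toFinset, ∑ i, ∑ j, (g i j).natAbs
  have hB : ∀ g ∈ S, ∀ i j, (g i j).natAbs ≤ B := by
    intro g hg i j
    calc (g i j).natAbs ≤ ∑ j, (g i j).natAbs :=
          Finset.single_le_sum (f := fun j => (g i j).natAbs) (fun _ _ => Nat.zero_le _)
            (Finset.mem_univ j)
      _ ≤ ∑ i, ∑ j, (g i j).natAbs :=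
          Finset.single_le_sum (f := fun i => ∑ j, (g i j).natAbs) (fun _ _ => Nat.zero_le _)
            (Finset.mem_univ i)
      _ ≤ B :=
          Finset.single_le_sum (f := fun g : GL m ℤ => ∑ i, ∑ j, (g i j).natAbs)
            (fun _ _ => Nat.zero_le _) (hS.mem_toFinset.2 hg)
  refine ⟨2 * B, fun q hq g hg h hh hgh => ?_⟩
  ext i j
  have hij : ((g i j : ℤ) : ZMod q) = ((h i j : ℤ) : ZMod q) := by
    simpa using congrArg (fun x : GL m (ZMod q) => x i j) hgh
  have hdvd : (q : ℤ) ∣ g i j - h i j := by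
    rw [← ZMod.intCast_zmod_eq_zero_iff_dvd, Int.cast_sub, hij, sub_self]
  have h1 := hB g hg i j
  have h2 := hB h hh i j
  have := Int.eq_zero_of_abs_lt_dvd hdvd (by rw [abs_lt]; omega)
  exact sub_eq_zero.1 this

/-- For an odd prime `p`, there are arbitrarily large primes that are primitive roots
modulo `p ^ 2`. -/
theorem exists_prime_gt_primitiveRoot_sq {p : ℕ} (hp : p.Prime) (hodd : Odd p) (B : ℕ) :
    ∃ q > B, q.Prime ∧ ∀ i, p ^ 2 ∣ q ^ i - 1 ↔ p * (p - 1) ∣ i := by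
  have hp2 : p ≠ 2 := by rintro rfl; exact absurd hodd (by decide)
  have : NeZero (p ^ 2) := ⟨pow_ne_zero _ hp.ne_zero⟩
  obtain ⟨g, hg⟩ := isCyclic_iff_exists_orderOf_eq_natCard.1
    (ZMod.isCyclic_units_of_prime_pow p hp hp2 2)
  obtain ⟨q, hqB, hq, hqg⟩ := Nat.forall_exists_prime_gt_and_eq_mod g.isUnit B
  refine ⟨q, hqB, hq, fun i => ?_⟩
  have hcard : Nat.card (ZMod (p ^ 2))ˣ = p * (p - 1) := by
    rw [Nat.card_eq_fintype_card, ZMod.card_units_eq_totient, Nat.totient_prime_pow hp two_pos]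
    simp
  rw [← hcard, ← hg, orderOf_dvd_iff_pow_eq_one, ← ZMod.natCast_eq_zero_iff,
    Nat.cast_sub (Nat.one_le_pow _ _ hq.pos), sub_eq_zero, Units.ext_iff]
  simp [hqg]

/-- The `p`-adic valuation of `q ^ i - 1` when `q` is a primitive root modulo `p ^ 2`. -/
theorem factorization_pow_sub_one_le {p q : ℕ} (hp : p.Prime) (hodd : Odd p) (hq : 1 < q)
    (hpq : ∀ i, p ^ 2 ∣ q ^ i - 1 ↔ p * (p - 1) ∣ i) {i : ℕ} (hi : i ≠ 0) :
    (q ^ i - 1).factorization p ≤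
      if p - 1 ∣ i then 1 + (i / (p - 1)).factorization p else 0 := by
  have : Fact p.Prime := ⟨hp⟩
  have hp1 : 0 < p - 1 := Nat.sub_pos_of_lt hp.one_lt
  have hne : ∀ j, j ≠ 0 → q ^ j - 1 ≠ 0 := fun j hj =>
    (Nat.sub_pos_of_lt (Nat.one_lt_pow hj hq)).ne'
  by_cases hpd : p ∣ q ^ i - 1
  swap
  · simp [Nat.factorization_eq_zero_of_not_dvd hpd]
  have lte : ∀ j k, j ≠ 0 → k ≠ 0 → p ∣ q ^ j - 1 →
      (q ^ (j * k) - 1).factorization p = (q ^ j - 1).factorization p + k.factorization p := by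
    intro j k hj hk hd
    have hnd : ¬ p ∣ q ^ j := fun h => by
      have h1 := (Nat.dvd_sub_iff_right (Nat.one_le_pow _ _ (by omega)) h).1 hd
      exact hp.one_lt.ne' (Nat.dvd_one.1 h1)
    have := padicValNat.pow_sub_pow (p := p) hodd (Nat.one_lt_pow hj hq) hd hnd hk
    simpa [Nat.factorization_def _ hp, pow_mul] using this
  have hdiv : p - 1 ∣ i := by
    have h1 := lte i p hi hp.ne_zero hpd
    rw [hp.factorization_self] at h1
    have h2 := (hp.dvd_iff_one_le_factorization (hne i hi)).1 hpd
    have h3 : p ^ 2 ∣ q ^ (i * p) - 1 :=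
      (hp.pow_dvd_iff_le_factorization (hne _ (mul_ne_zero hi hp.ne_zero))).2 (by omega)
    rw [hpq, mul_comm i p] at h3
    exact Nat.dvd_of_mul_dvd_mul_left hp.pos h3
  rw [if_pos hdiv]
  have hlt : (q ^ (p - 1) - 1).factorization p ≤ 1 := by
    by_contra! h
    have h3 := (hpq _).1 ((hp.pow_dvd_iff_le_factorization (hne _ hp1.ne')).2 h)
    have h4 := Nat.le_of_dvd hp1 h3
    nlinarith [hp.two_le]
  obtain ⟨k, rfl⟩ := hdiv
  have hk : k ≠ 0 := by rintro rfl; simp at hi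
  rw [Nat.mul_div_cancel_left _ hp1]
  have hd : p ∣ q ^ (p - 1) - 1 := by
    have hnd : ¬ p ∣ q := fun h => by
      have h1 := (Nat.dvd_sub_iff_right (Nat.one_le_pow _ _ (by omega)) (dvd_pow h hi)).1 hpd
      exact hp.one_lt.ne' (Nat.dvd_one.1 h1)
    have hq0 : (q : ZMod p) ≠ 0 := by rwa [Ne, ZMod.natCast_eq_zero_iff]
    rw [← ZMod.natCast_eq_zero_iff, Nat.cast_sub (Nat.one_le_pow _ _ (by omega))]
    simp [ZMod.pow_card_sub_one_eq_one hq0]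
  rw [lte _ k hp1.ne' hk hd]
  omega

theorem sum_range_ite_dvd_one_add_factorization (p d n : ℕ) :
    ∑ i ∈ Finset.range n,
      (if d ∣ i + 1 then 1 + ((i + 1) / d).factorization p else 0) =
      n / d + (n / d).factorial.factorization p := by
  induction n with
  | zero => simp
  | succ n ih =>
    rw [Finset.sum_range_succ, ih, Nat.succ_div]
    split_ifs with h
    · rw [Nat.factorial_succ, Nat.factorization_mul (Nat.succ_ne_zero _) (Nat.factorial_ne_zero _),
        Finsupp.add_apply, Nat.succ_eq_add_one]
      omega
    · simp

theorem div_add_factorization_factorial_div {p : ℕ} (hp : p.Prime) (d n : ℕ) :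
    n / d + (n / d).factorial.factorization p =
      ∑ a ∈ Finset.range (n + 1), n / (d * p ^ a) := by
  have hlog : Nat.log p (n / d) < n + 1 :=
    Nat.lt_succ_of_le ((Nat.log_le_self _ _).trans (Nat.div_le_self _ _))
  rw [Nat.factorization_factorial hp hlog, Finset.range_eq_Ico,
    Finset.sum_eq_sum_Ico_succ_bot n.succ_pos]
  simp [Nat.div_div_eq_div_mul]

/-- For an odd prime `p` and a finite subgroup `H ≤ GL_n(ℤ)`, the `p`-adic valuation of
`|H|` is at most `M(n,p) = Σ_{a ≥ 0} ⌊n / ((p−1)·p^a)⌋` (it suffices to sum over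
`0 ≤ a ≤ n`). -/
theorem stmt_13 (n : ℕ) (hn : 1 ≤ n) (p : ℕ) (hp : p.Prime) (hodd : Odd p)
    (H : Subgroup (GL (Fin n) ℤ)) (hH : (H : Set (GL (Fin n) ℤ)).Finite) :
    (Nat.card H).factorization p ≤ ∑ a ∈ Finset.range (n + 1), n / ((p - 1) * p ^ a) := by
  obtain ⟨B, hB⟩ := exists_bound_injOn_map_castRingHom hH
  obtain ⟨q, hq, hqp, hpq⟩ := exists_prime_gt_primitiveRoot_sq hp hodd (max B p)
  have : Fact q.Prime := ⟨hqp⟩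
  have : Finite H := hH.to_subtype
  have hinj : Function.Injective
      ((GeneralLinearGroup.map (n := Fin n) (Int.castRingHom (ZMod q))).comp H.subtype) :=
    fun x y hxy => Subtype.ext (hB q (by omega) x.2 y.2 hxy)
  have hdvd := Subgroup.card_dvd_of_injective _ hinj
  have hcard : Nat.card (GL (Fin n) (ZMod q)) =
      ∏ i ∈ Finset.range n, q ^ (n - 1 - i) * (q ^ (i + 1) - 1) := by
    rw [Matrix.card_GL_field, ← Finset.prod_range_reflect, Finset.prod_range]
    refine Finset.prod_congr rfl fun i _ => ?_
    have hi := i.2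
    rw [ZMod.card, Nat.mul_sub, mul_one, ← pow_add]
    congr 2 <;> omega
  have hfac : ∀ i, q ^ (i + 1) - 1 ≠ 0 := fun i =>
    (Nat.sub_pos_of_lt (Nat.one_lt_pow i.succ_ne_zero hqp.one_lt)).ne'
  have hqz : q.factorization p = 0 := by
    refine Nat.factorization_eq_zero_of_not_dvd fun h => ?_
    have := (Nat.prime_dvd_prime_iff_eq hp hqp).1 h
    omega
  calc (Nat.card H).factorization p
      ≤ (Nat.card (GL (Fin n) (ZMod q))).factorization p :=
        (Nat.factorization_le_iff_dvd Nat.card_pos.ne' Nat.card_pos.ne').2 hdvd p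
    _ = ∑ i ∈ Finset.range n, (q ^ (i + 1) - 1).factorization p := by
        rw [hcard, Nat.factorization_prod fun i _ =>
          mul_ne_zero (pow_ne_zero _ hqp.ne_zero) (hfac i), Finsupp.finsetSum_apply]
        refine Finset.sum_congr rfl fun i _ => ?_
        rw [Nat.factorization_mul (pow_ne_zero _ hqp.ne_zero) (hfac i)]
        simp [hqz]
    _ ≤ ∑ i ∈ Finset.range n,
          (if p - 1 ∣ i + 1 then 1 + ((i + 1) / (p - 1)).factorization p else 0) :=
        Finset.sum_le_sum fun i _ =>
          factorization_pow_sub_one_le hp hodd hqp.one_lt hpq i.succ_ne_zero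
    _ = ∑ a ∈ Finset.range (n + 1), n / ((p - 1) * p ^ a) := by
        rw [sum_range_ite_dvd_one_add_factorization, div_add_factorization_factorial_div hp]
end

section
/- Let p be an odd prime and n ≥ 1. There exists a prime q with q ≥ 3 and q not divisible by p such that for every 1 ≤ i ≤ n the p-adic valuation of q^i − 1 equals (p-adic valuation of i) + 1 if (p−1) divides i, and equals 0 otherwise. In particular, Σ_{i=1}^{n} v_p(q^i − 1) ≤ Σ_{a ≥ 0} ⌊ n / ((p−1)·p^a) ⌋. -/
/-- A prime `q` whose class modulo `p ^ 2` generates the unit group. -/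
lemma exists_prime_sq_dvd_pow_sub_one_iff (p : ℕ) (hp : p.Prime) (hp2 : p ≠ 2) :
    ∃ q : ℕ, q.Prime ∧ 3 ≤ q ∧ ¬ p ∣ q ∧
      ∀ i : ℕ, p ^ 2 ∣ q ^ i - 1 ↔ p * (p - 1) ∣ i := by
  have : NeZero (p ^ 2) := ⟨pow_ne_zero 2 hp.ne_zero⟩
  obtain ⟨g, hg⟩ := isCyclic_iff_exists_orderOf_eq_natCard.mp
    (ZMod.isCyclic_units_of_prime_pow p hp hp2 2)
  obtain ⟨q, hqp, hq, hqg⟩ := Nat.forall_exists_prime_gt_and_eq_mod g.isUnit (p + 2)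
  refine ⟨q, hq, by omega, ?_, fun i => ?_⟩
  · rw [Nat.prime_dvd_prime_iff_eq hp hq]
    omega
  · have h1 : 1 ≤ q ^ i := Nat.one_le_pow _ _ hq.pos
    have hord : orderOf g = p * (p - 1) := by
      rw [hg, Nat.card_eq_fintype_card, ZMod.card_units_eq_totient,
        Nat.totient_prime_pow hp two_pos]
      simp
    rw [← hord, orderOf_dvd_iff_pow_eq_one, ← ZMod.natCast_eq_zero_iff, Nat.cast_sub h1,
      sub_eq_zero, Nat.cast_pow, hqg, Nat.cast_one, Units.ext_iff]
    simp

/-- If `q` generates the units modulo `p ^ 2`, lifting the exponent computes the valuations. -/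
lemma factorization_pow_sub_one_of_generator {p q : ℕ} (hp : p.Prime) (hodd : Odd p)
    (hq : 2 ≤ q) (hpq : ¬ p ∣ q) (hgen : ∀ i : ℕ, p ^ 2 ∣ q ^ i - 1 ↔ p * (p - 1) ∣ i)
    {i : ℕ} (hi : i ≠ 0) :
    (q ^ i - 1).factorization p = if (p - 1) ∣ i then i.factorization p + 1 else 0 := by
  have : Fact p.Prime := ⟨hp⟩
  have hp1 : 0 < p - 1 := Nat.sub_pos_of_lt hp.one_lt
  have hlte (x k : ℕ) (hx : 1 < x) (hd : p ∣ x - 1) (hk : k ≠ 0) :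
      (x ^ k - 1).factorization p = (x - 1).factorization p + k.factorization p := by
    have hpx : ¬ p ∣ x := fun h => hp.one_lt.ne' <| Nat.dvd_one.mp <| by
      simpa [Nat.sub_sub_self hx.le] using Nat.dvd_sub h hd
    simpa [Nat.factorization_def _ hp] using
      padicValNat.pow_sub_pow (p := p) hodd hx hd hpx hk
  have hpos (k : ℕ) (hk : k ≠ 0) : 1 < q ^ k := Nat.one_lt_pow hk (by omega)
  split_ifs with h
  · obtain ⟨k, rfl⟩ := h
    have hk : k ≠ 0 := right_ne_zero_of_mul hi
    have hfermat : p ∣ q ^ (p - 1) - 1 :=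
      (Nat.modEq_iff_dvd' (hpos _ hp1.ne').le).mp
        (by simpa [Nat.totient_prime hp] using
          (Nat.ModEq.pow_totient ((Nat.Prime.coprime_iff_not_dvd hp).mpr hpq).symm).symm)
    have hne : q ^ (p - 1) - 1 ≠ 0 := (Nat.sub_pos_of_lt (hpos _ hp1.ne')).ne'
    have hone : (q ^ (p - 1) - 1).factorization p = 1 := by
      apply le_antisymm
      · by_contra! hlt
        have hdvd := (hgen (p - 1)).mp ((hp.pow_dvd_iff_le_factorization hne).mpr hlt)
        have := Nat.le_of_dvd hp1 ((Nat.dvd_mul_right p _).trans hdvd)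
        omega
      · exact (hp.dvd_iff_one_le_factorization hne).mp hfermat
    have hzero : (p - 1).factorization p = 0 :=
      Nat.factorization_eq_zero_of_lt (Nat.sub_lt hp.pos one_pos)
    rw [pow_mul, hlte _ k (hpos _ hp1.ne') hfermat hk, hone,
      Nat.factorization_mul hp1.ne' hk, Finsupp.add_apply, hzero]
    ring
  · refine Nat.factorization_eq_zero_of_not_dvd fun hd => h ?_
    have hne : q ^ (i * p) - 1 ≠ 0 :=
      (Nat.sub_pos_of_lt (hpos _ (mul_ne_zero hi hp.ne_zero))).ne'
    have hne' : q ^ i - 1 ≠ 0 := (Nat.sub_pos_of_lt (hpos _ hi)).ne'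
    have hsq : p ^ 2 ∣ q ^ (i * p) - 1 := by
      rw [hp.pow_dvd_iff_le_factorization hne, pow_mul, hlte _ p (hpos _ hi) hd hp.ne_zero,
        hp.factorization_self]
      have := (hp.dvd_iff_one_le_factorization hne').mp hd
      omega
    rw [hgen, mul_comm] at hsq
    exact Nat.dvd_of_mul_dvd_mul_right hp.pos hsq

lemma sum_factorization_add_one_le {p : ℕ} (hp : p.Prime) (n : ℕ) :
    ∑ i ∈ Finset.Icc 1 n, (if (p - 1) ∣ i then i.factorization p + 1 else 0) ≤
      ∑ a ∈ Finset.range (n + 1), n / ((p - 1) * p ^ a) := by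
  calc ∑ i ∈ Finset.Icc 1 n, (if (p - 1) ∣ i then i.factorization p + 1 else 0)
      ≤ ∑ i ∈ Finset.Icc 1 n, ∑ a ∈ Finset.range (n + 1),
          if (p - 1) * p ^ a ∣ i then 1 else 0 := by
        refine Finset.sum_le_sum fun i hi => ?_
        obtain ⟨hi1, hin⟩ := Finset.mem_Icc.mp hi
        split_ifs with h
        · rw [← Finset.card_filter]
          conv_lhs => rw [← Finset.card_range (i.factorization p + 1)]
          refine Finset.card_le_card fun a ha => ?_
          have hlt := Nat.factorization_lt p (n := i) (by omega)
          rw [Finset.mem_range] at ha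
          refine Finset.mem_filter.mpr ⟨Finset.mem_range.mpr (by omega), ?_⟩
          refine Nat.Coprime.mul_dvd_of_dvd_of_dvd ?_ h
            ((hp.pow_dvd_iff_le_factorization (by omega)).mpr (by omega))
          refine Nat.Coprime.pow_right a (Nat.Coprime.symm ?_)
          exact hp.coprime_iff_not_dvd.mpr
            (Nat.not_dvd_of_pos_of_lt (Nat.sub_pos_of_lt hp.one_lt)
              (Nat.sub_lt hp.pos one_pos))
        · exact Nat.zero_le _
    _ = ∑ a ∈ Finset.range (n + 1), n / ((p - 1) * p ^ a) := by
        rw [Finset.sum_comm]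
        refine Finset.sum_congr rfl fun a _ => ?_
        rw [← Finset.card_filter, ← Nat.Ioc_filter_dvd_card_eq_div]
        rfl


/-- For an odd prime `p` and `n ≥ 1`, there is a prime `q ≥ 3` not divisible by `p` such
that `v_p(q^i − 1) = v_p(i) + 1` when `(p−1) ∣ i` and `v_p(q^i − 1) = 0` otherwise, for all
`1 ≤ i ≤ n`; in particular `Σ_{i=1}^n v_p(q^i − 1) ≤ Σ_{a ≥ 0} ⌊n / ((p−1)·p^a)⌋`. -/
theorem stmt_14 (p : ℕ) (hp : p.Prime) (hodd : Odd p) (n : ℕ) (hn : 1 ≤ n) :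
    ∃ q : ℕ, q.Prime ∧ 3 ≤ q ∧ ¬ p ∣ q ∧
      (∀ i : ℕ, 1 ≤ i → i ≤ n →
        (q ^ i - 1).factorization p =
          if (p - 1) ∣ i then i.factorization p + 1 else 0) ∧
      ∑ i ∈ Finset.Icc 1 n, (q ^ i - 1).factorization p ≤
        ∑ a ∈ Finset.range (n + 1), n / ((p - 1) * p ^ a) := by
  obtain ⟨q, hq, hq3, hpq, hgen⟩ :=
    exists_prime_sq_dvd_pow_sub_one_iff p hp (by rintro rfl; exact absurd hodd (by decide))
  have hval (i : ℕ) (hi : 1 ≤ i) : (q ^ i - 1).factorization p =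
      if (p - 1) ∣ i then i.factorization p + 1 else 0 :=
    factorization_pow_sub_one_of_generator hp hodd (by omega) hpq hgen (by omega)
  refine ⟨q, hq, hq3, hpq, fun i hi _ => hval i hi, ?_⟩
  rw [Finset.sum_congr rfl fun i hi => hval i (Finset.mem_Icc.mp hi).1]
  exact sum_factorization_add_one_le hp n
end

section
/- There exists a constant C > 0 such that for every n ≥ 1, every finite subgroup H of GL_n(ℤ) has order at most n^n · exp(C·n). -/
open Matrix

/-- An integer matrix congruent modulo `ℓ` to an invertible scalar is right cancellable. -/
theorem eq_zero_of_mul_scalar_add {n : ℕ} {ℓ : ℕ} (hℓ : ℓ.Prime) {c : ℤ} (hc : ¬ (ℓ : ℤ) ∣ c)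
    {N T : Matrix (Fin n) (Fin n) ℤ} (h : N * (c • 1 + (ℓ : ℤ) • T) = 0) : N = 0 := by
  have := Fact.mk hℓ
  set S : Matrix (Fin n) (Fin n) ℤ := c • 1 + (ℓ : ℤ) • T with hS
  have hdet : S.det ≠ 0 := by
    intro h0
    have hmap : (Int.castRingHom (ZMod ℓ)).mapMatrix S = (c : ZMod ℓ) • 1 := by
      ext i j
      rw [hS]
      simp only [RingHom.mapMatrix_apply, Matrix.map_apply, Matrix.add_apply, Matrix.smul_apply,
        Matrix.one_apply, smul_eq_mul]
      split_ifs <;> simp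
    have h1 := RingHom.map_det (Int.castRingHom (ZMod ℓ)) S
    rw [hmap, h0, Matrix.det_smul] at h1
    have h2 : (c : ZMod ℓ) ≠ 0 := fun h => hc ((ZMod.intCast_zmod_eq_zero_iff_dvd c ℓ).1 h)
    rw [map_zero, det_one, mul_one] at h1
    exact pow_ne_zero _ h2 h1.symm
  have h1 : N * (S * S.adjugate) = 0 := by rw [← mul_assoc, h, zero_mul]
  rw [Matrix.mul_adjugate, Matrix.mul_smul, mul_one] at h1
  exact (smul_eq_zero.1 h1).resolve_left hdet

theorem exists_pow_eq_one_add_smul {R : Type*} [Ring R] (c : ℤ) (B : R) (i : ℕ) :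
    ∃ T : R, (1 + c • B) ^ i = 1 + (c * i) • B + (c ^ 2) • T := by
  induction i with
  | zero => exact ⟨0, by simp⟩
  | succ i ih =>
    obtain ⟨T, hT⟩ := ih
    refine ⟨(i : ℤ) • (B * B) + T + c • (T * B), ?_⟩
    rw [pow_succ, hT]
    simp only [mul_add, add_mul, smul_mul_assoc, mul_smul_comm, smul_smul, smul_add, mul_one,
      one_mul]
    push_cast
    module

theorem exists_geom_sum_eq {R : Type*} [Ring R] (c : ℤ) (B : R) (q : ℕ) :
    ∃ T : R, ∑ i ∈ Finset.range q, (1 + c • B) ^ i =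
      (q : ℤ) • 1 + (c * (∑ i ∈ Finset.range q, i : ℕ)) • B + (c ^ 2) • T := by
  choose T hT using exists_pow_eq_one_add_smul c B
  refine ⟨∑ i ∈ Finset.range q, T i, ?_⟩
  simp only [hT, Finset.sum_add_distrib, ← Finset.smul_sum, ← Finset.sum_smul]
  simp [Finset.mul_sum]

theorem eq_one_of_pow_prime_eq_one {n ℓ q : ℕ} (hℓ : ℓ.Prime) (hℓ2 : ℓ ≠ 2) (hq : q.Prime)
    {B : Matrix (Fin n) (Fin n) ℤ} (h : (1 + (ℓ : ℤ) • B) ^ q = 1) : (ℓ : ℤ) • B = 0 := by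
  obtain ⟨T, hT⟩ := exists_geom_sum_eq (ℓ : ℤ) B q
  have hmul := mul_geom_sum (1 + (ℓ : ℤ) • B) q
  rw [h, sub_self, hT, add_sub_cancel_left] at hmul
  by_cases hql : q = ℓ
  · subst hql
    obtain ⟨k, hk⟩ : q ∣ ∑ i ∈ Finset.range q, i := by
      obtain ⟨m, hm⟩ := hq.odd_of_ne_two hℓ2
      refine ⟨m, Nat.eq_of_mul_eq_mul_right two_pos ?_⟩
      rw [Finset.sum_range_id_mul_two, mul_assoc, mul_comm m 2]
      congr 1
      omega
    have hq0 : (q : ℤ) ≠ 0 := by exact_mod_cast hq.ne_zero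
    refine eq_zero_of_mul_scalar_add hq (c := 1) (T := (k : ℤ) • B + T) ?_ ?_
    · intro h1
      exact hq.one_lt.ne' (by exact_mod_cast Int.eq_one_of_dvd_one (by positivity) h1)
    · refine (smul_eq_zero.1 (?_ : (q : ℤ) • ((q : ℤ) • B *
        ((1 : ℤ) • 1 + (q : ℤ) • ((k : ℤ) • B + T))) = 0)).resolve_left hq0
      rw [← mul_smul_comm, ← hmul, hk]
      congr 1
      push_cast
      module
  · refine eq_zero_of_mul_scalar_add hℓ (c := q)
      (T := (∑ i ∈ Finset.range q, i : ℕ) • B + (ℓ : ℤ) • T) ?_ ?_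
    · rw [Int.natCast_dvd_natCast, Nat.prime_dvd_prime_iff_eq hℓ hq]
      exact fun h => hql h.symm
    · rw [← hmul]
      congr 1
      module

/-- Minkowski's lemma: for an odd prime `ℓ`, reduction modulo `ℓ` is injective on finite subgroups
of `GL n ℤ`. -/
theorem injective_reduction_of_finite {n ℓ : ℕ} (hℓ : ℓ.Prime) (hℓ2 : ℓ ≠ 2)
    (H : Subgroup (GL (Fin n) ℤ)) [Finite H] :
    Function.Injective
      ((GeneralLinearGroup.map (Int.castRingHom (ZMod ℓ))).comp H.subtype) := by
  set f := (GeneralLinearGroup.map (n := Fin n) (Int.castRingHom (ZMod ℓ))).comp H.subtype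
  rw [← MonoidHom.ker_eq_bot_iff, ← Subgroup.card_eq_one]
  by_contra hne
  obtain ⟨q, hq, hqd⟩ := Nat.exists_prime_and_dvd hne
  have := Fact.mk hq
  obtain ⟨⟨⟨A, hAH⟩, hA⟩, hord⟩ := exists_prime_orderOf_dvd_card' q hqd
  have hA' : GeneralLinearGroup.map (Int.castRingHom (ZMod ℓ)) A = 1 := hA
  have hB : ∀ i j, ∃ b : ℤ, A.1 i j - (1 : Matrix (Fin n) (Fin n) ℤ) i j = ℓ * b := by
    intro i j
    have h1 : (GeneralLinearGroup.map (Int.castRingHom (ZMod ℓ)) A).1 i j =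
      (1 : Matrix (Fin n) (Fin n) (ZMod ℓ)) i j := by rw [hA']; rfl
    refine (ZMod.intCast_zmod_eq_zero_iff_dvd _ ℓ).1 ?_
    have h2 : ((A.1 i j : ℤ) : ZMod ℓ) = (1 : Matrix (Fin n) (Fin n) (ZMod ℓ)) i j := h1
    rw [Int.cast_sub, h2]
    by_cases hij : i = j <;> simp [Matrix.one_apply, hij]
  choose B hB using hB
  have hAB : A.1 = 1 + (ℓ : ℤ) • Matrix.of B := by
    ext i j
    simp [← hB]
  have hpow : A ^ q = 1 := by
    have h1 := pow_orderOf_eq_one (⟨⟨A, hAH⟩, hA⟩ : f.ker)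
    rw [hord] at h1
    simpa [Subtype.ext_iff] using h1
  have hpow' : A.1 ^ q = 1 := by rw [← Units.val_pow_eq_pow_val, hpow]; rfl
  rw [hAB] at hpow'
  have hA1 : A = 1 := by
    apply Units.ext
    rw [hAB, eq_one_of_pow_prime_eq_one hℓ hℓ2 hq hpow']
    simp
  subst hA1
  apply hq.one_lt.ne'
  rw [← hord, orderOf_eq_one_iff]
  rfl

theorem exists_prime_primitive_root_sq {p : ℕ} (hp : p.Prime) (hp2 : p ≠ 2) :
    ∃ ℓ : ℕ, ℓ.Prime ∧ 2 < ℓ ∧ ∀ i, p ^ 2 ∣ ℓ ^ i - 1 ↔ p * (p - 1) ∣ i := by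
  have := Fact.mk hp
  have hcyc := ZMod.isCyclic_units_of_prime_pow p hp hp2 2
  have : NeZero (p ^ 2) := ⟨pow_ne_zero 2 hp.ne_zero⟩
  obtain ⟨g, hg⟩ := isCyclic_iff_exists_orderOf_eq_natCard.mp hcyc
  rw [Nat.card_eq_fintype_card, ZMod.card_units_eq_totient, Nat.totient_prime_pow_succ hp,
    pow_one] at hg
  obtain ⟨ℓ, hlt, hℓ, hℓg⟩ := Nat.forall_exists_prime_gt_and_eq_mod g.isUnit 2
  refine ⟨ℓ, hℓ, hlt, fun i => ?_⟩
  rw [← hg, orderOf_dvd_iff_pow_eq_one, ← ZMod.natCast_eq_zero_iff,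
    Nat.cast_sub (Nat.one_le_pow _ _ hℓ.pos), sub_eq_zero, Units.ext_iff]
  simp [hℓg]

theorem padicValNat_finset_prod {α : Type*} {p : ℕ} [Fact p.Prime] {s : Finset α} {f : α → ℕ}
    (hf : ∀ a ∈ s, f a ≠ 0) : padicValNat p (∏ a ∈ s, f a) = ∑ a ∈ s, padicValNat p (f a) := by
  simp_rw [← Nat.factorization_def _ (Fact.out : p.Prime)]
  exact Nat.factorization_prod_apply hf

theorem padicValNat_card_GL_zmod {p ℓ : ℕ} [Fact p.Prime] [Fact ℓ.Prime] (hpℓ : p ≠ ℓ) (n : ℕ) :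
    padicValNat p (Nat.card (GL (Fin n) (ZMod ℓ))) =
      ∑ j ∈ Finset.Icc 1 n, padicValNat p (ℓ ^ j - 1) := by
  have hℓ : ℓ.Prime := Fact.out
  have hlt : ∀ j, 0 < j → 1 < ℓ ^ j := fun j hj => Nat.one_lt_pow hj.ne' hℓ.one_lt
  rw [Matrix.card_GL_field, ZMod.card, Fin.prod_univ_eq_prod_range (fun i => ℓ ^ n - ℓ ^ i)]
  have h1 : ∀ i ∈ Finset.range n, ℓ ^ n - ℓ ^ i = ℓ ^ i * (ℓ ^ (n - i) - 1) := by
    intro i hi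
    rw [Nat.mul_sub, ← pow_add, mul_one, Nat.add_sub_cancel' (Finset.mem_range.1 hi).le]
  rw [Finset.prod_congr rfl h1, padicValNat_finset_prod]
  · have h2 : ∀ i ∈ Finset.range n, padicValNat p (ℓ ^ i * (ℓ ^ (n - i) - 1)) =
        padicValNat p (ℓ ^ (n - i) - 1) := by
      intro i hi
      have h3 := hlt (n - i) (by have := Finset.mem_range.1 hi; omega)
      rw [padicValNat.mul (pow_ne_zero _ hℓ.ne_zero) (by omega), padicValNat.pow,
        padicValNat_primes hpℓ]
      simp
    rw [Finset.sum_congr rfl h2]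
    refine Finset.sum_bij' (fun i _ => n - i) (fun j _ => n - j) ?_ ?_ ?_ ?_ ?_ <;>
      simp only [Finset.mem_range, Finset.mem_Icc] <;> intros <;> first | omega | trivial
  · intro i hi
    have h3 := hlt (n - i) (by have := Finset.mem_range.1 hi; omega)
    exact mul_ne_zero (pow_ne_zero _ hℓ.ne_zero) (by omega)

theorem sum_Icc_padicValNat {p : ℕ} [Fact p.Prime] (m : ℕ) :
    ∑ j ∈ Finset.Icc 1 m, padicValNat p j = padicValNat p m.factorial := by
  rw [← Finset.prod_Ico_id_eq_factorial, ← padicValNat_finset_prod]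
  · rfl
  intro i hi
  have := Finset.mem_Icc.1 hi
  omega

theorem padicValNat_pow_sub_one_of_primitive {p ℓ : ℕ} [Fact p.Prime] (hp2 : p ≠ 2) (hℓ : 2 < ℓ)
    (h : ∀ i, p ^ 2 ∣ ℓ ^ i - 1 ↔ p * (p - 1) ∣ i) {j : ℕ} (hj : j ≠ 0) :
    padicValNat p (ℓ ^ j - 1) = if p - 1 ∣ j then 1 + padicValNat p j else 0 := by
  have hp : p.Prime := Fact.out
  have hp3 : 2 < p := lt_of_le_of_ne hp.two_le hp2.symm
  have hlt : ∀ j, 0 < j → 1 < ℓ ^ j := fun j hj => Nat.one_lt_pow hj.ne' (by omega)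
  have hpℓ : ¬ p ∣ ℓ := by
    intro hd
    have h1 : p ∣ ℓ ^ (p * (p - 1)) - 1 :=
      (dvd_pow_self p two_ne_zero).trans ((h _).2 dvd_rfl)
    have h2 : 0 < p * (p - 1) := Nat.mul_pos hp.pos (by omega)
    have h3 : p ∣ ℓ ^ (p * (p - 1)) := dvd_pow hd h2.ne'
    exact hp.one_lt.ne' (Nat.dvd_one.1 ((Nat.dvd_sub_iff_right (hlt _ h2).le h3).1 h1))
  split_ifs with hdvd
  · obtain ⟨k, rfl⟩ := hdvd
    have hk : k ≠ 0 := by rintro rfl; simp at hj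
    have hcop : IsCoprime (ℓ : ℤ) p := by
      rw [Nat.isCoprime_iff_coprime, Nat.coprime_comm]
      exact (Nat.Prime.coprime_iff_not_dvd hp).2 hpℓ
    have hfer : p ∣ ℓ ^ (p - 1) - 1 := by
      have := (Int.ModEq.pow_card_sub_one_eq_one hp hcop).symm.dvd
      rw [← Int.natCast_dvd_natCast, Nat.cast_sub (hlt _ (by omega)).le]
      simpa using this
    have hone : padicValNat p (ℓ ^ (p - 1) - 1) = 1 := by
      have hne : ℓ ^ (p - 1) - 1 ≠ 0 := by have := hlt (p - 1) (by omega); omega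
      have h1 : 1 ≤ padicValNat p (ℓ ^ (p - 1) - 1) := one_le_padicValNat_of_dvd hne hfer
      have h2 : ¬ 2 ≤ padicValNat p (ℓ ^ (p - 1) - 1) := by
        rw [← padicValNat_dvd_iff_le hne, h]
        intro hd
        have := Nat.le_of_dvd (by omega) hd
        nlinarith [Nat.sub_pos_of_lt hp.one_lt]
      omega
    have hlte := padicValNat.pow_sub_pow (hp.odd_of_ne_two hp2) (hlt (p - 1) (by omega)) hfer
      (fun hd => hpℓ (hp.dvd_of_dvd_pow hd)) hk
    rw [one_pow, ← pow_mul, hone] at hlte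
    rw [hlte, padicValNat.mul (by omega) hk, padicValNat.eq_zero_of_not_dvd
      (Nat.not_dvd_of_pos_of_lt (by omega) (by omega : p - 1 < p)), zero_add]
  · apply padicValNat.eq_zero_of_not_dvd
    intro hd
    have hp1 : p ^ 2 ∣ ℓ ^ (j * p) - 1 := by
      have h1 := padicValNat.pow_sub_pow (hp.odd_of_ne_two hp2) (hlt j (by omega)) hd
        (fun hd => hpℓ (hp.dvd_of_dvd_pow hd)) hp.ne_zero
      have h2 := one_le_padicValNat_of_dvd (by have := hlt j (by omega); omega) hd
      rw [one_pow, ← pow_mul, padicValNat_self] at h1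
      have h3 := hlt (j * p) (Nat.mul_pos (by omega) hp.pos)
      rw [padicValNat_dvd_iff_le (by omega)]
      omega
    rw [h, mul_comm j p] at hp1
    exact hdvd (Nat.dvd_of_mul_dvd_mul_left hp.pos hp1)

theorem sq_mul_sum_padicValNat_le {p ℓ : ℕ} [Fact p.Prime] (hp2 : p ≠ 2) (hℓ : 2 < ℓ)
    (h : ∀ i, p ^ 2 ∣ ℓ ^ i - 1 ↔ p * (p - 1) ∣ i) (n : ℕ) :
    (p - 1) ^ 2 * ∑ j ∈ Finset.Icc 1 n, padicValNat p (ℓ ^ j - 1) ≤ p * n := by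
  have hp : p.Prime := Fact.out
  have hp1 : 0 < p - 1 := by have := hp.two_le; omega
  set m := n / (p - 1)
  have hsum : ∑ j ∈ Finset.Icc 1 n, padicValNat p (ℓ ^ j - 1) =
      m + padicValNat p m.factorial := by
    have h1 : ∀ j ∈ Finset.Icc 1 n, padicValNat p (ℓ ^ j - 1) =
        if p - 1 ∣ j then 1 + padicValNat p j else 0 := fun j hj =>
      padicValNat_pow_sub_one_of_primitive hp2 hℓ h (by have := Finset.mem_Icc.1 hj; omega)
    rw [Finset.sum_congr rfl h1, ← Finset.sum_filter]
    have h2 : ∑ k ∈ Finset.Icc 1 m, (1 + padicValNat p k) = m + padicValNat p m.factorial := by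
      simp [Finset.sum_add_distrib, sum_Icc_padicValNat]
    rw [← h2]
    symm
    refine Finset.sum_bij (fun k _ => (p - 1) * k) ?_ ?_ ?_ ?_
    · intro k hk
      obtain ⟨hk1, hk2⟩ := Finset.mem_Icc.1 hk
      refine Finset.mem_filter.2 ⟨Finset.mem_Icc.2 ⟨Nat.mul_pos hp1 hk1, ?_⟩, dvd_mul_right _ _⟩
      rw [mul_comm]
      exact (Nat.le_div_iff_mul_le hp1).1 hk2
    · intro a _ b _ hab
      exact Nat.eq_of_mul_eq_mul_left hp1 hab
    · intro j hj
      obtain ⟨hj, k, rfl⟩ := Finset.mem_filter.1 hj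
      obtain ⟨hj1, hj2⟩ := Finset.mem_Icc.1 hj
      refine ⟨k, Finset.mem_Icc.2 ⟨Nat.pos_of_mul_pos_left hj1, ?_⟩, rfl⟩
      exact (Nat.le_div_iff_mul_le hp1).2 (by rwa [mul_comm])
    · intro k hk
      have hk1 := (Finset.mem_Icc.1 hk).1
      rw [padicValNat.mul (by omega) (by omega), padicValNat.eq_zero_of_not_dvd
        (Nat.not_dvd_of_pos_of_lt (by omega) (by omega : p - 1 < p)), zero_add]
  have hfac : (p - 1) * padicValNat p m.factorial ≤ m := by
    rw [sub_one_mul_padicValNat_factorial]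
    exact Nat.sub_le _ _
  have hm : (p - 1) * m ≤ n := Nat.mul_div_le n (p - 1)
  rw [hsum]
  calc (p - 1) ^ 2 * (m + padicValNat p m.factorial)
      = (p - 1) * ((p - 1) * m + (p - 1) * padicValNat p m.factorial) := by ring
    _ ≤ (p - 1) * ((p - 1) * m + m) := by gcongr
    _ = (p - 1 + 1) * ((p - 1) * m) := by ring
    _ = p * ((p - 1) * m) := by rw [Nat.sub_add_cancel hp.one_le]
    _ ≤ p * n := by gcongr

theorem sum_padicValNat_two_le (n : ℕ) :
    ∑ j ∈ Finset.Icc 1 n, padicValNat 2 (3 ^ j - 1) ≤ 4 * n := by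
  have h1 : ∀ j ∈ Finset.Icc 1 n, padicValNat 2 (3 ^ j - 1) ≤ 3 + padicValNat 2 j := by
    intro j hj
    have hj0 : j ≠ 0 := by have := Finset.mem_Icc.1 hj; omega
    have h2 := padicValNat.pow_two_sub_pow (x := 3) (y := 1) (by norm_num) (by norm_num)
      (by norm_num) (n := 2 * j) (by omega) (even_two_mul j)
    have h4 : padicValNat 2 4 = 2 := by
      rw [show 4 = 2 ^ 2 by norm_num, padicValNat.prime_pow]
    rw [padicValNat.mul two_ne_zero hj0] at h2
    simp only [one_pow, Nat.reduceAdd, Nat.reduceSub, h4, padicValNat_self] at h2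
    have hd : 3 ^ j - 1 ∣ 3 ^ (2 * j) - 1 := by
      simpa [pow_mul'] using Nat.sub_dvd_pow_sub_pow (3 ^ j) 1 2
    have h5 : 3 ^ (2 * j) - 1 ≠ 0 := by
      have := Nat.one_lt_pow (n := 2 * j) (by omega) (by norm_num : 1 < 3)
      omega
    have := (padicValNat_dvd_iff_le h5).1 ((pow_padicValNat_dvd (p := 2)).trans hd)
    omega
  refine (Finset.sum_le_sum h1).trans ?_
  have h2 := sub_one_mul_padicValNat_factorial (p := 2) n
  simp [Finset.sum_add_distrib, sum_Icc_padicValNat]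
  omega

/-- An upper bound of Mertens type. -/
theorem sum_log_div_primesLE_le {N : ℕ} (hN : N ≠ 0) :
    ∑ p ∈ Nat.primesLE N, Real.log p / p ≤ Real.log N + Real.log 4 := by
  have hN0 : (0 : ℝ) < N := by positivity
  have hθ := Chebyshev.theta_le_log4_mul_x hN0.le
  rw [Chebyshev.theta_eq_sum_primesLE_log] at hθ
  have hprime : ∀ p ∈ Nat.primesLE N, p.Prime := fun p hp => (Nat.mem_primesLE.1 hp).2
  have hfac : ∑ p ∈ Nat.primesLE N, ((N / p : ℕ) : ℝ) * Real.log p ≤ N * Real.log N := by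
    have hdvd : ∏ p ∈ Nat.primesLE N, p ^ (N / p) ∣ N.factorial := by
      refine Finset.prod_dvd_of_isRelPrime ?_ ?_
      · intro p hp q hq hpq
        exact Nat.coprime_iff_isRelPrime.1 (Nat.Coprime.pow _ _
          ((Nat.coprime_primes (hprime p hp) (hprime q hq)).2 hpq))
      · intro p hp
        have := Fact.mk (hprime p hp)
        rw [padicValNat_dvd_iff_le N.factorial_ne_zero,
          padicValNat_factorial (b := Nat.log p N + 2) (by omega)]
        have := Finset.single_le_sum (f := fun i => N / p ^ i) (fun _ _ => Nat.zero_le _)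
          (Finset.mem_Ico.2 ⟨le_rfl, by omega⟩ : 1 ∈ Finset.Ico 1 (Nat.log p N + 2))
        simpa using this
    have hle : ∏ p ∈ Nat.primesLE N, p ^ (N / p) ≤ N ^ N :=
      (Nat.le_of_dvd N.factorial_pos hdvd).trans (Nat.factorial_le_pow N)
    have hlog : Real.log (∏ p ∈ Nat.primesLE N, (p : ℝ) ^ (N / p)) ≤ Real.log ((N : ℝ) ^ N) := by
      refine Real.log_le_log (Finset.prod_pos fun p hp => ?_) (by exact_mod_cast hle)
      have := (hprime p hp).pos
      positivity
    rw [Real.log_prod, Real.log_pow] at hlog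
    · simpa using hlog
    · intro p hp
      have := (hprime p hp).pos
      positivity
  have hfloor : ∑ p ∈ Nat.primesLE N, ((N : ℝ) / p - 1) * Real.log p ≤ N * Real.log N := by
    refine le_trans (Finset.sum_le_sum fun p hp => ?_) hfac
    refine mul_le_mul_of_nonneg_right ?_ (Real.log_natCast_nonneg p)
    have := Nat.lt_floor_add_one ((N : ℝ) / p)
    rw [Nat.floor_div_eq_div] at this
    linarith
  have hsplit : ∑ p ∈ Nat.primesLE N, ((N : ℝ) / p - 1) * Real.log p =
      N * ∑ p ∈ Nat.primesLE N, Real.log p / p - ∑ p ∈ Nat.primesLE N, Real.log p := by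
    rw [Finset.mul_sum, ← Finset.sum_sub_distrib]
    exact Finset.sum_congr rfl fun p _ => by ring
  rw [hsplit] at hfloor
  have : (N : ℝ) * ∑ p ∈ Nat.primesLE N, Real.log p / p ≤ N * (Real.log N + Real.log 4) := by
    linarith
  exact le_of_mul_le_mul_left this hN0

theorem div_sub_one_sq_mul_log_le {p : ℕ} (hp : 2 ≤ p) :
    (p : ℝ) / (p - 1) ^ 2 * Real.log p ≤ Real.log p / p + 16 * (1 / (p : ℝ) ^ (3 / 2 : ℝ)) := by
  have hp2 : (2 : ℝ) ≤ p := by exact_mod_cast hp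
  have hp0 : (0 : ℝ) < p := by linarith
  have hlog0 : 0 ≤ Real.log p := Real.log_natCast_nonneg p
  have hlog : Real.log p ≤ 2 * (p : ℝ) ^ (1 / 2 : ℝ) := by
    have := Real.log_le_rpow_div hp0.le (ε := 1 / 2) (by norm_num)
    linarith
  have hfrac : (p : ℝ) / (p - 1) ^ 2 ≤ 1 / p + 8 / p ^ 2 := by
    have h1 : (0 : ℝ) < p - 1 := by linarith
    rw [div_add_div _ _ hp0.ne' (by positivity), div_le_div_iff₀ (by positivity) (by positivity)]
    have : 0 ≤ (p : ℝ) * (p - 2) * (6 * p - 4) := by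
      apply mul_nonneg (mul_nonneg hp0.le (by linarith)) (by linarith)
    nlinarith
  have hpow : 8 / (p : ℝ) ^ 2 * (2 * (p : ℝ) ^ (1 / 2 : ℝ)) =
      16 * (1 / (p : ℝ) ^ (3 / 2 : ℝ)) := by
    have : (p : ℝ) ^ (2 : ℕ) = (p : ℝ) ^ (3 / 2 : ℝ) * (p : ℝ) ^ (1 / 2 : ℝ) := by
      rw [← Real.rpow_add hp0, ← Real.rpow_natCast]
      norm_num
    rw [this]
    have h2 : (p : ℝ) ^ (1 / 2 : ℝ) ≠ 0 := (Real.rpow_pos_of_pos hp0 _).ne'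
    field_simp
    norm_num
  calc (p : ℝ) / (p - 1) ^ 2 * Real.log p ≤ (1 / p + 8 / p ^ 2) * Real.log p := by gcongr
    _ = Real.log p / p + 8 / p ^ 2 * Real.log p := by ring
    _ ≤ Real.log p / p + 8 / p ^ 2 * (2 * (p : ℝ) ^ (1 / 2 : ℝ)) := by gcongr
    _ = _ := by rw [hpow]

theorem padicValNat_card_le {n ℓ p : ℕ} [Fact p.Prime] (hℓ : ℓ.Prime) (hℓ2 : ℓ ≠ 2) (hpℓ : p ≠ ℓ)
    (H : Subgroup (GL (Fin n) ℤ)) [Finite H] :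
    padicValNat p (Nat.card H) ≤ ∑ j ∈ Finset.Icc 1 n, padicValNat p (ℓ ^ j - 1) := by
  have := Fact.mk hℓ
  rw [← padicValNat_card_GL_zmod hpℓ]
  have hdvd := Subgroup.card_dvd_of_injective _ (injective_reduction_of_finite hℓ hℓ2 H)
  exact (padicValNat_dvd_iff_le Nat.card_pos.ne').1 ((pow_padicValNat_dvd (p := p)).trans hdvd)

/-- A slightly weakened form of Minkowski's bound at odd primes. -/
theorem sq_mul_factorization_card_le {n p : ℕ} (hp : p.Prime) (hp2 : p ≠ 2)
    (H : Subgroup (GL (Fin n) ℤ)) [Finite H] :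
    (p - 1) ^ 2 * (Nat.card H).factorization p ≤ p * n := by
  have := Fact.mk hp
  obtain ⟨ℓ, hℓ, hℓ2, h⟩ := exists_prime_primitive_root_sq hp hp2
  have hpℓ : p ≠ ℓ := by
    rintro rfl
    have h1 := (h (p * (p - 1))).2 dvd_rfl
    have h2 : 0 < p * (p - 1) := Nat.mul_pos hp.pos (by omega)
    have h3 : p ∣ p ^ (p * (p - 1)) := dvd_pow_self p h2.ne'
    exact hp.one_lt.ne' (Nat.dvd_one.1 ((Nat.dvd_sub_iff_right (Nat.one_le_pow _ _ hp.pos) h3).1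
      ((dvd_pow_self p two_ne_zero).trans h1)))
  rw [Nat.factorization_def _ hp]
  exact (Nat.mul_le_mul_left _ (padicValNat_card_le hℓ hℓ2.ne' hpℓ H)).trans
    (sq_mul_sum_padicValNat_le hp2 hℓ2 h n)

theorem factorization_card_two_le {n : ℕ} (H : Subgroup (GL (Fin n) ℤ)) [Finite H] :
    (Nat.card H).factorization 2 ≤ 4 * n := by
  rw [Nat.factorization_def _ Nat.prime_two]
  exact (padicValNat_card_le Nat.prime_three (by norm_num) (by norm_num) H).trans
    (sum_padicValNat_two_le n)

theorem le_add_one_of_mem_primeFactors_card {n p : ℕ} (hn : 1 ≤ n)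
    (H : Subgroup (GL (Fin n) ℤ)) [Finite H] (hp : p ∈ (Nat.card H).primeFactors) :
    p ≤ n + 1 := by
  obtain ⟨hp, hd, h0⟩ := Nat.mem_primeFactors.1 hp
  by_cases hp2 : p = 2
  · omega
  have h1 := sq_mul_factorization_card_le hp hp2 H
  have h2 : 1 ≤ (Nat.card H).factorization p := hp.factorization_pos_of_dvd h0 hd
  have h3 : (p - 1) ^ 2 * 1 ≤ p * n := (Nat.mul_le_mul_left _ h2).trans h1
  obtain ⟨m, rfl⟩ : ∃ m, p = m + 1 := ⟨p - 1, by have := hp.one_le; omega⟩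
  simp only [Nat.add_sub_cancel] at h3
  by_contra hlt
  obtain ⟨k, rfl⟩ : ∃ k, m = n + 1 + k := ⟨m - n - 1, by omega⟩
  nlinarith

theorem log_card_le {n : ℕ} (hn : 1 ≤ n) (H : Subgroup (GL (Fin n) ℤ)) [Finite H] :
    Real.log (Nat.card H) ≤ n * Real.log n +
      (1 + Real.log 4 + 16 * ∑' k : ℕ, 1 / (k : ℝ) ^ (3 / 2 : ℝ) + 4 * Real.log 2) * n := by
  have hn0 : (0 : ℝ) < n := by exact_mod_cast hn
  have hsummable : Summable fun k : ℕ => 1 / (k : ℝ) ^ (3 / 2 : ℝ) :=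
    Real.summable_one_div_nat_rpow.2 (by norm_num)
  have hterm0 : ∀ k : ℕ, 0 ≤ 1 / (k : ℝ) ^ (3 / 2 : ℝ) := fun k => by positivity
  have hlog0 : ∀ k : ℕ, 0 ≤ Real.log k := Real.log_natCast_nonneg
  have hterm : ∀ p ∈ Nat.primesLE (n + 1), (Nat.card H).factorization p * Real.log p ≤
      n * (Real.log p / p + 16 * (1 / (p : ℝ) ^ (3 / 2 : ℝ))) +
        if p = 2 then 4 * n * Real.log 2 else 0 := by
    intro p hp
    have hp := (Nat.mem_primesLE.1 hp).2
    split_ifs with hp2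
    · subst hp2
      have h1 : ((Nat.card H).factorization 2 : ℝ) ≤ 4 * n := by
        exact_mod_cast factorization_card_two_le H
      have h2 : ((Nat.card H).factorization 2 : ℝ) * Real.log (2 : ℕ) ≤ 4 * n * Real.log 2 := by
        push_cast
        gcongr
      have h3 : 0 ≤ (n : ℝ) * (Real.log (2 : ℕ) / (2 : ℕ) +
          16 * (1 / ((2 : ℕ) : ℝ) ^ (3 / 2 : ℝ))) := by
        have := hlog0 2
        positivity
      exact le_add_of_nonneg_of_le h3 h2
    · have h1 : ((p : ℝ) - 1) ^ 2 * (Nat.card H).factorization p ≤ p * n := by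
        have := sq_mul_factorization_card_le hp hp2 H
        rw [← Nat.cast_one, ← Nat.cast_sub hp.one_le]
        exact_mod_cast this
      have hp1 : (0 : ℝ) < p - 1 := by
        have : (1 : ℝ) < p := by exact_mod_cast hp.one_lt
        linarith
      have h2 : ((Nat.card H).factorization p : ℝ) ≤ n * (p / (p - 1) ^ 2) := by
        rw [← mul_div_assoc, le_div_iff₀ (by positivity)]
        linarith
      rw [add_zero]
      calc ((Nat.card H).factorization p : ℝ) * Real.log p
          ≤ n * (p / (p - 1) ^ 2) * Real.log p := mul_le_mul_of_nonneg_right h2 (hlog0 p)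
        _ = n * (p / (p - 1) ^ 2 * Real.log p) := by ring
        _ ≤ _ := mul_le_mul_of_nonneg_left (div_sub_one_sq_mul_log_le hp.two_le) hn0.le
  have hsub : (Nat.card H).primeFactors ⊆ Nat.primesLE (n + 1) := fun p hp =>
    Nat.mem_primesLE.2 ⟨le_add_one_of_mem_primeFactors_card hn H hp, Nat.prime_of_mem_primeFactors hp⟩
  have hmertens := sum_log_div_primesLE_le n.succ_ne_zero
  have htsum : ∑ p ∈ Nat.primesLE (n + 1), 1 / (p : ℝ) ^ (3 / 2 : ℝ) ≤
      ∑' k : ℕ, 1 / (k : ℝ) ^ (3 / 2 : ℝ) :=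
    hsummable.sum_le_tsum _ fun k _ => hterm0 k
  have hlogsucc : n * Real.log (n + 1 : ℕ) ≤ n * Real.log n + n := by
    have h1 : Real.log ((n + 1 : ℕ) / n) ≤ (n + 1 : ℕ) / n - 1 :=
      Real.log_le_sub_one_of_pos (by positivity)
    rw [Real.log_div (by positivity) hn0.ne'] at h1
    have h2 : (n : ℝ) * (((n + 1 : ℕ) : ℝ) / n - 1) = 1 := by
      push_cast
      field_simp
      ring
    have h3 := mul_le_mul_of_nonneg_left h1 hn0.le
    have h4 : (1 : ℝ) ≤ n := by exact_mod_cast hn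
    linarith
  have hite : ∑ p ∈ Nat.primesLE (n + 1), (if p = 2 then 4 * (n : ℝ) * Real.log 2 else 0) ≤
      4 * n * Real.log 2 := by
    rw [Finset.sum_ite_eq']
    have := hlog0 2
    split_ifs
    · rfl
    · positivity
  calc Real.log (Nat.card H)
      = ∑ p ∈ (Nat.card H).primeFactors, (Nat.card H).factorization p * Real.log p := by
        rw [Real.log_nat_eq_sum_factorization]
        rfl
    _ ≤ ∑ p ∈ Nat.primesLE (n + 1), (Nat.card H).factorization p * Real.log p :=
        Finset.sum_le_sum_of_subset_of_nonneg hsub fun p _ _ =>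
          mul_nonneg (Nat.cast_nonneg _) (hlog0 p)
    _ ≤ _ := Finset.sum_le_sum hterm
    _ = n * (∑ p ∈ Nat.primesLE (n + 1), Real.log p / p +
          16 * ∑ p ∈ Nat.primesLE (n + 1), 1 / (p : ℝ) ^ (3 / 2 : ℝ)) +
        ∑ p ∈ Nat.primesLE (n + 1), (if p = 2 then 4 * (n : ℝ) * Real.log 2 else 0) := by
        rw [Finset.sum_add_distrib, ← Finset.mul_sum, Finset.sum_add_distrib, ← Finset.mul_sum]
    _ ≤ n * ((Real.log (n + 1 : ℕ) + Real.log 4) +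
          16 * ∑' k : ℕ, 1 / (k : ℝ) ^ (3 / 2 : ℝ)) + 4 * n * Real.log 2 := by
        gcongr
    _ ≤ _ := by linarith

/-- There is a constant `C > 0` such that for every `n ≥ 1`, every finite subgroup of
`GL_n(ℤ)` has order at most `n^n · exp(C·n)`. -/
theorem stmt_15 :
    ∃ C : ℝ, 0 < C ∧ ∀ n : ℕ, 1 ≤ n → ∀ H : Subgroup (GL (Fin n) ℤ),
      (H : Set (GL (Fin n) ℤ)).Finite →
        (Nat.card H : ℝ) ≤ (n : ℝ) ^ n * Real.exp (C * n) := by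
  refine ⟨1 + Real.log 4 + 16 * ∑' k : ℕ, 1 / (k : ℝ) ^ (3 / 2 : ℝ) + 4 * Real.log 2, ?_, ?_⟩
  · have h4 : 0 ≤ Real.log 4 := Real.log_nonneg (by norm_num)
    have h2 : 0 ≤ Real.log 2 := Real.log_nonneg (by norm_num)
    have hs : 0 ≤ ∑' k : ℕ, 1 / (k : ℝ) ^ (3 / 2 : ℝ) := tsum_nonneg fun k => by positivity
    positivity
  · intro n hn H hH
    have : Finite H := hH.to_subtype
    have hcard : (0 : ℝ) < Nat.card H := by exact_mod_cast Nat.card_pos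
    have hn0 : (0 : ℝ) < n := by exact_mod_cast hn
    rw [← Real.log_le_log_iff hcard (by positivity), Real.log_mul (by positivity) (by positivity),
      Real.log_pow, Real.log_exp]
    exact log_card_le hn H
end

section
/- Fix a real number ε with 1/2 < ε < 1 and a real number g ≥ 0. Suppose x₁, …, x_k are real numbers with 0 ≤ x_i ≤ ε·g for all i and Σ_{i=1}^{k} x_i = g. Then Σ_{i=1}^{k} x_i² ≤ g²·(ε² + (1−ε)²). -/
/-- If `1/2 < ε < 1`, `g ≥ 0`, and `x₁, …, x_k ∈ [0, εg]` sum to `g`, then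
`Σ x_i² ≤ g²(ε² + (1−ε)²)`. -/
theorem stmt_16 (ε : ℝ) (hε1 : 1 / 2 < ε) (hε2 : ε < 1) (g : ℝ) (hg : 0 ≤ g)
    (k : ℕ) (hk : 1 ≤ k) (x : Fin k → ℝ)
    (hx0 : ∀ i, 0 ≤ x i) (hx1 : ∀ i, x i ≤ ε * g) (hsum : ∑ i, x i = g) :
    ∑ i, (x i) ^ 2 ≤ g ^ 2 * (ε ^ 2 + (1 - ε) ^ 2) := by
  by_cases h : ∃ j, (1 - ε) * g ≤ x j
  · obtain ⟨j, hj⟩ := h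
    have hsplit := Finset.add_sum_erase Finset.univ x (Finset.mem_univ j)
    have hrest : ∑ i ∈ Finset.univ.erase j, x i ^ 2 ≤ (g - x j) ^ 2 := by
      rw [show g - x j = ∑ i ∈ Finset.univ.erase j, x i by linarith]
      exact Finset.sum_sq_le_sq_sum_of_nonneg fun i _ => hx0 i
    rw [← Finset.add_sum_erase Finset.univ (fun i => x i ^ 2) (Finset.mem_univ j)]
    nlinarith [mul_nonneg (sub_nonneg.2 hj) (sub_nonneg.2 (hx1 j))]
  · push Not at h
    calc ∑ i, x i ^ 2 ≤ ∑ i, (1 - ε) * g * x i :=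
          Finset.sum_le_sum fun i _ => by
            rw [sq]
            exact mul_le_mul_of_nonneg_right (h i).le (hx0 i)
      _ = g ^ 2 * (1 - ε) := by rw [← Finset.mul_sum, hsum]; ring
      _ ≤ g ^ 2 * (ε ^ 2 + (1 - ε) ^ 2) :=
          mul_le_mul_of_nonneg_left (by nlinarith) (sq_nonneg g)
end

section
/- Let k ≥ 1 and let d₁, …, d_k and n₁, …, n_k be positive integers. Set g := Σ_{i=1}^{k} d_i·n_i. If Σ_{i=1}^{k} d_i · n_i² · log(n_i) ≥ 0.99 · g² · log(g), then there exists an index i₀ with d_{i₀} = 1 and n_{i₀} ≥ 0.99·g. -/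
/-- Let `d₁, …, d_k` and `n₁, …, n_k` be positive integers and `g = Σ dᵢnᵢ`.  If
`Σ dᵢ·nᵢ²·log nᵢ ≥ 0.99·g²·log g`, then some index `i₀` has `d_{i₀} = 1` and
`n_{i₀} ≥ 0.99·g`. -/
theorem stmt_17 (k : ℕ) (hk : 1 ≤ k) (d n : Fin k → ℕ)
    (hd : ∀ i, 0 < d i) (hn : ∀ i, 0 < n i)
    (g : ℕ) (hg : g = ∑ i, d i * n i)
    (h : (0.99 : ℝ) * (g : ℝ) ^ 2 * Real.log g ≤
      ∑ i, (d i : ℝ) * (n i : ℝ) ^ 2 * Real.log (n i)) :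
    ∃ i₀, d i₀ = 1 ∧ (0.99 : ℝ) * (g : ℝ) ≤ (n i₀ : ℝ) := by
  have : Nonempty (Fin k) := ⟨⟨0, hk⟩⟩
  obtain ⟨i₀, hmax⟩ := Finite.exists_max n
  have hdn : d i₀ * n i₀ ≤ g :=
    hg ▸ Finset.single_le_sum (f := fun i => d i * n i) (fun _ _ => Nat.zero_le _)
      (Finset.mem_univ i₀)
  have hng : n i₀ ≤ g := (Nat.le_mul_of_pos_left _ (hd i₀)).trans hdn
  have hn₀ : (1 : ℝ) ≤ n i₀ := by exact_mod_cast hn i₀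
  have hng' : (n i₀ : ℝ) ≤ g := by exact_mod_cast hng
  have hsum : ∑ i, (d i : ℝ) * (n i : ℝ) ^ 2 * Real.log (n i) ≤
      g * (n i₀ * Real.log g) := by
    have hg' : (g : ℝ) = ∑ i, (d i : ℝ) * n i := by rw [hg]; push_cast; rfl
    calc ∑ i, (d i : ℝ) * (n i : ℝ) ^ 2 * Real.log (n i)
        ≤ ∑ i, (d i : ℝ) * n i * (n i₀ * Real.log g) := by
          refine Finset.sum_le_sum fun i _ => ?_
          have hi : (1 : ℝ) ≤ n i := by exact_mod_cast hn i
          have hi' : (n i : ℝ) ≤ n i₀ := by exact_mod_cast hmax i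
          have hl : Real.log (n i) ≤ Real.log g :=
            Real.log_le_log (by linarith) (hi'.trans hng')
          calc (d i : ℝ) * (n i : ℝ) ^ 2 * Real.log (n i)
              = d i * n i * (n i * Real.log (n i)) := by ring
            _ ≤ d i * n i * (n i₀ * Real.log g) := by
              have := Real.log_nonneg hi
              gcongr
      _ = g * (n i₀ * Real.log g) := by rw [← Finset.sum_mul, ← hg']
  have hbound : (0.99 : ℝ) * g ≤ n i₀ := by
    rcases (hn₀.trans hng').eq_or_lt with hg1 | hg1
    · rw [← hg1]; linarith
    · have hpos : 0 < (g : ℝ) * Real.log g := mul_pos (by linarith) (Real.log_pos hg1)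
      refine le_of_mul_le_mul_right ?_ hpos
      linarith
  refine ⟨i₀, ?_, hbound⟩
  have hdn' : (d i₀ : ℝ) * n i₀ ≤ g := by exact_mod_cast hdn
  by_contra hne
  have hd2 : 2 ≤ d i₀ := by have := hd i₀; omega
  have hd2' : (2 : ℝ) ≤ d i₀ := by exact_mod_cast hd2
  nlinarith
end
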